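/- arXiv:2206.00328 — 2 statements merged into one kernel-verified Lean document; each statement's English description precedes it below -/
import Mathlib

section
/- Adams–Hedberg inequality: let 0 < a < 5/q, 1 < p ≤ q < ∞ and f ∈ M^{p,q}_{t,x}(ℝ × ℝ³). Set ν = 1 - a q / 5. Then the parabolic Riesz potential I_a(f) belongs to M^{p/ν, q/ν}_{t,x}(ℝ × ℝ³) and ‖I_a(f)‖_{M^{p/ν,q/ν}} ≤ C ‖f‖_{M^{p,q}}. -/
open MeasureTheory ENNReal

/-- The parabolic Morrey norm on ℝ × ℝ³ (homogeneous dimension 5):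
‖φ‖_{M^{p,q}} = sup_{t₀,x₀,r>0} ( r^{-5(1-p/q)} ∫_{|t-t₀|<r²} ∫_{B(x₀,r)} ‖φ‖^p )^{1/p}. -/
noncomputable def morreyNorm {E : Type*} [NormedAddCommGroup E] (p q : ℝ)
    (f : ℝ → EuclideanSpace ℝ (Fin 3) → E) : ℝ≥0∞ :=
  ⨆ (t₀ : ℝ) (x₀ : EuclideanSpace ℝ (Fin 3)) (r : {r : ℝ // 0 < r}),
    (ENNReal.ofReal ((r : ℝ) ^ (-(5 : ℝ) * (1 - p / q))) *
      ∫⁻ t in Set.Ioo (t₀ - (r : ℝ) ^ 2) (t₀ + (r : ℝ) ^ 2),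
        ∫⁻ x in Metric.ball x₀ (r : ℝ), ENNReal.ofReal (‖f t x‖ ^ p)) ^ (1 / p)

/-- The parabolic Riesz potential I_a on ℝ × ℝ³. -/
noncomputable def rieszPot (a : ℝ)
    (f : ℝ → EuclideanSpace ℝ (Fin 3) → EuclideanSpace ℝ (Fin 3)) :
    ℝ → EuclideanSpace ℝ (Fin 3) → EuclideanSpace ℝ (Fin 3) :=
  fun t x => ∫ s : ℝ, ∫ y : EuclideanSpace ℝ (Fin 3),
    ((Real.sqrt |t - s| + ‖x - y‖) ^ (-(5 - a))) • f s y

local notation "E₃" => EuclideanSpace ℝ (Fin 3)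

/-- The open parabolic cylinder of radius `r` centred at `z`. -/
def parBall (z : ℝ × EuclideanSpace ℝ (Fin 3)) (r : ℝ) : Set (ℝ × EuclideanSpace ℝ (Fin 3)) :=
  Set.Ioo (z.1 - r ^ 2) (z.1 + r ^ 2) ×ˢ Metric.ball z.2 r

lemma mem_parBall {z w : ℝ × E₃} {r : ℝ} :
    w ∈ parBall z r ↔ |w.1 - z.1| < r ^ 2 ∧ dist w.2 z.2 < r := by
  simp only [parBall, Set.mem_prod, Set.mem_Ioo, Metric.mem_ball, abs_lt]
  constructor <;> rintro ⟨⟨h1, h2⟩, h3⟩ <;> exact ⟨⟨by linarith, by linarith⟩, h3⟩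

lemma isOpen_parBall (z : ℝ × E₃) (r : ℝ) : IsOpen (parBall z r) :=
  isOpen_Ioo.prod Metric.isOpen_ball

lemma measurableSet_parBall (z : ℝ × E₃) (r : ℝ) : MeasurableSet (parBall z r) :=
  (isOpen_parBall z r).measurableSet

lemma self_mem_parBall (z : ℝ × E₃) {r : ℝ} (hr : 0 < r) : z ∈ parBall z r := by
  rw [mem_parBall]
  simp [hr]

lemma mem_parBall_comm {z w : ℝ × E₃} {r : ℝ} : w ∈ parBall z r ↔ z ∈ parBall w r := by
  rw [mem_parBall, mem_parBall, abs_sub_comm, dist_comm]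

lemma mem_parBall_add {x y z : ℝ × E₃} {r s : ℝ} (hr : 0 < r) (hs : 0 < s)
    (h : x ∈ parBall y r) (h' : y ∈ parBall z s) : x ∈ parBall z (r + s) := by
  rw [mem_parBall] at *
  refine ⟨?_, (dist_triangle _ y.2 _).trans_lt (by linarith)⟩
  have := abs_sub_le x.1 y.1 z.1
  nlinarith [mul_pos hr hs]

lemma parBall_mono (z : ℝ × E₃) {r s : ℝ} (hr : 0 ≤ r) (h : r ≤ s) :
    parBall z r ⊆ parBall z s := by
  intro w hw
  rw [mem_parBall] at *
  exact ⟨hw.1.trans_le (by gcongr), hw.2.trans_le h⟩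

/-- The volume of the parabolic cylinder of radius one. -/
noncomputable def unitVol : ℝ≥0∞ := 2 * volume (Metric.ball (0 : EuclideanSpace ℝ (Fin 3)) 1)

lemma unitVol_ne_top : unitVol ≠ ∞ :=
  ENNReal.mul_ne_top (by simp) measure_ball_lt_top.ne

lemma volume_parBall (z : ℝ × E₃) {r : ℝ} (hr : 0 < r) :
    volume (parBall z r) = ENNReal.ofReal (r ^ 5) * unitVol := by
  rw [parBall, Measure.volume_eq_prod, Measure.prod_prod, Real.volume_Ioo,
    Measure.addHaar_ball volume z.2 hr.le, unitVol]
  have : z.1 + r ^ 2 - (z.1 - r ^ 2) = r ^ 2 * 2 := by ring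
  rw [this, ENNReal.ofReal_mul (by positivity)]
  have h5 : r ^ 5 = r ^ 2 * r ^ 3 := by ring
  rw [h5, ENNReal.ofReal_mul (by positivity)]
  simp only [finrank_euclideanSpace, Fintype.card_fin, ENNReal.ofReal_ofNat]
  ring

/-- The dyadic uncentred-in-scale parabolic maximal function. -/
noncomputable def parMax (G : ℝ × EuclideanSpace ℝ (Fin 3) → ℝ≥0∞)
    (z : ℝ × EuclideanSpace ℝ (Fin 3)) : ℝ≥0∞ :=
  ⨆ k : ℤ, ENNReal.ofReal ((2 : ℝ) ^ (-5 * k)) * ∫⁻ w in parBall z ((2 : ℝ) ^ k), G w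

lemma measurable_lintegral_parBall {G : ℝ × E₃ → ℝ≥0∞} (hG : Measurable G) (r : ℝ) :
    Measurable fun z => ∫⁻ w in parBall z r, G w := by
  have hS : MeasurableSet {v : (ℝ × E₃) × (ℝ × E₃) | v.2 ∈ parBall v.1 r} := by
    simp only [mem_parBall]
    apply MeasurableSet.inter
    · exact measurableSet_lt (f := fun v : (ℝ × E₃) × (ℝ × E₃) => |v.2.1 - v.1.1|)
        (g := fun _ => r ^ 2) (by fun_prop) (by fun_prop)
    · exact measurableSet_lt (f := fun v : (ℝ × E₃) × (ℝ × E₃) => dist v.2.2 v.1.2)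
        (g := fun _ => r) (by fun_prop) (by fun_prop)
  have h : Measurable fun v : (ℝ × E₃) × (ℝ × E₃) =>
      {v : (ℝ × E₃) × (ℝ × E₃) | v.2 ∈ parBall v.1 r}.indicator (fun v => G v.2) v :=
    (hG.comp measurable_snd).indicator hS
  convert h.lintegral_prod_right' (ν := volume) using 2 with z
  rw [← lintegral_indicator (measurableSet_parBall z r)]
  rfl

lemma measurable_parMax {G : ℝ × E₃ → ℝ≥0∞} (hG : Measurable G) : Measurable (parMax G) :=
  Measurable.iSup fun _ => (measurable_lintegral_parBall hG _).const_mul _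

lemma parMax_weak (G : ℝ × E₃ → ℝ≥0∞) (l : ℝ) (hl : 0 < l) :
    volume {z | ENNReal.ofReal l < parMax G z} * ENNReal.ofReal l ≤
      ENNReal.ofReal (3 ^ 5) * unitVol * ∫⁻ w, G w := by
  by_cases hI : ∫⁻ w, G w = ∞
  · have : unitVol ≠ 0 := mul_ne_zero (by simp) (Metric.measure_ball_pos _ _ one_pos).ne'
    rw [hI, ENNReal.mul_top (mul_ne_zero (by simp) this)]
    exact le_top
  set t : Set ((ℝ × E₃) × ℤ) := {a | ENNReal.ofReal l * ENNReal.ofReal ((2 : ℝ) ^ (5 * a.2)) <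
    ∫⁻ w in parBall a.1 ((2 : ℝ) ^ a.2), G w} with ht
  have hsub : {z | ENNReal.ofReal l < parMax G z} ⊆ {z | ∃ k : ℤ, (z, k) ∈ t} := by
    intro z hz
    simp only [parMax, Set.mem_ofPred_eq, lt_iSup_iff] at hz
    obtain ⟨k, hk⟩ := hz
    refine ⟨k, ?_⟩
    simp only [ht, Set.mem_ofPred_eq]
    have h0 : (0 : ℝ) < 2 ^ (5 * k) := by positivity
    have hc : ENNReal.ofReal ((2 : ℝ) ^ (-5 * k)) = (ENNReal.ofReal ((2 : ℝ) ^ (5 * k)))⁻¹ := by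
      rw [← ENNReal.ofReal_inv_of_pos h0, neg_mul, zpow_neg]
    rw [hc, mul_comm, ← div_eq_mul_inv] at hk
    exact (ENNReal.lt_div_iff_mul_lt (Or.inl (by simpa using h0))
      (Or.inl ENNReal.ofReal_ne_top)).1 hk
  have hbd : ∀ a ∈ t, (2 : ℝ) ^ a.2 ≤ max 1 ((∫⁻ w, G w).toReal / l) := by
    intro a ha
    by_contra! hlt
    have h1 : (1 : ℝ) < 2 ^ a.2 := (le_max_left _ _).trans_lt hlt
    have h2 : (∫⁻ w, G w).toReal / l < 2 ^ a.2 := (le_max_right _ _).trans_lt hlt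
    rw [div_lt_iff₀ hl] at h2
    have h3 : ENNReal.ofReal l * ENNReal.ofReal ((2 : ℝ) ^ (5 * a.2)) < ∫⁻ w, G w :=
      lt_of_lt_of_le ha (setLIntegral_le_lintegral _ _)
    rw [← ENNReal.ofReal_mul hl.le, ENNReal.ofReal_lt_iff_lt_toReal (by positivity) hI] at h3
    have h4 : (2 : ℝ) ^ a.2 ≤ 2 ^ (5 * a.2) := by
      rw [mul_comm, zpow_mul]
      exact_mod_cast le_self_pow₀ h1.le (by norm_num : (5 : ℕ) ≠ 0)
    nlinarith
  obtain ⟨u, hut, hdis, hcov⟩ := Vitali.exists_disjoint_subfamily_covering_enlargement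
    (fun a : (ℝ × E₃) × ℤ => parBall a.1 ((2 : ℝ) ^ a.2)) t (fun a => (2 : ℝ) ^ a.2) 2 one_lt_two
    (fun a _ => by positivity) _ hbd (fun a _ => ⟨a.1, self_mem_parBall _ (by positivity)⟩)
  have hcount : u.Countable := hdis.countable_of_isOpen (fun a _ => isOpen_parBall _ _)
    (fun a _ => ⟨a.1, self_mem_parBall _ (by positivity)⟩)
  have hcover : {z | ENNReal.ofReal l < parMax G z} ⊆
      ⋃ b ∈ u, parBall b.1 (3 * (2 : ℝ) ^ b.2) := by
    intro z hz
    obtain ⟨k, hk⟩ := hsub hz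
    obtain ⟨b, hbu, ⟨w, hw1, hw2⟩, hle⟩ := hcov _ hk
    refine Set.mem_biUnion hbu (parBall_mono _ (by positivity) ?_
      (mem_parBall_add (by positivity) (by positivity) (mem_parBall_comm.1 hw1) hw2))
    dsimp only at hle ⊢
    linarith
  have hc5 (k : ℤ) : ((2 : ℝ) ^ k) ^ 5 = 2 ^ (5 * k) := by
    rw [mul_comm, zpow_mul]; norm_cast
  calc volume {z | ENNReal.ofReal l < parMax G z} * ENNReal.ofReal l
      ≤ (∑' b : u, volume (parBall b.1.1 (3 * (2 : ℝ) ^ b.1.2))) * ENNReal.ofReal l := by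
        gcongr
        exact (measure_mono hcover).trans (measure_biUnion_le _ hcount _)
    _ = ∑' b : u, ENNReal.ofReal (3 ^ 5) * unitVol *
          (ENNReal.ofReal l * ENNReal.ofReal ((2 : ℝ) ^ (5 * b.1.2))) := by
        rw [← ENNReal.tsum_mul_right]
        congr 1
        ext b
        rw [volume_parBall _ (by positivity), mul_pow, hc5, ENNReal.ofReal_mul (by positivity)]
        ring
    _ ≤ ∑' b : u, ENNReal.ofReal (3 ^ 5) * unitVol *
          ∫⁻ w in parBall b.1.1 ((2 : ℝ) ^ b.1.2), G w := by
        gcongr with b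
        exact (hut b.2).le
    _ = ENNReal.ofReal (3 ^ 5) * unitVol *
          ∫⁻ w in ⋃ b ∈ u, parBall b.1 ((2 : ℝ) ^ b.2), G w := by
        rw [ENNReal.tsum_mul_left, lintegral_biUnion hcount
          (fun b _ => measurableSet_parBall _ _) hdis]
    _ ≤ _ := by
        gcongr
        exact Measure.restrict_le_self

lemma setLIntegral_Ioo_rpow {s h : ℝ} (hs : 0 < s) (hh : 0 ≤ h) :
    ∫⁻ l in Set.Ioo 0 h, ENNReal.ofReal (l ^ (s - 1)) = ENNReal.ofReal (h ^ s / s) := by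
  have hi : IntegrableOn (fun l : ℝ => l ^ (s - 1)) (Set.Ioc 0 h) :=
    (intervalIntegrable_iff_integrableOn_Ioc_of_le hh).1
      (intervalIntegral.intervalIntegrable_rpow' (by linarith))
  rw [← ofReal_integral_eq_lintegral_ofReal (hi.mono_set Set.Ioo_subset_Ioc_self),
    ← integral_Ioc_eq_integral_Ioo, ← intervalIntegral.integral_of_le hh,
    integral_rpow (Or.inl (by linarith))]
  · simp [Real.zero_rpow hs.ne']
  · filter_upwards [ae_restrict_mem measurableSet_Ioo] with l hl
    exact Real.rpow_nonneg hl.1.le _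

lemma lintegral_layer_rpow (H : ℝ≥0∞) {s : ℝ} (hs : 0 < s) :
    ∫⁻ l in Set.Ioi (0 : ℝ), {l | ENNReal.ofReal l < H}.indicator
      (fun l => ENNReal.ofReal (l ^ (s - 1))) l = H ^ s / ENNReal.ofReal s := by
  have hm (H : ℝ≥0∞) : MeasurableSet {l | ENNReal.ofReal l < H} :=
    measurableSet_lt (by fun_prop) (by fun_prop)
  have hfin (h : ℝ) (hh : 0 ≤ h) :
      ∫⁻ l in Set.Ioi (0 : ℝ), {l | ENNReal.ofReal l < ENNReal.ofReal h}.indicator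
      (fun l => ENNReal.ofReal (l ^ (s - 1))) l = ENNReal.ofReal (h ^ s / s) := by
    rw [lintegral_indicator (hm _), Measure.restrict_restrict (hm _),
      ← setLIntegral_Ioo_rpow hs hh]
    congr 2
    ext l
    simp only [Set.mem_inter_iff, Set.mem_ofPred_eq, Set.mem_Ioi, Set.mem_Ioo]
    constructor
    · rintro ⟨h1, h2⟩
      exact ⟨h2, (ENNReal.ofReal_lt_ofReal_iff_of_nonneg h2.le).1 h1⟩
    · rintro ⟨h1, h2⟩
      exact ⟨(ENNReal.ofReal_lt_ofReal_iff_of_nonneg h1.le).2 h2, h1⟩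
  rcases eq_or_ne H ∞ with rfl | hH
  · rw [ENNReal.top_rpow_of_pos hs, ENNReal.top_div_of_ne_top ENNReal.ofReal_ne_top]
    refine ENNReal.eq_top_of_forall_nnreal_le fun r => ?_
    have h := hfin ((r * s) ^ s⁻¹) (by positivity)
    rw [← Real.rpow_mul (by positivity), inv_mul_cancel₀ hs.ne', Real.rpow_one,
      mul_div_cancel_right₀ _ hs.ne', ENNReal.ofReal_coe_nnreal] at h
    rw [← h]
    refine lintegral_mono fun l => Set.indicator_le_indicator_of_subset ?_ (fun _ => zero_le) _
    intro l _
    exact ENNReal.ofReal_lt_top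
  · have h := hfin H.toReal ENNReal.toReal_nonneg
    rw [ENNReal.ofReal_toReal hH] at h
    rw [h, ENNReal.ofReal_div_of_pos hs, ← ENNReal.ofReal_rpow_of_nonneg ENNReal.toReal_nonneg hs.le,
      ENNReal.ofReal_toReal hH]

lemma lintegral_rpow_eq_layer {α : Type*} [MeasurableSpace α] {μ : Measure α} [SFinite μ]
    {H : α → ℝ≥0∞} (hH : Measurable H) {s : ℝ} (hs : 0 < s) :
    ∫⁻ z, H z ^ s ∂μ = ENNReal.ofReal s *
      ∫⁻ l in Set.Ioi (0 : ℝ), ENNReal.ofReal (l ^ (s - 1)) * μ {z | ENNReal.ofReal l < H z} := by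
  have h1 (z : α) : H z ^ s = ENNReal.ofReal s * ∫⁻ l in Set.Ioi (0 : ℝ),
      {l | ENNReal.ofReal l < H z}.indicator (fun l => ENNReal.ofReal (l ^ (s - 1))) l := by
    rw [lintegral_layer_rpow _ hs, ENNReal.mul_div_cancel (by simpa using hs) ENNReal.ofReal_ne_top]
  have hS : MeasurableSet {v : α × ℝ | ENNReal.ofReal v.2 < H v.1} :=
    measurableSet_lt (by fun_prop) (by fun_prop)
  have hmeas : Measurable fun v : α × ℝ =>
      {v : α × ℝ | ENNReal.ofReal v.2 < H v.1}.indicator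
        (fun v => ENNReal.ofReal (v.2 ^ (s - 1))) v :=
    Measurable.indicator (by fun_prop) hS
  simp_rw [h1]
  rw [lintegral_const_mul' _ _ ENNReal.ofReal_ne_top]
  congr 1
  refine (lintegral_lintegral_swap hmeas.aemeasurable).trans ?_
  refine lintegral_congr fun l => ?_
  rw [← setLIntegral_const, ← lintegral_indicator (measurableSet_lt (by fun_prop) (by fun_prop))]
  rfl

lemma parMax_le_add (G : ℝ × E₃ → ℝ≥0∞) (z : ℝ × E₃) (l : ℝ) :
    parMax G z ≤ parMax ({w | ENNReal.ofReal l < G w}.indicator G) z +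
      ENNReal.ofReal l * unitVol := by
  refine iSup_le fun k => ?_
  have hk : (0 : ℝ) < 2 ^ k := by positivity
  have h1 : ∫⁻ w in parBall z (2 ^ k), G w ≤
      (∫⁻ w in parBall z (2 ^ k), {w | ENNReal.ofReal l < G w}.indicator G w) +
        ENNReal.ofReal l * (ENNReal.ofReal ((2 : ℝ) ^ (5 * k)) * unitVol) := by
    have hc5 : ((2 : ℝ) ^ k) ^ 5 = 2 ^ (5 * k) := by
      rw [mul_comm, zpow_mul]; norm_cast
    rw [← hc5, ← volume_parBall z hk, ← setLIntegral_const, ← lintegral_add_right _ (by fun_prop)]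
    refine lintegral_mono fun w => ?_
    by_cases hw : ENNReal.ofReal l < G w
    · simp [Set.indicator, hw]
    · simp [Set.indicator, hw, not_lt.1 hw]
  have h2 : ENNReal.ofReal ((2 : ℝ) ^ (-5 * k)) * ENNReal.ofReal ((2 : ℝ) ^ (5 * k)) = 1 := by
    rw [← ENNReal.ofReal_mul (by positivity), ← zpow_add₀ two_ne_zero]
    simp
  calc _ ≤ ENNReal.ofReal ((2 : ℝ) ^ (-5 * k)) *
        ((∫⁻ w in parBall z (2 ^ k), {w | ENNReal.ofReal l < G w}.indicator G w) +
        ENNReal.ofReal l * (ENNReal.ofReal ((2 : ℝ) ^ (5 * k)) * unitVol)) := by gcongr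
    _ = ENNReal.ofReal ((2 : ℝ) ^ (-5 * k)) *
        (∫⁻ w in parBall z (2 ^ k), {w | ENNReal.ofReal l < G w}.indicator G w) +
        ENNReal.ofReal l * unitVol * (ENNReal.ofReal ((2 : ℝ) ^ (-5 * k)) *
          ENNReal.ofReal ((2 : ℝ) ^ (5 * k))) := by ring
    _ ≤ _ := by
      rw [h2, mul_one]
      refine add_le_add ?_ le_rfl
      exact le_iSup (fun k : ℤ => ENNReal.ofReal ((2 : ℝ) ^ (-5 * k)) *
        ∫⁻ w in parBall z ((2 : ℝ) ^ k), {w | ENNReal.ofReal l < G w}.indicator G w) k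

lemma parMax_strong {p : ℝ} (hp : 1 < p) : ∃ C : ℝ≥0∞, C ≠ ∞ ∧
    ∀ G : ℝ × E₃ → ℝ≥0∞, Measurable G → ∫⁻ z, parMax G z ^ p ≤ C * ∫⁻ z, G z ^ p := by
  have hK : 1 + unitVol ≠ ∞ := by simp [unitVol_ne_top]
  have hK0 : 1 + unitVol ≠ 0 := by simp
  have hp1 : 0 < p - 1 := by linarith
  refine ⟨(1 + unitVol) ^ p * (ENNReal.ofReal p * (ENNReal.ofReal (3 ^ 5) * unitVol *
    (ENNReal.ofReal (p - 1))⁻¹)), ?_, fun G hG => ?_⟩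
  · refine ENNReal.mul_ne_top (ENNReal.rpow_ne_top_of_nonneg (by linarith) hK) ?_
    refine ENNReal.mul_ne_top ENNReal.ofReal_ne_top (ENNReal.mul_ne_top
      (ENNReal.mul_ne_top ENNReal.ofReal_ne_top unitVol_ne_top) ?_)
    simpa using hp
  have hM : Measurable fun z => parMax G z / (1 + unitVol) := (measurable_parMax hG).div_const _
  have h1 : ∫⁻ z, parMax G z ^ p = (1 + unitVol) ^ p * ∫⁻ z, (parMax G z / (1 + unitVol)) ^ p := by
    rw [← lintegral_const_mul' _ _ (ENNReal.rpow_ne_top_of_nonneg (by linarith) hK)]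
    refine lintegral_congr fun z => ?_
    rw [← ENNReal.mul_rpow_of_nonneg _ _ (by linarith), ENNReal.mul_div_cancel hK0 hK]
  have hweak (l : ℝ) (hl : 0 < l) :
      ENNReal.ofReal l * volume {z | ENNReal.ofReal l < parMax G z / (1 + unitVol)} ≤
      ENNReal.ofReal (3 ^ 5) * unitVol * ∫⁻ w, {w | ENNReal.ofReal l < G w}.indicator G w := by
    rw [mul_comm]
    refine le_trans ?_ (parMax_weak _ l hl)
    refine mul_le_mul' (measure_mono fun z hz => ?_) le_rfl
    have hz := (ENNReal.lt_div_iff_mul_lt (Or.inl hK0) (Or.inl hK)).1 hz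
    have := hz.trans_le (parMax_le_add G z l)
    rw [mul_add, mul_one] at this
    exact lt_of_add_lt_add_right this
  have hS : MeasurableSet {v : ℝ × (ℝ × E₃) | ENNReal.ofReal v.1 < G v.2} :=
    measurableSet_lt (by fun_prop) (by fun_prop)
  have hmeas : Measurable fun v : ℝ × (ℝ × E₃) =>
      ENNReal.ofReal (v.1 ^ (p - 1 - 1)) *
        {v : ℝ × (ℝ × E₃) | ENNReal.ofReal v.1 < G v.2}.indicator (fun v => G v.2) v :=
    Measurable.mul (by fun_prop) ((hG.comp measurable_snd).indicator hS)
  have h2 : ∫⁻ l in Set.Ioi (0 : ℝ), ENNReal.ofReal (l ^ (p - 1)) *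
        volume {z | ENNReal.ofReal l < parMax G z / (1 + unitVol)} ≤
      ENNReal.ofReal (3 ^ 5) * unitVol * (ENNReal.ofReal (p - 1))⁻¹ * ∫⁻ z, G z ^ p := by
    calc _ ≤ ∫⁻ l in Set.Ioi (0 : ℝ), ENNReal.ofReal (3 ^ 5) * unitVol *
            ∫⁻ w, ENNReal.ofReal (l ^ (p - 1 - 1)) *
              {v : ℝ × (ℝ × E₃) | ENNReal.ofReal v.1 < G v.2}.indicator (fun v => G v.2) (l, w) := by
          refine setLIntegral_mono' measurableSet_Ioi fun l hl => ?_
          have hl : 0 < l := hl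
          have : l ^ (p - 1) = l ^ (p - 1 - 1) * l := by
            rw [Real.rpow_sub_one hl.ne' (p - 1), div_mul_cancel₀ _ hl.ne']
          rw [this, ENNReal.ofReal_mul (by positivity), mul_assoc,
            lintegral_const_mul' _ _ ENNReal.ofReal_ne_top]
          calc _ ≤ ENNReal.ofReal (l ^ (p - 1 - 1)) * (ENNReal.ofReal (3 ^ 5) * unitVol *
                ∫⁻ w, {w | ENNReal.ofReal l < G w}.indicator G w) := by
                exact mul_le_mul' le_rfl (hweak l hl)
            _ = _ := by
                rw [← mul_assoc, mul_comm (ENNReal.ofReal (l ^ _)), mul_assoc]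
                rfl
      _ = ENNReal.ofReal (3 ^ 5) * unitVol * ∫⁻ w, ∫⁻ l in Set.Ioi (0 : ℝ),
            ENNReal.ofReal (l ^ (p - 1 - 1)) *
              {v : ℝ × (ℝ × E₃) | ENNReal.ofReal v.1 < G v.2}.indicator (fun v => G v.2) (l, w) := by
          rw [lintegral_const_mul' _ _ (ENNReal.mul_ne_top ENNReal.ofReal_ne_top unitVol_ne_top),
            lintegral_lintegral_swap hmeas.aemeasurable]
      _ = ENNReal.ofReal (3 ^ 5) * unitVol * ∫⁻ w, (ENNReal.ofReal (p - 1))⁻¹ * G w ^ p := by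
          congr 1
          refine lintegral_congr fun w => ?_
          have : G w ^ p = G w ^ (p - 1) * G w := by
            conv_rhs => rw [← ENNReal.rpow_one (G w), ← ENNReal.rpow_mul,
              ← ENNReal.rpow_add_of_nonneg _ _ (by linarith) zero_le_one]
            simp
          rw [this, ← mul_assoc, mul_comm (_)⁻¹, ← div_eq_mul_inv, ← lintegral_layer_rpow _ hp1,
            ← lintegral_mul_const _ (Measurable.indicator (by fun_prop)
              (measurableSet_lt (by fun_prop) (by fun_prop)))]
          refine lintegral_congr fun l => ?_
          by_cases h : ENNReal.ofReal l < G w <;> simp [Set.indicator, h]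
      _ = _ := by
          rw [lintegral_const_mul _ (hG.pow_const p), ← mul_assoc]
  rw [h1, lintegral_rpow_eq_layer hM (by linarith), mul_assoc, mul_assoc]
  gcongr

/-- The Morrey growth condition: `F` has `M^{p,q}` norm at most `N`. -/
def MorreyBound (p q N : ℝ) (F : ℝ × EuclideanSpace ℝ (Fin 3) → ℝ≥0∞) : Prop :=
  ∀ (z : ℝ × EuclideanSpace ℝ (Fin 3)) (r : ℝ), 0 < r →
    ∫⁻ w in parBall z r, F w ^ p ≤ ENNReal.ofReal (N ^ p * r ^ (5 * (1 - p / q)))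

lemma MorreyBound.lintegral_le {p q N : ℝ} (hp : 1 < p) (hN : 0 < N)
    {F : ℝ × E₃ → ℝ≥0∞} (hF : Measurable F) (h : MorreyBound p q N F) (z : ℝ × E₃) {r : ℝ}
    (hr : 0 < r) : ∫⁻ w in parBall z r, F w ≤
      unitVol ^ (1 - 1 / p) * ENNReal.ofReal (N * r ^ (5 - 5 / q)) := by
  have hp0 : 0 < p := by linarith
  have hc := Real.HolderConjugate.conjExponent hp
  have h1 := ENNReal.lintegral_mul_le_Lp_mul_Lq (volume.restrict (parBall z r)) hc
    hF.aemeasurable (g := fun _ => 1) aemeasurable_const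
  simp only [Pi.mul_apply, mul_one, ENNReal.one_rpow, lintegral_const, one_mul,
    Measure.restrict_apply_univ] at h1
  have he : 1 / p.conjExponent = 1 - 1 / p := by
    have := hc.inv_add_inv_eq_one
    simp only [one_div]; linarith
  rw [he, volume_parBall z hr] at h1
  have hpos : 0 ≤ 1 - 1 / p := by rw [sub_nonneg, div_le_one hp0]; exact hp.le
  refine h1.trans ((mul_le_mul' (ENNReal.rpow_le_rpow (h z r hr) (by positivity)) le_rfl).trans ?_)
  rw [ENNReal.mul_rpow_of_nonneg _ _ hpos, ENNReal.ofReal_rpow_of_nonneg (by positivity)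
    (by positivity), ENNReal.ofReal_rpow_of_nonneg (by positivity) hpos, ← mul_assoc, mul_comm,
    ← ENNReal.ofReal_mul (by positivity)]
  refine le_of_eq ?_
  congr 2
  rw [Real.mul_rpow (by positivity) (by positivity), ← Real.rpow_mul hN.le,
    ← Real.rpow_natCast r 5, ← Real.rpow_mul hr.le, ← Real.rpow_mul hr.le, mul_assoc,
    ← Real.rpow_add hr]
  congr 1
  · rw [mul_one_div_cancel hp0.ne', Real.rpow_one]
  · congr 1
    push_cast
    field_simp
    ring

lemma lintegral_parBall_le_parMax (F : ℝ × E₃ → ℝ≥0∞) (z : ℝ × E₃) {r : ℝ} (hr : 0 < r) :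
    ∫⁻ w in parBall z r, F w ≤ ENNReal.ofReal ((2 * r) ^ 5) * parMax F z := by
  obtain ⟨k, hk1, hk2⟩ := exists_mem_Ioc_zpow hr one_lt_two
  have h1 : (2 : ℝ) ^ (k + 1) ≤ 2 * r := by rw [zpow_add_one₀ two_ne_zero]; linarith
  have h5 : ((2 : ℝ) ^ (k + 1)) ^ 5 = 2 ^ (5 * (k + 1)) := by
    rw [mul_comm, zpow_mul]; norm_cast
  have h2 : ENNReal.ofReal ((2 : ℝ) ^ (5 * (k + 1))) *
      ENNReal.ofReal ((2 : ℝ) ^ (-5 * (k + 1))) = 1 := by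
    rw [← ENNReal.ofReal_mul (by positivity), ← zpow_add₀ two_ne_zero]
    simp
  calc _ ≤ ∫⁻ w in parBall z (2 ^ (k + 1)), F w := lintegral_mono_set (parBall_mono _ hr.le hk2)
    _ = ENNReal.ofReal ((2 : ℝ) ^ (5 * (k + 1))) * (ENNReal.ofReal ((2 : ℝ) ^ (-5 * (k + 1))) *
          ∫⁻ w in parBall z (2 ^ (k + 1)), F w) := by rw [← mul_assoc, h2, one_mul]
    _ ≤ _ := by
        rw [← h5]
        gcongr
        exact le_iSup (fun k : ℤ => ENNReal.ofReal ((2 : ℝ) ^ (-5 * k)) *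
          ∫⁻ w in parBall z ((2 : ℝ) ^ k), F w) (k + 1)

lemma MorreyBound.parMax_le {p q N : ℝ} (hp : 1 < p) (hpq : p ≤ q) (hN : 0 < N)
    {F : ℝ × E₃ → ℝ≥0∞} (hF : Measurable F) (h : MorreyBound p q N F) {z z₀ : ℝ × E₃} {R : ℝ}
    (hR : 0 < R) (hz : z ∈ parBall z₀ R) :
    parMax F z ≤ parMax ((parBall z₀ (2 * R)).indicator F) z +
      unitVol ^ (1 - 1 / p) * ENNReal.ofReal (N * R ^ (-(5 / q))) := by
  refine iSup_le fun k => ?_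
  have hk : (0 : ℝ) < 2 ^ k := by positivity
  rcases lt_or_ge ((2 : ℝ) ^ k) R with hkR | hkR
  · refine le_add_right (le_trans (le_of_eq ?_)
      (le_iSup (fun k : ℤ => ENNReal.ofReal ((2 : ℝ) ^ (-5 * k)) *
          ∫⁻ w in parBall z ((2 : ℝ) ^ k), (parBall z₀ (2 * R)).indicator F w) k))
    congr 1
    refine setLIntegral_congr_fun (measurableSet_parBall _ _) fun w hw => ?_
    rw [Set.indicator_of_mem]
    rw [two_mul]
    exact mem_parBall_add hR hR (parBall_mono _ hk.le hkR.le hw) hz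
  · refine le_add_left ?_
    calc _ ≤ ENNReal.ofReal ((2 : ℝ) ^ (-5 * k)) *
          (unitVol ^ (1 - 1 / p) * ENNReal.ofReal (N * ((2 : ℝ) ^ k) ^ (5 - 5 / q))) := by
          gcongr
          exact h.lintegral_le hp hN hF z hk
      _ = unitVol ^ (1 - 1 / p) * ENNReal.ofReal (N * ((2 : ℝ) ^ k) ^ (-(5 / q))) := by
          rw [mul_left_comm, ← ENNReal.ofReal_mul (by positivity)]
          congr 2
          have : (2 : ℝ) ^ (-5 * k) = ((2 : ℝ) ^ k) ^ (-5 : ℝ) := by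
            rw [mul_comm, zpow_mul]; norm_cast
          rw [this, mul_left_comm, ← Real.rpow_add hk]
          congr 2
          ring
      _ ≤ _ := by
          have : 0 < q := by linarith
          refine mul_le_mul' le_rfl (ENNReal.ofReal_le_ofReal
            (mul_le_mul_of_nonneg_left ?_ hN.le))
          exact Real.rpow_le_rpow_of_nonpos hR hkR (neg_nonpos.2 (by positivity))

lemma MorreyBound.parMax_rpow {p q : ℝ} (hp : 1 < p) (hpq : p ≤ q) : ∃ C : ℝ≥0∞, C ≠ ∞ ∧
    ∀ (F : ℝ × E₃ → ℝ≥0∞) (N : ℝ), Measurable F → 0 < N → MorreyBound p q N F →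
    ∀ (z : ℝ × E₃) (R : ℝ), 0 < R → ∫⁻ w in parBall z R, parMax F w ^ p ≤
      C * ENNReal.ofReal (N ^ p * R ^ (5 * (1 - p / q))) := by
  obtain ⟨C, hC, hmax⟩ := parMax_strong hp
  have hp0 : 0 < p := by linarith
  have hq0 : 0 < q := by linarith
  have hpos : 0 ≤ 1 - 1 / p := by rw [sub_nonneg, div_le_one hp0]; exact hp.le
  set V := (unitVol ^ (1 - 1 / p)) ^ p with hV
  have hVt : V ≠ ∞ := ENNReal.rpow_ne_top_of_nonneg hp0.le
    (ENNReal.rpow_ne_top_of_nonneg hpos unitVol_ne_top)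
  refine ⟨2 ^ (p - 1) * (C * ENNReal.ofReal (2 ^ (5 * (1 - p / q))) + V * unitVol), ?_,
    fun F N hF hN h z R hR => ?_⟩
  · refine ENNReal.mul_ne_top (ENNReal.rpow_ne_top_of_nonneg (by linarith) (by simp)) ?_
    exact ENNReal.add_ne_top.2 ⟨ENNReal.mul_ne_top hC ENNReal.ofReal_ne_top,
      ENNReal.mul_ne_top hVt unitVol_ne_top⟩
  calc _ ≤ ∫⁻ w in parBall z R, (2 ^ (p - 1) *
        (parMax ((parBall z (2 * R)).indicator F) w ^ p +
          (unitVol ^ (1 - 1 / p) * ENNReal.ofReal (N * R ^ (-(5 / q)))) ^ p)) := by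
        refine setLIntegral_mono' (measurableSet_parBall _ _) fun w hw => ?_
        refine le_trans (ENNReal.rpow_le_rpow (h.parMax_le hp hpq hN hF hR hw) hp0.le) ?_
        exact ENNReal.rpow_add_le_mul_rpow_add_rpow _ _ hp.le
    _ = 2 ^ (p - 1) * ((∫⁻ w in parBall z R, parMax ((parBall z (2 * R)).indicator F) w ^ p) +
          (unitVol ^ (1 - 1 / p) * ENNReal.ofReal (N * R ^ (-(5 / q)))) ^ p *
            (ENNReal.ofReal (R ^ 5) * unitVol)) := by
        rw [lintegral_const_mul' _ _ (ENNReal.rpow_ne_top_of_nonneg (by linarith) (by simp)),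
          lintegral_add_right _ measurable_const, setLIntegral_const, volume_parBall z hR]
    _ ≤ 2 ^ (p - 1) * (C * ENNReal.ofReal (N ^ p * (2 * R) ^ (5 * (1 - p / q))) +
          V * unitVol * ENNReal.ofReal (N ^ p * R ^ (5 * (1 - p / q)))) := by
        refine mul_le_mul' le_rfl (add_le_add ?_ ?_)
        · refine (setLIntegral_le_lintegral _ _).trans ((hmax _
            (hF.indicator (measurableSet_parBall _ _))).trans ?_)
          gcongr
          refine le_trans (le_of_eq ?_) (h z (2 * R) (by positivity))
          rw [← lintegral_indicator (measurableSet_parBall _ _)]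
          refine lintegral_congr fun w => ?_
          by_cases hw : w ∈ parBall z (2 * R) <;> simp [hw, hp0]
        · rw [ENNReal.mul_rpow_of_nonneg _ _ hp0.le, ← hV,
            ENNReal.ofReal_rpow_of_nonneg (by positivity) hp0.le]
          have : N ^ p * R ^ (5 * (1 - p / q)) = (N * R ^ (-(5 / q))) ^ p * R ^ 5 := by
            rw [Real.mul_rpow hN.le (by positivity), ← Real.rpow_mul hR.le,
              ← Real.rpow_natCast R 5, mul_assoc, ← Real.rpow_add hR]
            congr 2
            push_cast
            field_simp
            ring
          rw [this, ENNReal.ofReal_mul (by positivity)]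
          refine le_of_eq ?_
          ring
    _ = _ := by
        rw [Real.mul_rpow zero_le_two hR.le, mul_left_comm (N ^ p), ENNReal.ofReal_mul
          (p := 2 ^ (5 * (1 - p / q))) (by positivity)]
        ring

/-- The parabolic Riesz kernel. -/
noncomputable def parKer (b : ℝ) (z w : ℝ × EuclideanSpace ℝ (Fin 3)) : ℝ :=
  (Real.sqrt |z.1 - w.1| + ‖z.2 - w.2‖) ^ (-b)

/-- The parabolic Riesz potential of a nonnegative function. -/
noncomputable def parPot (b : ℝ) (F : ℝ × EuclideanSpace ℝ (Fin 3) → ℝ≥0∞)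
    (z : ℝ × EuclideanSpace ℝ (Fin 3)) : ℝ≥0∞ :=
  ∫⁻ w, ENNReal.ofReal (parKer b z w) * F w

lemma parPot_le_tsum {b : ℝ} (hb : 0 < b) {F : ℝ × E₃ → ℝ≥0∞} (hF : Measurable F) (z : ℝ × E₃)
    {ρ : ℝ} (hρ : 0 < ρ) : parPot b F z ≤ ∑' j : ℤ, ENNReal.ofReal ((ρ * 2 ^ j) ^ (-b)) *
      ∫⁻ w in parBall z (2 * (ρ * 2 ^ j)), F w := by
  have h1 (w : ℝ × E₃) : ENNReal.ofReal (parKer b z w) * F w ≤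
      ∑' j : ℤ, ENNReal.ofReal ((ρ * 2 ^ j) ^ (-b)) *
        (parBall z (2 * (ρ * 2 ^ j))).indicator F w := by
    set d := Real.sqrt |z.1 - w.1| + ‖z.2 - w.2‖ with hd
    have hd0 : 0 ≤ d := by positivity
    rcases hd0.eq_or_lt with h0 | h0
    · simp [parKer, ← hd, ← h0, Real.zero_rpow (neg_ne_zero.2 hb.ne')]
    · obtain ⟨j, hj1, hj2⟩ := exists_mem_Ico_zpow (div_pos h0 hρ) one_lt_two
      rw [le_div_iff₀ hρ, mul_comm] at hj1
      rw [div_lt_iff₀ hρ, zpow_add_one₀ two_ne_zero, mul_right_comm, mul_comm, mul_comm _ ρ] at hj2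
      refine le_trans ?_ (ENNReal.le_tsum j)
      rw [Set.indicator_of_mem]
      · gcongr
        exact Real.rpow_le_rpow_of_nonpos (by positivity) hj1 (by linarith)
      · rw [mem_parBall, abs_sub_comm, dist_comm, dist_eq_norm]
        have hs := Real.sqrt_nonneg |z.1 - w.1|
        have hn := norm_nonneg (z.2 - w.2)
        refine ⟨(Real.sqrt_lt' (by positivity)).1 (by linarith), by linarith⟩
  calc _ ≤ _ := lintegral_mono h1
    _ = ∑' j : ℤ, ∫⁻ w, ENNReal.ofReal ((ρ * 2 ^ j) ^ (-b)) *
        (parBall z (2 * (ρ * 2 ^ j))).indicator F w :=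
      lintegral_tsum fun j => ((hF.indicator (measurableSet_parBall _ _)).const_mul _).aemeasurable
    _ = _ := by
      congr 1
      ext j
      rw [lintegral_const_mul' _ _ ENNReal.ofReal_ne_top,
        lintegral_indicator (measurableSet_parBall _ _)]

lemma tsum_two_zpow_rpow_le {a β ρ : ℝ} (hρ : 0 < ρ) {A B : ℝ≥0∞} (f : ℤ → ℝ≥0∞)
    (hA : ∀ j, f j ≤ A * ENNReal.ofReal ((ρ * 2 ^ j) ^ a))
    (hB : ∀ j, f j ≤ B * ENNReal.ofReal ((ρ * 2 ^ j) ^ (-β))) :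
    ∑' j, f j ≤ (1 - ENNReal.ofReal (2 ^ (-a)))⁻¹ * (A * ENNReal.ofReal (ρ ^ a)) +
      (1 - ENNReal.ofReal (2 ^ (-β)))⁻¹ * (B * ENNReal.ofReal (ρ ^ (-β))) := by
  have key (n : ℕ) (c : ℝ) (e : ℝ) : ENNReal.ofReal ((ρ * (2 : ℝ) ^ (c * n)) ^ e) =
      ENNReal.ofReal (ρ ^ e) * ENNReal.ofReal (2 ^ (c * e)) ^ n := by
    rw [Real.mul_rpow hρ.le (by positivity), ENNReal.ofReal_mul (by positivity),
      ← ENNReal.ofReal_pow (by positivity), ← Real.rpow_mul zero_le_two, ← Real.rpow_natCast,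
      ← Real.rpow_mul zero_le_two]
    congr 3
    ring
  have hsplit : ∑' j, f j ≤ (∑' n : ℕ, f (-n)) + ∑' n : ℕ, f n := by
    rw [tsum_of_nat_of_neg_add_one ENNReal.summable ENNReal.summable, add_comm]
    refine add_le_add ?_ le_rfl
    exact_mod_cast ENNReal.tsum_comp_le_tsum_of_injective (add_left_injective 1)
      (fun n : ℕ => f (-n))
  refine hsplit.trans (add_le_add ?_ ?_)
  · rw [← ENNReal.tsum_geometric, ← ENNReal.tsum_mul_right]
    refine ENNReal.tsum_le_tsum fun n => (hA _).trans (le_of_eq ?_)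
    have := key n (-1) a
    rw [neg_one_mul, neg_one_mul, Real.rpow_neg zero_le_two, Real.rpow_natCast] at this
    rw [zpow_neg, zpow_natCast, this]
    ring
  · rw [← ENNReal.tsum_geometric, ← ENNReal.tsum_mul_right]
    refine ENNReal.tsum_le_tsum fun n => (hB _).trans (le_of_eq ?_)
    have := key n 1 (-β)
    rw [one_mul, one_mul, Real.rpow_natCast] at this
    rw [zpow_natCast, this]
    ring

lemma MorreyBound.parPot_le {p q a : ℝ} (hp : 1 < p) (hpq : p ≤ q) (ha : 0 < a)
    (haq : a < 5 / q) : ∃ C : ℝ≥0∞, C ≠ ∞ ∧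
    ∀ (F : ℝ × E₃ → ℝ≥0∞) (N : ℝ), Measurable F → 0 < N → MorreyBound p q N F →
    ∀ (z : ℝ × E₃), parPot (5 - a) F z ≤
      C * (parMax F z ^ (1 - a * q / 5) * ENNReal.ofReal (N ^ (a * q / 5))) := by
  have hq0 : 0 < q := by linarith
  have hq1 : 1 ≤ q := by linarith
  have hp0 : 0 < p := by linarith
  have hq5 : 5 / q ≤ 5 := div_le_self (by norm_num) hq1
  have hν : 0 < 1 - a * q / 5 := by
    rw [lt_div_iff₀ hq0] at haq
    linarith
  have hpos : 0 ≤ 1 - 1 / p := by rw [sub_nonneg, div_le_one hp0]; exact hp.le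
  set V := unitVol ^ (1 - 1 / p) with hV
  have hVt : V ≠ ∞ := ENNReal.rpow_ne_top_of_nonneg hpos unitVol_ne_top
  have hgeo (e : ℝ) (he : 0 < e) : (1 - ENNReal.ofReal (2 ^ (-e)))⁻¹ ≠ ∞ := by
    rw [ENNReal.inv_ne_top, ← pos_iff_ne_zero, tsub_pos_iff_lt, ENNReal.ofReal_lt_one]
    exact Real.rpow_lt_one_of_one_lt_of_neg one_lt_two (by linarith)
  set C₁ := (1 - ENNReal.ofReal (2 ^ (-a)))⁻¹ with hC₁
  set C₂ := (1 - ENNReal.ofReal (2 ^ (-(5 / q - a))))⁻¹ with hC₂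
  have hC₁t : C₁ ≠ ∞ := hgeo a ha
  have hC₂t : C₂ ≠ ∞ := hgeo _ (by linarith)
  refine ⟨C₁ * ENNReal.ofReal (4 ^ 5) + C₂ * (V * ENNReal.ofReal (2 ^ 5)), ?_,
    fun F N hF hN h z => ?_⟩
  · exact ENNReal.add_ne_top.2 ⟨ENNReal.mul_ne_top hC₁t ENNReal.ofReal_ne_top,
      ENNReal.mul_ne_top hC₂t (ENNReal.mul_ne_top hVt ENNReal.ofReal_ne_top)⟩
  have hmain (ρ : ℝ) (hρ : 0 < ρ) : parPot (5 - a) F z ≤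
      C₁ * (ENNReal.ofReal (4 ^ 5) * parMax F z * ENNReal.ofReal (ρ ^ a)) +
      C₂ * (V * ENNReal.ofReal (2 ^ 5 * N) * ENNReal.ofReal (ρ ^ (-(5 / q - a)))) := by
    refine (parPot_le_tsum (by linarith) hF z hρ).trans (tsum_two_zpow_rpow_le hρ _ ?_ ?_)
    · intro j
      set x := ρ * 2 ^ j with hx
      have hx0 : 0 < x := by positivity
      refine (mul_le_mul' le_rfl (lintegral_parBall_le_parMax F z (by positivity))).trans
        (le_of_eq ?_)
      rw [← mul_assoc, ← ENNReal.ofReal_mul (by positivity), mul_right_comm,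
        ← ENNReal.ofReal_mul (by positivity)]
      congr 2
      have : x ^ a = x ^ (-(5 - a)) * x ^ 5 := by
        rw [← Real.rpow_natCast x 5, ← Real.rpow_add hx0]
        congr 1
        push_cast
        ring
      rw [this]
      ring
    · intro j
      set x := ρ * 2 ^ j with hx
      have hx0 : 0 < x := by positivity
      refine (mul_le_mul' le_rfl (h.lintegral_le hp hN hF z (by positivity))).trans ?_
      rw [mul_left_comm, mul_assoc, ← hV, ← ENNReal.ofReal_mul (by positivity),
        ← ENNReal.ofReal_mul (by positivity)]
      refine mul_le_mul' le_rfl (ENNReal.ofReal_le_ofReal ?_)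
      have h1 : (2 * x) ^ (5 - 5 / q) ≤ 2 ^ 5 * x ^ (5 - 5 / q) := by
        rw [Real.mul_rpow zero_le_two hx0.le]
        gcongr
        rw [← Real.rpow_natCast 2 5]
        refine Real.rpow_le_rpow_of_exponent_le one_le_two ?_
        push_cast
        linarith [div_pos (show (0:ℝ) < 5 by norm_num) hq0]
      have h2 : x ^ (-(5 / q - a)) = x ^ (-(5 - a)) * x ^ (5 - 5 / q) := by
        rw [← Real.rpow_add hx0]
        congr 1
        ring
      rw [h2]
      calc _ ≤ x ^ (-(5 - a)) * (N * (2 ^ 5 * x ^ (5 - 5 / q))) := by gcongr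
        _ = _ := by ring
  rcases eq_or_ne (parMax F z) ∞ with hM | hM
  · rw [hM, ENNReal.top_rpow_of_pos hν, ENNReal.top_mul (by simpa using Real.rpow_pos_of_pos hN _), ENNReal.mul_top]
    · exact le_top
    · refine (add_pos_of_pos_of_nonneg (ENNReal.mul_pos ?_ (by simp)) zero_le).ne'
      rw [hC₁, ENNReal.inv_ne_zero]
      exact (tsub_le_self.trans_lt one_lt_top).ne
  rcases eq_or_ne (parMax F z) 0 with hM0 | hM0
  · refine le_trans ?_ zero_le
    refine (parPot_le_tsum (by linarith) hF z one_pos).trans (le_of_eq ?_)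
    refine ENNReal.tsum_eq_zero.2 fun j => ?_
    have := lintegral_parBall_le_parMax F z (r := 2 * (1 * 2 ^ j)) (by positivity)
    rw [hM0, mul_zero, nonpos_iff_eq_zero] at this
    rw [this, mul_zero]
  obtain ⟨A, hA⟩ : ∃ A : ℝ, A = (parMax F z).toReal := ⟨_, rfl⟩
  have hA0 : 0 < A := hA ▸ ENNReal.toReal_pos hM0 hM
  have hAe : parMax F z = ENNReal.ofReal A := by rw [hA, ENNReal.ofReal_toReal hM]
  have hρ : 0 < (N / A) ^ (q / 5) := by positivity
  refine (hmain _ hρ).trans (le_of_eq ?_)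
  have e1 : A * ((N / A) ^ (q / 5)) ^ a = A ^ (1 - a * q / 5) * N ^ (a * q / 5) := by
    rw [← Real.rpow_mul (by positivity), Real.div_rpow hN.le hA0.le, Real.rpow_sub hA0,
      Real.rpow_one]
    have : q / 5 * a = a * q / 5 := by ring
    rw [this]
    ring
  have e2 : N * ((N / A) ^ (q / 5)) ^ (-(5 / q - a)) = A ^ (1 - a * q / 5) * N ^ (a * q / 5) := by
    rw [← Real.rpow_mul (by positivity)]
    have : q / 5 * (-(5 / q - a)) = -(1 - a * q / 5) := by field_simp
    rw [this, Real.rpow_neg (by positivity), ← Real.inv_rpow (by positivity), inv_div,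
      Real.div_rpow hA0.le hN.le, Real.rpow_sub hN, Real.rpow_one]
    field_simp
  rw [hAe, ENNReal.ofReal_rpow_of_pos hA0,
    ← ENNReal.ofReal_mul (p := A ^ (1 - a * q / 5)) (by positivity), ← e1, add_mul]
  congr 1
  · rw [ENNReal.ofReal_mul hA0.le]
    ring
  · rw [e1, ← e2, ENNReal.ofReal_mul (p := 2 ^ 5) (by positivity), ENNReal.ofReal_mul hN.le]
    ring

lemma MorreyBound.parPot_rpow {p q a : ℝ} (hp : 1 < p) (hpq : p ≤ q) (ha : 0 < a)
    (haq : a < 5 / q) : ∃ C : ℝ≥0∞, C ≠ ∞ ∧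
    ∀ (F : ℝ × E₃ → ℝ≥0∞) (N : ℝ), Measurable F → 0 < N → MorreyBound p q N F →
    ∀ (z : ℝ × E₃) (R : ℝ), 0 < R →
      ∫⁻ w in parBall z R, parPot (5 - a) F w ^ (p / (1 - a * q / 5)) ≤
      C * ENNReal.ofReal (N ^ (p / (1 - a * q / 5)) * R ^ (5 * (1 - p / q))) := by
  obtain ⟨C, hC, h1⟩ := MorreyBound.parPot_le hp hpq ha haq
  obtain ⟨C', hC', h2⟩ := MorreyBound.parMax_rpow hp hpq
  have hq0 : 0 < q := by linarith
  set ν := 1 - a * q / 5 with hν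
  have hν0 : 0 < ν := by
    rw [lt_div_iff₀ hq0] at haq
    linarith
  have hs : 0 ≤ p / ν := by positivity
  refine ⟨C ^ (p / ν) * C', ENNReal.mul_ne_top (ENNReal.rpow_ne_top_of_nonneg hs hC) hC',
    fun F N hF hN h z R hR => ?_⟩
  have hpt (w : ℝ × E₃) : parPot (5 - a) F w ^ (p / ν) ≤
      C ^ (p / ν) * ENNReal.ofReal (N ^ (p / ν - p)) * parMax F w ^ p := by
    refine (ENNReal.rpow_le_rpow (h1 F N hF hN h w) hs).trans (le_of_eq ?_)
    rw [ENNReal.mul_rpow_of_nonneg _ _ hs, ENNReal.mul_rpow_of_nonneg _ _ hs,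
      ENNReal.ofReal_rpow_of_nonneg (by positivity) hs, ← ENNReal.rpow_mul, ← Real.rpow_mul hN.le,
      mul_div_cancel₀ _ hν0.ne', mul_assoc, mul_comm (parMax F w ^ p)]
    congr 4
    have : a * q / 5 = 1 - ν := by rw [hν]; ring
    rw [this]
    field_simp
  calc _ ≤ _ := lintegral_mono hpt
    _ = C ^ (p / ν) * ENNReal.ofReal (N ^ (p / ν - p)) * ∫⁻ w in parBall z R, parMax F w ^ p :=
      lintegral_const_mul _ ((measurable_parMax hF).pow_const p)
    _ ≤ C ^ (p / ν) * ENNReal.ofReal (N ^ (p / ν - p)) *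
        (C' * ENNReal.ofReal (N ^ p * R ^ (5 * (1 - p / q)))) := by
      gcongr
      exact h2 F N hF hN h z R hR
    _ = _ := by
      have : N ^ (p / ν) = N ^ (p / ν - p) * N ^ p := by
        rw [← Real.rpow_add hN]; simp
      rw [this, mul_assoc (N ^ _), ENNReal.ofReal_mul (p := N ^ (p / ν - p)) (by positivity)]
      ring

lemma eq_zero_and_frequently_deriv_eq_zero {f f' : ℝ → ℝ} {c : ℝ}
    (hf : ∀ᶠ x in nhds c, HasDerivAt f (f' x) x) (h0 : ∃ᶠ x in nhdsWithin c {c}ᶜ, f x = 0) :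
    f c = 0 ∧ ∃ᶠ x in nhdsWithin c {c}ᶜ, f' x = 0 := by
  have hc : f c = 0 := by
    by_contra h
    have h1 := (hf.self_of_nhds.continuousAt.eventually_ne h).filter_mono
      (nhdsWithin_le_nhds (s := {c}ᶜ))
    obtain ⟨x, hx, hx'⟩ := (h0.and_eventually h1).exists
    exact hx' hx
  refine ⟨hc, ?_⟩
  rw [Filter.frequently_iff]
  intro U hU
  obtain ⟨ε, hε, hεU⟩ := Metric.mem_nhdsWithin_iff.1 hU
  obtain ⟨δ, hδ, hδf⟩ := Metric.eventually_nhds_iff_ball.1 hf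
  have hb : Metric.ball c (min ε δ) ∈ nhdsWithin c {c}ᶜ :=
    mem_nhdsWithin_of_mem_nhds (Metric.ball_mem_nhds _ (lt_min hε hδ))
  have hb' : {c}ᶜ ∈ nhdsWithin c {c}ᶜ := self_mem_nhdsWithin
  obtain ⟨x, ⟨hx1, hx2⟩, hx0⟩ := Filter.frequently_iff.1 h0 (Filter.inter_mem hb hb')
  rw [Metric.mem_ball, Real.dist_eq, lt_min_iff, abs_lt, abs_lt] at hx1
  have key : ∀ y, |y - c| < min ε δ → HasDerivAt f (f' y) y := fun y hy =>
    hδf y (by rw [Metric.mem_ball, Real.dist_eq]; exact hy.trans_le (min_le_right _ _))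
  have hin : ∀ y, |y - c| < min ε δ → y ≠ c → y ∈ U := fun y hy hyc =>
    hεU ⟨by rw [Metric.mem_ball, Real.dist_eq]; exact hy.trans_le (min_le_left _ _), hyc⟩
  simp only [lt_min_iff, abs_lt] at key hin
  rcases lt_or_gt_of_ne (show x ≠ c from hx2) with hlt | hlt
  · obtain ⟨y, hy, hy0⟩ := exists_hasDerivAt_eq_zero (f := f) (f' := f') hlt
      (fun y hy => (key y (by constructor <;> constructor <;> linarith [hy.1, hy.2])
        ).continuousAt.continuousWithinAt) (by rw [hx0, hc])
      (fun y hy => key y (by constructor <;> constructor <;> linarith [hy.1, hy.2]))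
    exact ⟨y, hin y (by constructor <;> constructor <;> linarith [hy.1, hy.2]) hy.2.ne, hy0⟩
  · obtain ⟨y, hy, hy0⟩ := exists_hasDerivAt_eq_zero (f := f) (f' := f') hlt
      (fun y hy => (key y (by constructor <;> constructor <;> linarith [hy.1, hy.2])
        ).continuousAt.continuousWithinAt) (by rw [hx0, hc])
      (fun y hy => key y (by constructor <;> constructor <;> linarith [hy.1, hy.2]))
    exact ⟨y, hin y (by constructor <;> constructor <;> linarith [hy.1, hy.2]) hy.1.ne', hy0⟩

section ShiftedPower

variable {Y : Type*} [MeasurableSpace Y] {μ : Measure Y} {u g : Y → ℝ} {b : ℝ}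

lemma integrable_shifted_rpow_of_le (hu : Measurable u) (hu0 : ∀ y, 0 ≤ u y)
    {c : ℝ} (hc : 0 < c) (hg : Integrable (fun y => (c + u y) ^ (-b) * g y) μ) {e : ℝ}
    (he : b ≤ e) : Integrable (fun y => (c + u y) ^ (-e) * g y) μ := by
  have h := hg.bdd_mul (f := fun y => (c + u y) ^ (-(e - b))) (c := c ^ (-(e - b)))
    ((hu.const_add c).pow_const _).aestronglyMeasurable (Filter.Eventually.of_forall fun y => by
      rw [Real.norm_of_nonneg (by have := hu0 y; positivity)]
      exact Real.rpow_le_rpow_of_nonpos hc (by linarith [hu0 y]) (by linarith))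
  refine h.congr (Filter.Eventually.of_forall fun y => ?_)
  have : 0 < c + u y := by linarith [hu0 y]
  simp only [← mul_assoc]
  rw [← Real.rpow_add this]
  ring_nf

lemma hasDerivAt_integral_shifted_rpow (hu : Measurable u) (hu0 : ∀ y, 0 ≤ u y) (hb : 0 < b)
    (hg : ∀ c > 0, Integrable (fun y => (c + u y) ^ (-b) * g y) μ) {e : ℝ} (he : b ≤ e)
    {c : ℝ} (hc : 0 < c) :
    HasDerivAt (fun c => ∫ y, (c + u y) ^ (-e) * g y ∂μ)
      (-e * ∫ y, (c + u y) ^ (-(e + 1)) * g y ∂μ) c := by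
  have hint : ∀ c > 0, ∀ e ≥ b, Integrable (fun y => (c + u y) ^ (-e) * g y) μ :=
    fun c hc e he => integrable_shifted_rpow_of_le hu hu0 hc (hg c hc) he
  have h := hasDerivAt_integral_of_dominated_loc_of_deriv_le (μ := μ) (𝕜 := ℝ)
    (F := fun c y => (c + u y) ^ (-e) * g y) (x₀ := c) (s := Set.Ioi (c / 2))
    (F' := fun c y => -e * ((c + u y) ^ (-(e + 1)) * g y))
    (bound := fun y => e * ‖(c / 2 + u y) ^ (-(e + 1)) * g y‖)
    (Ioi_mem_nhds (by linarith))
    (by filter_upwards [Ioi_mem_nhds hc] with x hx using (hint x hx e he).1)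
    (hint c hc e he)
    ((hint c hc (e + 1) (by linarith)).const_mul _).1
    (Filter.Eventually.of_forall fun y x hx => by
      have hx' : c / 2 < x := hx
      have := hu0 y
      have h3 : 0 < x := by linarith
      rw [norm_mul, norm_mul, norm_mul, norm_neg, Real.norm_of_nonneg (by linarith : 0 ≤ e),
        Real.norm_of_nonneg (Real.rpow_nonneg (by linarith) _),
        Real.norm_of_nonneg (Real.rpow_nonneg (by linarith) _)]
      have h2 : (x + u y) ^ (-(e + 1)) ≤ (c / 2 + u y) ^ (-(e + 1)) :=
        Real.rpow_le_rpow_of_nonpos (by linarith) (by linarith) (by linarith)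
      exact mul_le_mul_of_nonneg_left (mul_le_mul_of_nonneg_right h2 (norm_nonneg _))
        (by linarith))
    ((hint (c / 2) (by linarith) (e + 1) (by linarith)).norm.const_mul _)
    (Filter.Eventually.of_forall fun y x hx => by
      have hx' : c / 2 < x := hx
      have h3 : x + u y ≠ 0 := by have := hu0 y; linarith
      have := (((hasDerivAt_id x).add_const (u y)).rpow_const (p := -e) (Or.inl h3)).mul_const (g y)
      refine this.congr_deriv ?_
      simp only [id]
      rw [show -(e + 1) = -e - 1 by ring]
      ring)
  rw [integral_const_mul] at h
  exact h.2

lemma integral_shifted_rpow_eq_zero (hu : Measurable u) (hu0 : ∀ y, 0 ≤ u y) (hb : 0 < b)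
    (hg : ∀ c > 0, Integrable (fun y => (c + u y) ^ (-b) * g y) μ) {c : ℝ} (hc : 0 < c)
    (h0 : ∃ᶠ x in nhdsWithin c {c}ᶜ, ∫ y, (x + u y) ^ (-b) * g y ∂μ = 0) (k : ℕ) :
    ∫ y, (c + u y) ^ (-(b + k)) * g y ∂μ = 0 := by
  have hd (k : ℕ) : ∀ᶠ x in nhds c, HasDerivAt (fun c => ∫ y, (c + u y) ^ (-(b + k)) * g y ∂μ)
      (-(b + k) * ∫ y, (x + u y) ^ (-((b + k) + 1)) * g y ∂μ) x := by
    filter_upwards [Ioi_mem_nhds hc] with x hx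
    exact hasDerivAt_integral_shifted_rpow hu hu0 hb hg (by simp) hx
  have key (k : ℕ) : ∃ᶠ x in nhdsWithin c {c}ᶜ, ∫ y, (x + u y) ^ (-(b + k)) * g y ∂μ = 0 := by
    induction k with
    | zero => simpa using h0
    | succ k ih =>
      refine (eq_zero_and_frequently_deriv_eq_zero (hd k) ih).2.mono fun x hx => ?_
      have : b + k ≠ 0 := by positivity
      push_cast
      rw [← add_assoc]
      exact (mul_eq_zero.1 hx).resolve_left (neg_ne_zero.2 this)
  exact (eq_zero_and_frequently_deriv_eq_zero (hd k) (key k)).1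

lemma integral_shifted_rpow_mul_polynomial (hu : Measurable u) (hu0 : ∀ y, 0 ≤ u y)
    {c : ℝ} (hc : 0 < c) (hg : Integrable (fun y => (c + u y) ^ (-b) * g y) μ)
    (h0 : ∀ k : ℕ, ∫ y, (c + u y) ^ (-(b + k)) * g y ∂μ = 0) (P : Polynomial ℝ) :
    Integrable (fun y => P.eval (c + u y)⁻¹ * ((c + u y) ^ (-b) * g y)) μ ∧
      ∫ y, P.eval (c + u y)⁻¹ * ((c + u y) ^ (-b) * g y) ∂μ = 0 := by
  induction P using Polynomial.induction_on' with
  | add P Q hP hQ =>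
    simp only [Polynomial.eval_add, add_mul]
    refine ⟨hP.1.add hQ.1, ?_⟩
    rw [integral_add hP.1 hQ.1, hP.2, hQ.2, add_zero]
  | monomial n r =>
    have h1 : (fun y => (Polynomial.monomial n r).eval (c + u y)⁻¹ * ((c + u y) ^ (-b) * g y)) =
        fun y => r * ((c + u y) ^ (-(b + n)) * g y) := by
      funext y
      have : 0 < c + u y := by linarith [hu0 y]
      rw [Polynomial.eval_monomial, neg_add, Real.rpow_add this, inv_pow,
        Real.rpow_neg this.le n, Real.rpow_natCast]
      ring
    rw [h1]
    refine ⟨(integrable_shifted_rpow_of_le hu hu0 hc hg (by simp)).const_mul r, ?_⟩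
    rw [integral_const_mul, h0, mul_zero]

lemma integral_comp_mul_shifted_rpow_eq_zero (hu : Measurable u) (hu0 : ∀ y, 0 ≤ u y)
    {c : ℝ} (hc : 0 < c) (hg : Integrable (fun y => (c + u y) ^ (-b) * g y) μ)
    (h0 : ∀ k : ℕ, ∫ y, (c + u y) ^ (-(b + k)) * g y ∂μ = 0) {Ψ : ℝ → ℝ}
    (hΨ : ContinuousOn Ψ (Set.Icc 0 c⁻¹)) (hΨm : Measurable Ψ) :
    Integrable (fun y => Ψ (c + u y)⁻¹ * ((c + u y) ^ (-b) * g y)) μ ∧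
      ∫ y, Ψ (c + u y)⁻¹ * ((c + u y) ^ (-b) * g y) ∂μ = 0 := by
  have hmem (y : Y) : (c + u y)⁻¹ ∈ Set.Icc 0 c⁻¹ :=
    ⟨by have := hu0 y; positivity, inv_anti₀ hc (by linarith [hu0 y])⟩
  obtain ⟨M, hM⟩ := isCompact_Icc.exists_bound_of_continuousOn hΨ
  have hi : Integrable (fun y => Ψ (c + u y)⁻¹ * ((c + u y) ^ (-b) * g y)) μ :=
    hg.bdd_mul (c := M) (hΨm.comp (by fun_prop)).aestronglyMeasurable
      (Filter.Eventually.of_forall fun y => hM _ (hmem y))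
  refine ⟨hi, ?_⟩
  set I := ∫ y, ‖(c + u y) ^ (-b) * g y‖ ∂μ with hI
  have hI0 : 0 ≤ I := integral_nonneg fun y => norm_nonneg _
  rw [← norm_le_zero_iff]
  refine le_of_forall_pos_le_add fun ε hε => ?_
  rw [zero_add]
  obtain ⟨P, hP⟩ := exists_polynomial_near_of_continuousOn 0 c⁻¹ Ψ hΨ (ε / (I + 1)) (by positivity)
  obtain ⟨hP1, hP2⟩ := integral_shifted_rpow_mul_polynomial hu hu0 hc hg h0 P
  rw [← sub_zero (∫ y, Ψ (c + u y)⁻¹ * ((c + u y) ^ (-b) * g y) ∂μ), ← hP2, ← integral_sub hi hP1]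
  calc _ ≤ ∫ y, ε / (I + 1) * ‖(c + u y) ^ (-b) * g y‖ ∂μ := by
        refine norm_integral_le_of_norm_le (hg.norm.const_mul _)
          (Filter.Eventually.of_forall fun y => ?_)
        rw [← sub_mul, norm_mul]
        gcongr
        rw [norm_sub_rev]
        exact (hP _ (hmem y)).le
    _ = ε * (I / (I + 1)) := by rw [integral_const_mul, ← hI]; ring
    _ ≤ ε * 1 := by gcongr; rw [div_le_one (by positivity)]; linarith
    _ = ε := mul_one ε

end ShiftedPower

section SignedExp

variable {Y : Type*} [MeasurableSpace Y] {μ : Measure Y} {X h : Y → ℝ}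

lemma integrable_exp_mul_withDensity_ofReal (hh : AEMeasurable h μ) {t : ℝ}
    (hi : Integrable (fun y => Real.exp (t * X y) * h y) μ) :
    Integrable (fun y => Real.exp (t * X y)) (μ.withDensity fun y => ENNReal.ofReal (h y)) := by
  rw [integrable_withDensity_iff_integrable_smul₀' hh.ennreal_ofReal (by simp)]
  refine hi.pos_part.congr (Filter.Eventually.of_forall fun y => ?_)
  simp only [ENNReal.toReal_ofReal', smul_eq_mul]
  rw [← mul_zero (Real.exp (t * X y)), ← mul_max_of_nonneg _ _ (Real.exp_pos _).le, mul_zero,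
    mul_comm]

lemma integral_exp_mul_eq_mgf_sub_mgf (hh : AEMeasurable h μ) {t : ℝ}
    (hi : Integrable (fun y => Real.exp (t * X y) * h y) μ) :
    ∫ y, Real.exp (t * X y) * h y ∂μ =
      ProbabilityTheory.mgf X (μ.withDensity fun y => ENNReal.ofReal (h y)) t -
      ProbabilityTheory.mgf X (μ.withDensity fun y => ENNReal.ofReal (-h y)) t := by
  have h1 := (integrable_withDensity_iff_integrable_smul₀' hh.ennreal_ofReal (by simp)).1
    (integrable_exp_mul_withDensity_ofReal hh hi)
  have h2 := (integrable_withDensity_iff_integrable_smul₀' (f := fun y => ENNReal.ofReal (-h y))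
    hh.neg.ennreal_ofReal (by simp)).1
    (integrable_exp_mul_withDensity_ofReal (X := X) (h := fun y => -h y) (t := t) hh.neg
      (hi.neg.congr (Filter.Eventually.of_forall fun y => by simp)))
  rw [ProbabilityTheory.mgf, ProbabilityTheory.mgf,
    integral_withDensity_eq_integral_toReal_smul₀ hh.ennreal_ofReal (by simp),
    integral_withDensity_eq_integral_toReal_smul₀ (f := fun y => ENNReal.ofReal (-h y))
      hh.neg.ennreal_ofReal (by simp), ← integral_sub h1 h2]
  congr 1
  funext y
  simp only [ENNReal.toReal_ofReal', smul_eq_mul, ← sub_mul]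
  rw [max_zero_sub_max_neg_zero_eq_self, mul_comm]

lemma analyticOnNhd_integral_exp_mul (hh : AEMeasurable h μ)
    (hi : ∀ t : ℝ, Integrable (fun y => Real.exp (t * X y) * h y) μ) :
    AnalyticOnNhd ℝ (fun t : ℝ => ∫ y, Real.exp (t * X y) * h y ∂μ) Set.univ := by
  have key (h : Y → ℝ) (hh : AEMeasurable h μ)
      (hi : ∀ t : ℝ, Integrable (fun y => Real.exp (t * X y) * h y) μ) :
      AnalyticOnNhd ℝ (ProbabilityTheory.mgf X (μ.withDensity fun y => ENNReal.ofReal (h y)))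
        Set.univ := by
    have hs : ProbabilityTheory.integrableExpSet X
        (μ.withDensity fun y => ENNReal.ofReal (h y)) = Set.univ :=
      Set.eq_univ_of_forall fun t => integrable_exp_mul_withDensity_ofReal hh (hi t)
    have := ProbabilityTheory.analyticOnNhd_mgf (X := X)
      (μ := μ.withDensity fun y => ENNReal.ofReal (h y))
    rwa [hs, interior_univ] at this
  have e : (fun t : ℝ => ∫ y, Real.exp (t * X y) * h y ∂μ) = fun t =>
      ProbabilityTheory.mgf X (μ.withDensity fun y => ENNReal.ofReal (h y)) t -
      ProbabilityTheory.mgf X (μ.withDensity fun y => ENNReal.ofReal (-h y)) t :=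
    funext fun t => integral_exp_mul_eq_mgf_sub_mgf hh (hi t)
  rw [e]
  exact (key h hh hi).sub (key (fun y => -h y) hh.neg fun t =>
    (hi t).neg.congr (Filter.Eventually.of_forall fun y => by simp))

end SignedExp

section Laplace

variable {h : EuclideanSpace ℝ (Fin 3) → ℝ}

lemma ae_eq_zero_of_integral_exp_inner_eq_zero
    (hi : ∀ x : E₃, Integrable (fun y => Real.exp (inner ℝ x y) * h y))
    (h0 : ∀ x : E₃, ∫ y, Real.exp (inner ℝ x y) * h y = 0) : h =ᵐ[volume] 0 := by
  have hint : Integrable h := by simpa using hi 0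
  have hh : AEMeasurable h := hint.1.aemeasurable
  have hi' (x : E₃) (t : ℝ) : Integrable (fun y => Real.exp (t * inner ℝ x y) * h y) := by
    simpa [inner_smul_left] using hi (t • x)
  set μ₁ : Measure E₃ := volume.withDensity fun y => ENNReal.ofReal (h y)
  set μ₂ : Measure E₃ := volume.withDensity fun y => ENNReal.ofReal (-h y)
  have : IsFiniteMeasure μ₁ := isFiniteMeasure_withDensity_ofReal hint.2
  have : IsFiniteMeasure μ₂ := isFiniteMeasure_withDensity_ofReal hint.neg.2
  have hmgf (x : E₃) : ProbabilityTheory.mgf (fun y => inner ℝ x y) μ₁ =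
      ProbabilityTheory.mgf (fun y => inner ℝ x y) μ₂ := by
    funext t
    rw [← sub_eq_zero, ← integral_exp_mul_eq_mgf_sub_mgf hh (hi' x t)]
    simpa [inner_smul_left] using h0 (t • x)
  have hmass : μ₁ = 0 ↔ μ₂ = 0 := by
    have := congrFun (hmgf 0) 0
    simp only [ProbabilityTheory.mgf_zero'] at this
    rw [← Measure.measure_univ_eq_zero, ← measureReal_eq_zero_iff, this, measureReal_eq_zero_iff,
      Measure.measure_univ_eq_zero]
  have heq : μ₁ = μ₂ := by
    refine Measure.ext_of_charFun (funext fun x => ?_)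
    have hs : ProbabilityTheory.integrableExpSet (fun y => inner ℝ x y) μ₁ = Set.univ :=
      Set.eq_univ_of_forall fun t => integrable_exp_mul_withDensity_ofReal hh (hi' x t)
    have := ProbabilityTheory.eqOn_complexMGF_of_mgf' (hmgf x) hmass
      (x := Complex.I) (by simp [hs])
    simp only [ProbabilityTheory.complexMGF] at this
    simp only [charFun_apply]
    simpa only [real_inner_comm, mul_comm] using this
  have hd := (withDensity_eq_iff_of_sigmaFinite hh.ennreal_ofReal hh.neg.ennreal_ofReal).1 heq
  filter_upwards [hd] with y hy
  have := congrArg ENNReal.toReal hy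
  simp only [Pi.neg_apply, ENNReal.toReal_ofReal'] at this
  rw [← max_zero_sub_max_neg_zero_eq_self (h y), this, sub_self, Pi.zero_apply]

lemma integral_exp_inner_eq_zero_of_volume_ne_zero
    (hi : ∀ x : E₃, Integrable (fun y => Real.exp (inner ℝ x y) * h y)) {Z : Set E₃}
    (hZ : MeasurableSet Z) (hZ0 : volume Z ≠ 0)
    (h0 : ∀ x ∈ Z, ∫ y, Real.exp (inner ℝ x y) * h y = 0) (x : E₃) :
    ∫ y, Real.exp (inner ℝ x y) * h y = 0 := by
  have hint : Integrable h := by simpa using hi 0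
  have hh : AEMeasurable h := hint.1.aemeasurable
  set A : Set (ℝ × E₃) := {p | p.1 ∈ Set.Ioo (1 : ℝ) 2 ∧ x + p.1 • (p.2 - x) ∈ Z} with hA
  have hAm : MeasurableSet A := by
    refine (measurable_fst measurableSet_Ioo).inter ?_
    exact (by fun_prop : Measurable fun p : ℝ × E₃ => x + p.1 • (p.2 - x)) hZ
  have hA0 : volume A ≠ 0 := by
    rw [Measure.volume_eq_prod]
    intro h
    rw [Measure.measure_prod_null hAm] at h
    have h1 : ∀ᵐ r : ℝ, r ∉ Set.Ioo (1 : ℝ) 2 := by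
      filter_upwards [h] with r hr hr'
      have e : Prod.mk r ⁻¹' A = (fun z => (-x) + z) ⁻¹' ((r • ·) ⁻¹' ((x + ·) ⁻¹' Z)) := by
        ext z
        simp [hA, hr'.1, hr'.2, sub_eq_neg_add]
      rw [e, measure_preimage_add, Measure.addHaar_preimage_smul _ (by linarith [hr'.1]),
        measure_preimage_add] at hr
      have : 0 < |(r ^ Module.finrank ℝ E₃)⁻¹| := by
        have : 0 < r := by linarith [hr'.1]
        positivity
      exact mul_ne_zero (ENNReal.ofReal_pos.2 this).ne' hZ0 hr
    have h2 : volume (Set.Ioo (1 : ℝ) 2) = 0 := by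
      rw [measure_eq_zero_iff_ae_notMem]; exact h1
    norm_num at h2
  obtain ⟨z, hz⟩ : ∃ z : E₃, volume {r | (r, z) ∈ A} ≠ 0 := by
    by_contra! hcon
    apply hA0
    rw [Measure.volume_eq_prod, Measure.prod_apply_symm hAm]
    exact (lintegral_congr hcon).trans lintegral_zero
  have hinf : {r | (r, z) ∈ A}.Infinite := fun hf => hz (hf.measure_zero _)
  obtain ⟨r₀, -, hr₀⟩ := hinf.exists_accPt_of_subset_isCompact (isCompact_Icc (a := (1 : ℝ)) (b := 2))
    fun r hr => Set.Ioo_subset_Icc_self hr.1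
  rw [accPt_iff_frequently_nhdsNE] at hr₀
  have e (r : ℝ) : (fun y => Real.exp (inner ℝ (x + r • (z - x)) y) * h y) =
      fun y => Real.exp (r * inner ℝ (z - x) y) * (Real.exp (inner ℝ x y) * h y) := by
    funext y
    rw [inner_add_left, inner_smul_left, Real.exp_add]
    simp; ring
  have hana := analyticOnNhd_integral_exp_mul (X := fun y => inner ℝ (z - x) y)
    (h := fun y => Real.exp (inner ℝ x y) * h y) (hi x).1.aemeasurable
    (fun t => by rw [← e]; exact hi _)
  have := hana.eqOn_of_preconnected_of_frequently_eq (g := 0) analyticOnNhd_const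
    isPreconnected_univ (Set.mem_univ r₀) (hr₀.mono fun r hr => by
      simp only [← e]; exact h0 _ hr.2) (Set.mem_univ 0)
  simpa using this

end Laplace

lemma continuousOn_rpow_mul_exp_neg_sq {b : ℝ} (hb : 0 < b) (c M : ℝ) :
    ContinuousOn (fun v : ℝ => v ^ (-b) * Real.exp (-(v⁻¹ - c) ^ 2 / 2)) (Set.Icc 0 M) := by
  intro v hv
  rcases hv.1.eq_or_lt with rfl | hv0
  · refine ContinuousWithinAt.mono ?_ Set.Icc_subset_Ici_self
    rw [← continuousWithinAt_Ioi_iff_Ici, ContinuousWithinAt,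
      Real.zero_rpow (neg_ne_zero.2 hb.ne'), zero_mul]
    have h := ((tendsto_rpow_mul_exp_neg_mul_atTop_nhds_zero b 1 one_pos).comp
      (tendsto_inv_nhdsGT_zero (𝕜 := ℝ))).const_mul (Real.exp (c + 1 / 2))
    rw [mul_zero] at h
    refine squeeze_zero' ?_ ?_ h
    · filter_upwards [self_mem_nhdsWithin] with v hv
      have : 0 < v := hv
      positivity
    · filter_upwards [self_mem_nhdsWithin] with v hv
      have hv : 0 < v := hv
      simp only [Function.comp_apply]
      rw [Real.inv_rpow hv.le, ← Real.rpow_neg hv.le, mul_left_comm, ← Real.exp_add]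
      gcongr
      nlinarith [sq_nonneg (v⁻¹ - c - 1)]
  · refine ContinuousAt.continuousWithinAt ?_
    have : v ≠ 0 := hv0.ne'
    exact (Real.continuousAt_rpow_const _ _ (Or.inl this)).mul (by fun_prop (disch := assumption))

section Gaussian

variable {Y : Type*} [MeasurableSpace Y] {μ : Measure Y} {u g : Y → ℝ} {b : ℝ}

lemma rpow_mul_exp_shifted {b : ℝ} {c x : ℝ} (hc : 0 < c) (hx : 0 ≤ x) (r : ℝ) :
    ((c + x)⁻¹ ^ (-b) * Real.exp (-((c + x)⁻¹⁻¹ - c) ^ 2 / 2)) * ((c + x) ^ (-b) * r) =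
      Real.exp (-x ^ 2 / 2) * r := by
  have h : 0 < c + x := by linarith
  rw [inv_inv, add_sub_cancel_left, Real.inv_rpow h.le, Real.rpow_neg h.le]
  have := (Real.rpow_pos_of_pos h b).ne'
  field_simp

lemma integrable_exp_neg_sq_mul (hu : Measurable u) (hu0 : ∀ y, 0 ≤ u y) (hb : 0 < b) {c : ℝ}
    (hc : 0 < c) (hg : Integrable (fun y => (c + u y) ^ (-b) * g y) μ) :
    Integrable (fun y => Real.exp (-u y ^ 2 / 2) * g y) μ := by
  obtain ⟨M, hM⟩ := isCompact_Icc.exists_bound_of_continuousOn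
    (continuousOn_rpow_mul_exp_neg_sq hb c c⁻¹)
  refine (hg.bdd_mul (c := M)
    (f := fun y => (c + u y)⁻¹ ^ (-b) * Real.exp (-((c + u y)⁻¹⁻¹ - c) ^ 2 / 2))
    (by measurability) (Filter.Eventually.of_forall fun y => hM _ ⟨?_, ?_⟩)).congr
    (Filter.Eventually.of_forall fun y => rpow_mul_exp_shifted hc (hu0 y) _)
  · have := hu0 y; positivity
  · exact inv_anti₀ hc (by linarith [hu0 y])

lemma integral_exp_neg_sq_mul_eq_zero (hu : Measurable u) (hu0 : ∀ y, 0 ≤ u y) (hb : 0 < b)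
    (hg : ∀ c > 0, Integrable (fun y => (c + u y) ^ (-b) * g y) μ) {c : ℝ} (hc : 0 < c)
    (h0 : ∃ᶠ x in nhdsWithin c {c}ᶜ, ∫ y, (x + u y) ^ (-b) * g y ∂μ = 0) :
    ∫ y, Real.exp (-u y ^ 2 / 2) * g y ∂μ = 0 := by
  have := (integral_comp_mul_shifted_rpow_eq_zero hu hu0 hc (hg c hc)
    (integral_shifted_rpow_eq_zero hu hu0 hb hg hc h0)
    (continuousOn_rpow_mul_exp_neg_sq hb c c⁻¹) (by measurability)).2
  rw [← this]
  exact integral_congr_ae (Filter.Eventually.of_forall fun y =>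
    (rpow_mul_exp_shifted hc (hu0 y) _).symm)

end Gaussian

lemma integrable_rpow_add_norm_smul {F : Type*} [NormedAddCommGroup F] [NormedSpace ℝ F]
    {g : E₃ → F} {b c c' : ℝ} (hb : 0 < b) (hc : 0 < c) (hc' : 0 < c') {x : E₃} (x' : E₃)
    (h : Integrable (fun y => (c + ‖x - y‖) ^ (-b) • g y)) :
    Integrable (fun y => (c' + ‖x' - y‖) ^ (-b) • g y) := by
  refine (h.bdd_smul (φ := fun y => ((c' + ‖x' - y‖) / (c + ‖x - y‖)) ^ (-b))
    ((1 + (c + ‖x - x'‖) / c') ^ b)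
    ((by fun_prop : Measurable fun y => (c' + ‖x' - y‖) / (c + ‖x - y‖)).pow_const
      _).aestronglyMeasurable
    (Filter.Eventually.of_forall fun y => ?_)).congr (Filter.Eventually.of_forall fun y => ?_)
  · rw [Real.norm_of_nonneg (by positivity), Real.rpow_neg (by positivity),
      ← Real.inv_rpow (by positivity), inv_div]
    refine Real.rpow_le_rpow (by positivity) ?_ hb.le
    rw [div_le_iff₀ (by positivity)]
    have h1 : ‖x - y‖ ≤ ‖x - x'‖ + ‖x' - y‖ := norm_sub_le_norm_sub_add_norm_sub x x' y
    have h2 : c + ‖x - x'‖ ≤ (c + ‖x - x'‖) / c' * (c' + ‖x' - y‖) := by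
      rw [mul_add, div_mul_cancel₀ _ hc'.ne']
      have : 0 ≤ (c + ‖x - x'‖) / c' * ‖x' - y‖ := by positivity
      linarith
    linarith
  · simp only [Pi.smul_apply', smul_smul]
    rw [← Real.mul_rpow (by positivity) (by positivity), div_mul_cancel₀ _ (by positivity)]

lemma ae_eq_zero_of_frequently_integral_eq_zero {g : E₃ → ℝ} {b c : ℝ} (hb : 0 < b) (hc : 0 < c)
    (hg : Integrable (fun y => (1 + ‖y‖) ^ (-b) * g y)) {Z : Set E₃} (hZ : MeasurableSet Z)
    (hZ0 : volume Z ≠ 0)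
    (h0 : ∀ x ∈ Z, ∃ᶠ r in nhdsWithin c {c}ᶜ, ∫ y, (r + ‖x - y‖) ^ (-b) * g y = 0) :
    g =ᵐ[volume] 0 := by
  have hg' (x : E₃) : ∀ r > 0, Integrable (fun y => (r + ‖x - y‖) ^ (-b) * g y) := fun r hr => by
    have := integrable_rpow_add_norm_smul (c := 1) (x := 0) (g := g) hb one_pos hr x (by simpa)
    simpa
  have e (x y : E₃) : Real.exp (inner ℝ x y) * (Real.exp (-‖y‖ ^ 2 / 2) * g y) =
      Real.exp (‖x‖ ^ 2 / 2) * (Real.exp (-‖x - y‖ ^ 2 / 2) * g y) := by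
    rw [← mul_assoc, ← mul_assoc, ← Real.exp_add, ← Real.exp_add, norm_sub_sq_real]
    ring_nf
  have hm (x : E₃) : Measurable fun y : E₃ => ‖x - y‖ := by fun_prop
  have hi (x : E₃) : Integrable
      (fun y => Real.exp (inner ℝ x y) * (Real.exp (-‖y‖ ^ 2 / 2) * g y)) := by
    simp only [e]
    exact (integrable_exp_neg_sq_mul (hm x) (fun y => norm_nonneg _) hb one_pos
      (hg' x 1 one_pos)).const_mul _
  have hz := ae_eq_zero_of_integral_exp_inner_eq_zero hi
    (integral_exp_inner_eq_zero_of_volume_ne_zero hi hZ hZ0 fun x hx => by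
      simp only [e]
      rw [integral_const_mul, integral_exp_neg_sq_mul_eq_zero (hm x) (fun y => norm_nonneg _) hb
        (hg' x) hc (h0 x hx), mul_zero])
  filter_upwards [hz] with y hy
  exact (mul_eq_zero.1 hy).resolve_left (Real.exp_pos _).ne'

lemma continuous_integral_rpow_add_norm_smul {g : E₃ → E₃} {b c : ℝ} (hb : 0 < b) (hc : 0 < c)
    (hg : Integrable (fun y => (1 + ‖y‖) ^ (-b) • g y)) :
    Continuous fun x : E₃ => ∫ y, (c + ‖x - y‖) ^ (-b) • g y := by
  have hi (r : ℝ) (hr : 0 < r) (x : E₃) : Integrable (fun y => (r + ‖x - y‖) ^ (-b) • g y) :=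
    integrable_rpow_add_norm_smul (c := 1) (x := 0) hb one_pos hr x (by simpa)
  rw [continuous_iff_continuousAt]
  intro x₀
  refine continuousAt_of_dominated (bound := fun y => ‖(c / 2 + ‖x₀ - y‖) ^ (-b) • g y‖)
    (Filter.Eventually.of_forall fun x => (hi c hc x).1) ?_ (hi _ (by positivity) x₀).norm
    (Filter.Eventually.of_forall fun y => ?_)
  · filter_upwards [Metric.ball_mem_nhds x₀ (half_pos hc)] with x hx
    refine Filter.Eventually.of_forall fun y => ?_
    rw [norm_smul, norm_smul]
    refine mul_le_mul_of_nonneg_right ?_ (norm_nonneg _)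
    rw [Real.norm_of_nonneg (by positivity), Real.norm_of_nonneg (by positivity)]
    rw [Metric.mem_ball', dist_eq_norm] at hx
    exact Real.rpow_le_rpow_of_nonpos (by positivity)
      (by linarith [norm_sub_le_norm_sub_add_norm_sub x₀ x y]) (by linarith)
  · have h : c + ‖x₀ - y‖ ≠ 0 := by positivity
    have h1 : ContinuousAt (fun x => c + ‖x - y‖) x₀ := by fun_prop
    exact (h1.rpow_const (Or.inl h)).smul continuousAt_const

lemma ae_eq_zero_of_seq_integral_eq_zero {g : E₃ → E₃} {b : ℝ} (hb : 0 < b)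
    (hg : Integrable (fun y => (1 + ‖y‖) ^ (-b) • g y)) {c : ℕ → ℝ} {c₀ : ℝ} (hc₀ : 0 < c₀)
    (hc : ∀ n, 0 < c n) (hne : ∀ n, c n ≠ c₀) (hlim : Filter.Tendsto c Filter.atTop (nhds c₀))
    {Z D : ℕ → Set E₃} {B : Set E₃} (hB : volume B ≠ ∞) (hZB : ∀ n, Z n ⊆ B)
    (hZ : ∀ n, MeasurableSet (Z n)) {δ : ℝ≥0∞} (hδ : δ ≠ 0) (hZδ : ∀ n, δ ≤ volume (Z n))
    (hD : ∀ n, Z n ⊆ closure (D n))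
    (h0 : ∀ n, ∀ x ∈ D n, ∫ y, (c n + ‖x - y‖) ^ (-b) • g y = 0) : g =ᵐ[volume] 0 := by
  have hZ0 (n : ℕ) (x : E₃) (hx : x ∈ Z n) : ∫ y, (c n + ‖x - y‖) ^ (-b) • g y = 0 := by
    have hcl : IsClosed {x : E₃ | ∫ y, (c n + ‖x - y‖) ^ (-b) • g y = 0} :=
      isClosed_eq (continuous_integral_rpow_add_norm_smul hb (hc n) hg) continuous_const
    exact closure_minimal (h0 n) hcl (hD n hx)
  set L : Set E₃ := ⋂ n, ⋃ m ≥ n, Z m with hL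
  have hLm : MeasurableSet L := by measurability
  have hLδ : δ ≤ volume L := by
    have ht := tendsto_measure_iInter_atTop (μ := volume) (s := fun n => ⋃ m ≥ n, Z m)
      (fun n => (MeasurableSet.biUnion (Set.to_countable _) fun m _ => hZ m).nullMeasurableSet)
      (fun i j hij => Set.biUnion_subset_biUnion_left fun m hm => le_trans hij hm)
      ⟨0, ne_top_of_le_ne_top hB (measure_mono (Set.iUnion₂_subset fun m _ => hZB m))⟩
    exact ge_of_tendsto' ht fun n => (hZδ n).trans
      (measure_mono (Set.subset_biUnion_of_mem (u := Z) (le_refl n)))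
  have hlim' : Filter.Tendsto c Filter.atTop (nhdsWithin c₀ {c₀}ᶜ) :=
    tendsto_nhdsWithin_iff.2 ⟨hlim, Filter.Eventually.of_forall hne⟩
  have hcomp (i : Fin 3) : (fun y => g y i) =ᵐ[volume] 0 := by
    have hp (x : E₃) (r : ℝ) (hr : 0 < r) : (∫ y, (r + ‖x - y‖) ^ (-b) • g y) i =
        ∫ y, (r + ‖x - y‖) ^ (-b) * g y i := by
      have hi : Integrable (fun y => (r + ‖x - y‖) ^ (-b) • g y) :=
        integrable_rpow_add_norm_smul (c := 1) (x := 0) hb one_pos hr x (by simpa)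
      have := (EuclideanSpace.proj (𝕜 := ℝ) i : E₃ →L[ℝ] ℝ).integral_comp_comm hi
      simpa using this.symm
    refine ae_eq_zero_of_frequently_integral_eq_zero hb hc₀ ?_ hLm
      (fun h => hδ (le_zero_iff.1 (h ▸ hLδ))) fun x hx => ?_
    · simpa using (EuclideanSpace.proj (𝕜 := ℝ) i : E₃ →L[ℝ] ℝ).integrable_comp hg
    · refine hlim'.frequently (p := fun r => ∫ y, (r + ‖x - y‖) ^ (-b) * g y i = 0) ?_
      rw [Filter.frequently_atTop]
      intro n
      obtain ⟨m, hm, hxm⟩ := Set.mem_iUnion₂.1 (Set.mem_iInter.1 hx n)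
      exact ⟨m, hm, by rw [← hp x _ (hc m), hZ0 m x hxm]; rfl⟩
  filter_upwards [ae_all_iff.2 hcomp] with y hy
  ext i
  exact hy i

lemma exists_measurableSet_support_of_setLIntegral_ne_zero {Y : Type*} [MeasurableSpace Y]
    {μ : Measure Y} {f : Y → ℝ≥0∞} {B : Set Y} (hB : MeasurableSet B)
    (h : ∫⁻ y in B, f y ∂μ ≠ 0) :
    ∃ Z ⊆ B, MeasurableSet Z ∧ μ Z ≠ 0 ∧ ∀ y ∈ Z, f y ≠ 0 := by
  obtain ⟨k, hk, hkf, hki⟩ := exists_measurable_le_lintegral_eq (μ.restrict B) f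
  refine ⟨B ∩ Function.support k, Set.inter_subset_left,
    hB.inter (measurableSet_support hk), ?_, fun y hy hfy => hy.2 ?_⟩
  · rw [Set.inter_comm, ← Measure.restrict_apply (measurableSet_support hk)]
    rwa [hki, ← pos_iff_ne_zero, lintegral_pos_iff_support hk, pos_iff_ne_zero] at h
  · exact le_zero_iff.1 (hfy ▸ hkf y)

lemma exists_seq_support_of_lintegral_ne_zero {Y : Type*} [MeasurableSpace Y] {μ : Measure Y}
    {f : ℝ → Y → ℝ≥0∞} {B : Set Y} (hB : MeasurableSet B) {α β : ℝ}
    (h : ∫⁻ t in Set.Ioo α β, ∫⁻ y in B, f t y ∂μ ≠ 0) :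
    ∃ (t : ℕ → ℝ) (t₀ : ℝ) (Z : ℕ → Set Y) (δ : ℝ≥0∞), δ ≠ 0 ∧ (∀ n, t n ≠ t₀) ∧
      Filter.Tendsto t Filter.atTop (nhds t₀) ∧ (∀ n, Z n ⊆ B) ∧ (∀ n, MeasurableSet (Z n)) ∧
      (∀ n, δ ≤ μ (Z n)) ∧ ∀ n, ∀ y ∈ Z n, f (t n) y ≠ 0 := by
  set T : Set ℝ := {t | t ∈ Set.Ioo α β ∧ ∫⁻ y in B, f t y ∂μ ≠ 0} with hT
  have hZ (t : ℝ) : ∃ Z ⊆ B, MeasurableSet Z ∧ (t ∈ T → μ Z ≠ 0) ∧ ∀ y ∈ Z, f t y ≠ 0 := by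
    by_cases ht : t ∈ T
    · obtain ⟨Z, h1, h2, h3, h4⟩ := exists_measurableSet_support_of_setLIntegral_ne_zero hB ht.2
      exact ⟨Z, h1, h2, fun _ => h3, h4⟩
    · exact ⟨∅, by simp, by simp, fun h => absurd h ht, by simp⟩
  choose Z hZB hZm hZ0 hZf using hZ
  have hunc : ¬ T.Countable := by
    intro hc
    apply h
    rw [← lintegral_zero (μ := volume.restrict (Set.Ioo α β))]
    refine lintegral_congr_ae ?_
    filter_upwards [ae_restrict_mem measurableSet_Ioo,
      ae_restrict_of_ae (hc.ae_notMem volume)] with t ht htT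
    by_contra hne
    exact htT ⟨ht, hne⟩
  obtain ⟨k, hk⟩ : ∃ k : ℕ, {t | t ∈ T ∧ ((k : ℝ≥0∞) + 1)⁻¹ ≤ μ (Z t)}.Infinite := by
    by_contra! hcon
    refine hunc ((Set.countable_iUnion fun k => (hcon k).countable).mono
      fun t ht => ?_)
    obtain ⟨k, hk⟩ := ENNReal.exists_inv_nat_lt (hZ0 t ht)
    refine Set.mem_iUnion.2 ⟨k, ht, le_trans ?_ hk.le⟩
    exact ENNReal.inv_le_inv.2 le_self_add
  obtain ⟨t₀, -, ht₀⟩ := hk.exists_accPt_of_subset_isCompact (isCompact_Icc (a := α) (b := β))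
    fun t ht => Set.Ioo_subset_Icc_self ht.1.1
  rw [accPt_iff_frequently, Filter.frequently_iff_seq_forall] at ht₀
  obtain ⟨t, ht, htm⟩ := ht₀
  exact ⟨t, t₀, fun n => Z (t n), ((k : ℝ≥0∞) + 1)⁻¹, by simp, fun n => (htm n).1, ht,
    fun n => hZB _, fun n => hZm _, fun n => (htm n).2.2, fun n => hZf _⟩

lemma exists_dense_seq_of_nonempty {Y : Type*} [PseudoMetricSpace Y]
    [SecondCountableTopology Y] {Z : Set Y} (hZ : Z.Nonempty) :
    ∃ x : ℕ → Y, (∀ m, x m ∈ Z) ∧ Z ⊆ closure (Set.range x) := by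
  obtain ⟨D, hDZ, hDc, hD⟩ :=
    (TopologicalSpace.IsSeparable.of_separableSpace Z).exists_countable_dense_subset
  have hne : D.Nonempty := by
    rw [← closure_nonempty_iff]
    exact hZ.mono hD
  obtain ⟨x, rfl⟩ := hDc.exists_eq_range hne
  exact ⟨x, fun m => hDZ ⟨m, rfl⟩, hD⟩

lemma measurableSet_sep_mem_of_injective {S H D : Type*} [MeasurableSpace S]
    [StandardBorelSpace S] [MeasurableSpace H] [StandardBorelSpace H] [MeasurableSpace D]
    [StandardBorelSpace D] {S₀ : Set S} (hS₀ : MeasurableSet S₀)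
    {Φ : S × H → D} (hΦ : Measurable Φ)
    (hinj : ∀ s ∈ S₀, ∀ h h', Φ (s, h) = Φ (s, h') → h = h') {φ : S → H} {d : S → D}
    (hd : Measurable d) (hφ : ∀ s ∈ S₀, Φ (s, φ s) = d s) {U : Set H} (hU : MeasurableSet U) :
    MeasurableSet {s | s ∈ S₀ ∧ φ s ∈ U} := by
  have hΨ : Measurable fun p : S × H => (p.1, Φ p) := measurable_fst.prodMk hΦ
  have himg := (hS₀.prod hU).image_of_measurable_injOn hΨ (by
    rintro ⟨s, h⟩ hs ⟨s', h'⟩ - he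
    simp only [Prod.mk.injEq] at he
    obtain ⟨rfl, he⟩ := he
    rw [hinj s hs.1 h h' he])
  have : {s | s ∈ S₀ ∧ φ s ∈ U} = S₀ ∩ (fun s => (s, d s)) ⁻¹'
      (Set.image (fun p : S × H => (p.1, Φ p)) (S₀ ×ˢ U)) := by
    ext s
    simp only [Set.mem_ofPred_eq, Set.mem_inter_iff, Set.mem_preimage, Set.mem_image,
      Prod.exists, Prod.mk.injEq, Set.mem_prod, and_congr_right_iff]
    intro hs
    constructor
    · exact fun h => ⟨s, φ s, ⟨hs, h⟩, rfl, hφ s hs⟩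
    · rintro ⟨s', h, ⟨-, hh⟩, rfl, he⟩
      rwa [hinj s' hs (φ s') h (by rw [hφ s' hs, he])]
  rw [this]
  exact hS₀.inter ((measurable_id.prodMk hd) himg)

lemma continuous_integral_smul_Lp {k : E₃ → ℝ} (hk : Measurable k) {M : ℝ}
    (hM : ∀ y, |k y| ≤ M) :
    Continuous fun h : Lp E₃ 1 (volume : Measure E₃) => ∫ y, k y • h y := by
  have hM0 : 0 ≤ M := (abs_nonneg _).trans (hM 0)
  refine (LipschitzWith.of_dist_le_mul (K := M.toNNReal) fun h h' => ?_).continuous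
  have hi (h : Lp E₃ 1 (volume : Measure E₃)) : Integrable fun y => k y • h y :=
    (L1.integrable_coeFn h).bdd_smul M hk.aestronglyMeasurable
      (Filter.Eventually.of_forall hM)
  rw [dist_eq_norm, dist_eq_norm, ← integral_sub (hi h) (hi h'), L1.norm_eq_integral_norm]
  rw [Real.coe_toNNReal M hM0, ← integral_const_mul]
  refine norm_integral_le_of_norm_le ((L1.integrable_coeFn (h - h')).norm.const_mul _) ?_
  filter_upwards [Lp.coeFn_sub h h'] with y hy
  rw [hy, Pi.sub_apply, ← smul_sub, norm_smul]
  exact mul_le_mul_of_nonneg_right (hM y) (norm_nonneg _)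

section Lp

variable [MeasurableSpace (Lp (EuclideanSpace ℝ (Fin 3)) 1 (volume : Measure (EuclideanSpace ℝ (Fin 3))))]
  [BorelSpace (Lp (EuclideanSpace ℝ (Fin 3)) 1 (volume : Measure (EuclideanSpace ℝ (Fin 3))))]

lemma measurable_integral_smul_Lp {S : Type*} [MeasurableSpace S] {k : S → E₃ → ℝ}
    (hk : Measurable (Function.uncurry k)) (hM : ∀ s, ∃ M, ∀ y, |k s y| ≤ M) :
    Measurable fun p : S × Lp E₃ 1 (volume : Measure E₃) => ∫ y, k p.1 y • p.2 y := by
  have : Fact ((1 : ℝ≥0∞) ≠ ∞) := ⟨one_ne_top⟩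
  have : Measurable (Function.uncurry fun (h : Lp E₃ 1 (volume : Measure E₃)) (s : S) =>
      ∫ y, k s y • h y) := by
    refine measurable_uncurry_of_continuous_of_measurable (fun s => ?_) fun h => ?_
    · obtain ⟨M, hM⟩ := hM s
      exact continuous_integral_smul_Lp (hk.comp measurable_prodMk_left) hM
    · refine (StronglyMeasurable.integral_prod_right (f := fun s y => k s y • h y)
        ?_).measurable
      exact hk.stronglyMeasurable.smul ((Lp.stronglyMeasurable h).comp_measurable measurable_snd)
  exact this.comp measurable_swap

lemma exists_measurable_enorm_Lp : ∃ F : Lp E₃ 1 (volume : Measure E₃) × E₃ → ℝ≥0∞,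
    Measurable F ∧ ∀ h, ∀ᵐ y, F (h, y) = ‖h y‖ₑ := by
  refine ⟨fun p => Filter.limsup (fun n : ℕ => ‖⨍ y in Metric.closedBall p.2 (1 / ((n : ℝ) + 1)),
    p.1 y‖ₑ) Filter.atTop, ?_, fun h => ?_⟩
  · refine Measurable.limsup fun n => Measurable.enorm ?_
    simp only [setAverage_eq]
    have hball : MeasurableSet
        {p : E₃ × E₃ | p.2 ∈ Metric.closedBall p.1 (1 / ((n : ℝ) + 1))} :=
      measurableSet_le (measurable_snd.dist measurable_fst) measurable_const
    have hm := measurable_integral_smul_Lp (S := E₃) (k := fun x y =>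
      (Metric.closedBall x (1 / ((n : ℝ) + 1))).indicator (fun _ => (1 : ℝ)) y)
      ((measurable_const (a := (1 : ℝ))).indicator hball)
      (fun x => ⟨1, fun y => by
        by_cases hy : y ∈ Metric.closedBall x (1 / ((n : ℝ) + 1))
        · rw [Set.indicator_of_mem hy, abs_one]
        · rw [Set.indicator_of_notMem hy, abs_zero]
          exact zero_le_one⟩)
    have hv : Measurable fun x : E₃ => volume.real (Metric.closedBall x (1 / ((n : ℝ) + 1))) := by
      have : ∀ x : E₃, volume.real (Metric.closedBall x (1 / ((n : ℝ) + 1))) =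
          volume.real (Metric.closedBall (0 : E₃) (1 / ((n : ℝ) + 1))) := fun x => by
        rw [measureReal_def, measureReal_def, Measure.addHaar_closedBall_center]
      simp only [this]
      exact measurable_const
    refine ((hv.comp measurable_snd).inv).smul ?_
    convert hm.comp measurable_swap using 1
    funext p
    simp only [Function.comp_apply, Prod.fst_swap, Prod.snd_swap]
    rw [← integral_indicator measurableSet_closedBall]
    congr 1
    funext y
    by_cases hy : y ∈ Metric.closedBall p.2 (1 / ((n : ℝ) + 1))
    · rw [Set.indicator_of_mem hy, Set.indicator_of_mem hy, one_smul]
    · rw [Set.indicator_of_notMem hy, Set.indicator_of_notMem hy, zero_smul]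
  · filter_upwards [IsUnifLocDoublingMeasure.ae_tendsto_average volume
      (L1.integrable_coeFn h).locallyIntegrable 1] with y hy
    refine Filter.Tendsto.limsup_eq ?_
    refine (hy (fun _ => y) (fun n : ℕ => 1 / ((n : ℝ) + 1)) ?_ ?_).enorm
    · exact tendsto_nhdsWithin_iff.2 ⟨tendsto_one_div_add_atTop_nhds_zero_nat,
        Filter.Eventually.of_forall fun n => by simp only [Set.mem_Ioi]; positivity⟩
    · exact Filter.Eventually.of_forall fun n => Metric.mem_closedBall_self (by positivity)

end Lp

/-- The kernel `(c + ‖x - y‖) ^ (-b)` relative to the weight `(1 + ‖y‖) ^ (-b)`. -/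
noncomputable def relKer (b c : ℝ) (x y : EuclideanSpace ℝ (Fin 3)) : ℝ :=
  if c = 0 then 0 else ((1 + ‖y‖) / (c + ‖x - y‖)) ^ b

lemma relKer_mul {b c : ℝ} (hc : 0 < c) (x y : E₃) :
    relKer b c x y * (1 + ‖y‖) ^ (-b) = (c + ‖x - y‖) ^ (-b) := by
  have h1 : 0 < 1 + ‖y‖ := by positivity
  have h2 : 0 < c + ‖x - y‖ := by positivity
  rw [relKer, if_neg hc.ne', Real.div_rpow h1.le h2.le, Real.rpow_neg h1.le, Real.rpow_neg h2.le]
  have := (Real.rpow_pos_of_pos h1 b).ne'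
  field_simp

lemma abs_relKer_le {b c : ℝ} (hb : 0 ≤ b) (hc : 0 ≤ c) (x : E₃) :
    ∃ M, ∀ y, |relKer b c x y| ≤ M := by
  rcases hc.eq_or_lt with rfl | hc
  · exact ⟨0, fun y => by simp [relKer]⟩
  refine ⟨((1 + ‖x‖) / c + 1) ^ b, fun y => ?_⟩
  have h2 : 0 < c + ‖x - y‖ := by positivity
  rw [relKer, if_neg hc.ne', abs_of_nonneg (by positivity)]
  refine Real.rpow_le_rpow (by positivity) ?_ hb
  rw [div_le_iff₀ h2]
  have h3 : ‖y‖ ≤ ‖x‖ + ‖x - y‖ := by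
    have := norm_sub_le x (x - y)
    simpa using this
  have h4 : (1 + ‖x‖) / c * c = 1 + ‖x‖ := div_mul_cancel₀ _ hc.ne'
  have h5 : 0 ≤ (1 + ‖x‖) / c * ‖x - y‖ := by positivity
  nlinarith

lemma measurable_relKer {S : Type*} [MeasurableSpace S] (b : ℝ) {c : S → ℝ} (hc : Measurable c)
    (x : E₃) : Measurable (Function.uncurry fun s y => relKer b (c s) x y) := by
  have hc' : Measurable fun p : S × E₃ => c p.1 := hc.comp measurable_fst
  refine Measurable.ite (hc' (measurableSet_singleton 0)) measurable_const ?_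
  exact Measurable.pow_const (by fun_prop) b

/-- The class in `L¹` of `(1 + ‖y‖) ^ (-b) • g y`, or `0` if this is not integrable. -/
noncomputable def weightedL1 (b : ℝ) (g : EuclideanSpace ℝ (Fin 3) → EuclideanSpace ℝ (Fin 3)) :
    Lp (EuclideanSpace ℝ (Fin 3)) 1 (volume : Measure (EuclideanSpace ℝ (Fin 3))) :=
  open scoped Classical in
  if h : Integrable (fun y => (1 + ‖y‖) ^ (-b) • g y) then h.toL1 else 0

lemma coeFn_weightedL1 {b : ℝ} {g : E₃ → E₃} (h : Integrable (fun y => (1 + ‖y‖) ^ (-b) • g y)) :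
    weightedL1 b g =ᵐ[volume] fun y => (1 + ‖y‖) ^ (-b) • g y := by
  rw [weightedL1, dif_pos h]
  exact h.coeFn_toL1

lemma integral_relKer_smul_weightedL1 {b c : ℝ} (hb : 0 < b) (hc : 0 < c) (x : E₃) (g : E₃ → E₃) :
    ∫ y, relKer b c x y • weightedL1 b g y = ∫ y, (c + ‖x - y‖) ^ (-b) • g y := by
  by_cases h : Integrable (fun y => (1 + ‖y‖) ^ (-b) • g y)
  · refine integral_congr_ae ?_
    filter_upwards [coeFn_weightedL1 h] with y hy
    rw [hy, smul_smul, relKer_mul hc]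
  · have h0 : weightedL1 b g = 0 := by rw [weightedL1, dif_neg h]
    rw [integral_undef (f := fun y => (c + ‖x - y‖) ^ (-b) • g y) fun h' => h (by
      simpa using integrable_rpow_add_norm_smul hb hc one_pos 0 h'), h0]
    refine (integral_congr_ae ?_).trans (integral_zero _ _)
    filter_upwards [Lp.coeFn_zero E₃ 1 (volume : Measure E₃)] with y hy
    rw [hy, Pi.zero_apply, smul_zero]

lemma eq_of_integral_relKer_smul_eq {b : ℝ} (hb : 0 < b) {c : ℕ → ℝ} {c₀ : ℝ} (hc₀ : 0 < c₀)
    (hc : ∀ n, 0 < c n) (hne : ∀ n, c n ≠ c₀) (hlim : Filter.Tendsto c Filter.atTop (nhds c₀))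
    {Z : ℕ → Set E₃} {x : ℕ → ℕ → E₃} {B : Set E₃} (hB : volume B ≠ ∞) (hZB : ∀ n, Z n ⊆ B)
    (hZ : ∀ n, MeasurableSet (Z n)) {δ : ℝ≥0∞} (hδ : δ ≠ 0) (hZδ : ∀ n, δ ≤ volume (Z n))
    (hx : ∀ n, Z n ⊆ closure (Set.range (x n))) {h h' : Lp E₃ 1 (volume : Measure E₃)}
    (heq : ∀ n m, ∫ y, relKer b (c n) (x n m) y • h y = ∫ y, relKer b (c n) (x n m) y • h' y) :
    h = h' := by
  set g : E₃ → E₃ := fun y => (1 + ‖y‖) ^ b • (h y - h' y) with hg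
  have hw (y : E₃) : (1 + ‖y‖) ^ (-b) • g y = h y - h' y := by
    have h1 : 0 < 1 + ‖y‖ := by positivity
    rw [hg, smul_smul, ← Real.rpow_add h1, neg_add_cancel, Real.rpow_zero, one_smul]
  have hi (k : Lp E₃ 1 (volume : Measure E₃)) (n m : ℕ) :
      Integrable fun y => relKer b (c n) (x n m) y • k y := by
    obtain ⟨M, hM⟩ := abs_relKer_le hb.le (hc n).le (x n m)
    exact (L1.integrable_coeFn k).bdd_smul M
      ((measurable_relKer (S := Unit) b measurable_const (x n m)).comp
        (measurable_prodMk_left (x := ()))).aestronglyMeasurable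
      (Filter.Eventually.of_forall hM)
  have h0 : g =ᵐ[volume] 0 := by
    refine ae_eq_zero_of_seq_integral_eq_zero hb ?_ hc₀ hc hne hlim hB hZB hZ hδ hZδ hx ?_
    · simp only [hw]
      exact (L1.integrable_coeFn h).sub (L1.integrable_coeFn h')
    · rintro n _ ⟨m, rfl⟩
      simp only [← relKer_mul (hc n), mul_smul, hw, smul_sub]
      rw [integral_sub (hi h n m) (hi h' n m), heq, sub_self]
  refine Lp.ext ?_
  filter_upwards [h0] with y hy
  have := hw y
  rw [hy, Pi.zero_apply, smul_zero] at this
  exact (sub_eq_zero.1 this.symm)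

lemma exists_measurable_enorm_of_aestronglyMeasurable_integral {b : ℝ} (hb : 0 < b)
    {f : ℝ → E₃ → E₃} {t : ℕ → ℝ} {t₀ : ℝ} (hne : ∀ n, t n ≠ t₀)
    (hlim : Filter.Tendsto t Filter.atTop (nhds t₀)) {Z : ℕ → Set E₃} {x : ℕ → ℕ → E₃}
    {B : Set E₃} (hB : volume B ≠ ∞) (hZB : ∀ n, Z n ⊆ B) (hZ : ∀ n, MeasurableSet (Z n))
    {δ : ℝ≥0∞} (hδ : δ ≠ 0) (hZδ : ∀ n, δ ≤ volume (Z n))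
    (hx : ∀ n, Z n ⊆ closure (Set.range (x n)))
    (hf : ∀ n m, AEStronglyMeasurable
      (fun s => ∫ y, (Real.sqrt |t n - s| + ‖x n m - y‖) ^ (-b) • f s y) volume) :
    ∃ F : ℝ × E₃ → ℝ≥0∞, Measurable F ∧ ∀ᵐ s,
      (Integrable (fun y => (1 + ‖y‖) ^ (-b) • f s y) → ∀ᵐ y, F (s, y) = ‖f s y‖ₑ) ∧
      (¬ Integrable (fun y => (1 + ‖y‖) ^ (-b) • f s y) → ∀ᵐ y, F (s, y) = 0) := by
  let _ : MeasurableSpace (Lp E₃ 1 (volume : Measure E₃)) := borel _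
  have : BorelSpace (Lp E₃ 1 (volume : Measure E₃)) := ⟨rfl⟩
  classical
  have : Fact ((1 : ℝ≥0∞) ≠ ∞) := ⟨one_ne_top⟩
  have hae : ∀ᵐ s : ℝ, s ≠ t₀ ∧ ∀ n, s ≠ t n ∧ s ≠ (t n + t₀) / 2 ∧ ∀ m,
      ∫ y, (Real.sqrt |t n - s| + ‖x n m - y‖) ^ (-b) • f s y = (hf n m).mk _ s := by
    refine (Measure.ae_ne volume _).and (ae_all_iff.2 fun n => ?_)
    exact (Measure.ae_ne volume _).and ((Measure.ae_ne volume _).and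
      (ae_all_iff.2 fun m => (hf n m).ae_eq_mk))
  set N : Set ℝ := toMeasurable volume {s | ¬ (s ≠ t₀ ∧ ∀ n, s ≠ t n ∧ s ≠ (t n + t₀) / 2 ∧ ∀ m,
      ∫ y, (Real.sqrt |t n - s| + ‖x n m - y‖) ^ (-b) • f s y = (hf n m).mk _ s)} with hN
  have hN0 : volume N = 0 := by rw [hN, measure_toMeasurable]; exact hae
  have hNm : MeasurableSet Nᶜ := (measurableSet_toMeasurable _ _).compl
  have hS {s : ℝ} (hs : s ∈ Nᶜ) : s ≠ t₀ ∧ ∀ n, s ≠ t n ∧ s ≠ (t n + t₀) / 2 ∧ ∀ m,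
      ∫ y, (Real.sqrt |t n - s| + ‖x n m - y‖) ^ (-b) • f s y = (hf n m).mk _ s := by
    by_contra h
    exact hs (subset_toMeasurable _ _ h)
  have hpos {s u : ℝ} (h : s ≠ u) : 0 < Real.sqrt |u - s| :=
    Real.sqrt_pos.2 (abs_pos.2 (sub_ne_zero.2 h.symm))
  set Φ : ℝ × Lp E₃ 1 (volume : Measure E₃) → ℕ × ℕ → E₃ := fun p i =>
    ∫ y, relKer b (Real.sqrt |t i.1 - p.1|) (x i.1 i.2) y • p.2 y with hΦ
  have hΦm : Measurable Φ := by
    refine measurable_pi_lambda _ fun i => ?_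
    exact measurable_integral_smul_Lp
      (k := fun s y => relKer b (Real.sqrt |t i.1 - s|) (x i.1 i.2) y)
      (measurable_relKer b (by fun_prop) _) fun s => abs_relKer_le hb.le (Real.sqrt_nonneg _) _
  have hφ : Measurable (Nᶜ.piecewise (fun s => weightedL1 b (f s)) 0) := by
    intro U hU
    rw [Set.piecewise_preimage, Set.ite]
    refine MeasurableSet.union ?_ ((measurable_zero hU).diff hNm)
    rw [Set.inter_comm]
    refine measurableSet_sep_mem_of_injective hNm hΦm ?_
      (d := fun s i => (hf i.1 i.2).mk _ s)
      (measurable_pi_lambda _ fun i => (hf i.1 i.2).stronglyMeasurable_mk.measurable) ?_ hU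
    · intro s hs h h' hh
      have hs' := hS hs
      refine eq_of_integral_relKer_smul_eq hb (hpos hs'.1) (fun n => hpos (hs'.2 n).1)
        (fun n hc => ?_) ?_ hB hZB hZ hδ hZδ hx fun n m => congrFun hh (n, m)
      · rw [Real.sqrt_inj (abs_nonneg _) (abs_nonneg _)] at hc
        rcases abs_eq_abs.1 hc with h1 | h1
        · exact hne n (by linarith)
        · exact (hs'.2 n).2.1 (by linarith)
      · exact ((hlim.sub_const s).abs).sqrt
    · intro s hs
      funext i
      exact (integral_relKer_smul_weightedL1 hb (hpos ((hS hs).2 i.1).1) _ _).trans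
        (((hS hs).2 i.1).2.2 i.2)
  obtain ⟨G, hG, hG'⟩ := exists_measurable_enorm_Lp
  refine ⟨fun p => G (Nᶜ.piecewise (fun s => weightedL1 b (f s)) 0 p.1, p.2) *
    ENNReal.ofReal ((1 + ‖p.2‖) ^ b), ?_, ?_⟩
  · refine (hG.comp ((hφ.comp measurable_fst).prodMk measurable_snd)).mul ?_
    exact (Measurable.pow_const (by fun_prop) b).ennreal_ofReal
  · have : ∀ᵐ s, s ∈ Nᶜ := measure_eq_zero_iff_ae_notMem.1 hN0
    filter_upwards [this] with s hs
    rw [Set.piecewise_eq_of_mem _ _ _ hs]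
    refine ⟨fun h => ?_, fun h => ?_⟩
    · filter_upwards [hG' (weightedL1 b (f s)), coeFn_weightedL1 h] with y h1 h2
      have h3 : 0 < 1 + ‖y‖ := by positivity
      rw [h1, h2, enorm_smul, mul_right_comm, Real.enorm_of_nonneg (by positivity),
        ← ENNReal.ofReal_mul (by positivity), ← Real.rpow_add h3, neg_add_cancel, Real.rpow_zero,
        ENNReal.ofReal_one, one_mul]
    · have h0 : weightedL1 b (f s) = 0 := by rw [weightedL1, dif_neg h]
      filter_upwards [hG' (weightedL1 b (f s)), Lp.coeFn_zero E₃ 1 (volume : Measure E₃)]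
        with y h1 h2
      rw [h1, h0, h2, Pi.zero_apply, enorm_zero, zero_mul]

lemma measurable_parKer (b : ℝ) :
    Measurable fun v : (ℝ × E₃) × (ℝ × E₃) => parKer b v.1 v.2 := by
  unfold parKer
  exact Measurable.pow_const (by fun_prop) _

lemma measurable_parPot (b : ℝ) {F : ℝ × E₃ → ℝ≥0∞} (hF : Measurable F) :
    Measurable (parPot b F) := by
  refine Measurable.lintegral_prod_right' (ν := volume)
    (f := fun v : (ℝ × E₃) × (ℝ × E₃) => ENNReal.ofReal (parKer b v.1 v.2) * F v.2) ?_
  exact (measurable_parKer b).ennreal_ofReal.mul (hF.comp measurable_snd)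

lemma setLIntegral_parBall {F : ℝ × E₃ → ℝ≥0∞} (hF : Measurable F) (t₀ : ℝ) (x₀ : E₃) (r : ℝ) :
    ∫⁻ w in parBall (t₀, x₀) r, F w =
      ∫⁻ t in Set.Ioo (t₀ - r ^ 2) (t₀ + r ^ 2), ∫⁻ x in Metric.ball x₀ r, F (t, x) := by
  rw [parBall, Measure.volume_eq_prod, ← Measure.prod_restrict, lintegral_prod _ hF.aemeasurable]

lemma enorm_rieszPot_le_parPot {a : ℝ} (ha : a < 5) {f : ℝ → E₃ → E₃} {F : ℝ × E₃ → ℝ≥0∞}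
    (hF : Measurable F) (h : ∀ᵐ s, Integrable (fun y => (1 + ‖y‖) ^ (-(5 - a)) • f s y) →
      ∀ᵐ y, F (s, y) = ‖f s y‖ₑ) (t : ℝ) (x : E₃) :
    ‖rieszPot a f t x‖ₑ ≤ parPot (5 - a) F (t, x) := by
  refine (enorm_integral_le_lintegral_enorm _).trans ?_
  have hm : Measurable fun w => ENNReal.ofReal (parKer (5 - a) (t, x) w) * F w :=
    ((measurable_parKer _).comp measurable_prodMk_left).ennreal_ofReal.mul hF
  rw [parPot, Measure.volume_eq_prod, lintegral_prod _ hm.aemeasurable]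
  refine lintegral_mono_ae ?_
  filter_upwards [h, Measure.ae_ne volume t] with s hs hst
  by_cases hw : Integrable (fun y => (1 + ‖y‖) ^ (-(5 - a)) • f s y)
  · refine (enorm_integral_le_lintegral_enorm _).trans (lintegral_mono_ae ?_)
    filter_upwards [hs hw] with y hy
    rw [hy, enorm_smul, Real.enorm_of_nonneg (by positivity), parKer]
  · rw [integral_undef fun h' => hw ?_]
    · simp
    · have hc : 0 < Real.sqrt |t - s| :=
        Real.sqrt_pos.2 (abs_pos.2 (sub_ne_zero.2 hst.symm))
      simpa using integrable_rpow_add_norm_smul (by linarith) hc one_pos 0 h'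

lemma rieszPot_eq_zero_or_exists_le_parPot {a P : ℝ} (ha : a < 5) (hP : 0 < P)
    (f : ℝ → E₃ → E₃) :
    (∀ t₀ x₀ r, ∫⁻ t in Set.Ioo (t₀ - r ^ 2) (t₀ + r ^ 2), ∫⁻ x in Metric.ball x₀ r,
      ENNReal.ofReal (‖rieszPot a f t x‖ ^ P) = 0) ∨
    ∃ F : ℝ × E₃ → ℝ≥0∞, Measurable F ∧
      (∀ t x, ‖rieszPot a f t x‖ₑ ≤ parPot (5 - a) F (t, x)) ∧
      ∀ᵐ s, ∀ᵐ y, F (s, y) ≤ ‖f s y‖ₑ := by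
  refine or_iff_not_imp_left.2 fun h => ?_
  push Not at h
  obtain ⟨t₀', x₀, r, h⟩ := h
  obtain ⟨t, t₀, Z, δ, hδ, hne, hlim, hZB, hZ, hZδ, hZ0⟩ :=
    exists_seq_support_of_lintegral_ne_zero measurableSet_ball h
  have hZne (n : ℕ) : (Z n).Nonempty := by
    refine nonempty_of_measure_ne_zero (μ := volume) fun h0 => hδ ?_
    exact le_zero_iff.1 (h0 ▸ hZδ n)
  choose x hxZ hx using fun n => exists_dense_seq_of_nonempty (hZne n)
  obtain ⟨F, hF, hF'⟩ := exists_measurable_enorm_of_aestronglyMeasurable_integral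
    (b := 5 - a) (f := f) (by linarith) hne hlim measure_ball_lt_top.ne hZB hZ hδ hZδ hx
    fun n m => by
      by_contra hnot
      refine hZ0 n _ (hxZ n m) ?_
      rw [rieszPot, integral_undef fun hi => hnot hi.aestronglyMeasurable, norm_zero,
        Real.zero_rpow hP.ne', ENNReal.ofReal_zero]
  refine ⟨F, hF, enorm_rieszPot_le_parPot ha hF (hF'.mono fun s hs => hs.1), ?_⟩
  filter_upwards [hF'] with s hs
  by_cases hw : Integrable (fun y => (1 + ‖y‖) ^ (-(5 - a)) • f s y)
  · exact (hs.1 hw).mono fun y hy => hy.le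
  · exact (hs.2 hw).mono fun y hy => hy ▸ zero_le

lemma ofReal_norm_rpow {E : Type*} [NormedAddCommGroup E] (v : E) {s : ℝ} (hs : 0 ≤ s) :
    ENNReal.ofReal (‖v‖ ^ s) = ‖v‖ₑ ^ s := by
  rw [← ENNReal.ofReal_rpow_of_nonneg (norm_nonneg v) hs, ofReal_norm]

lemma MorreyBound.of_morreyNorm_le {p q N : ℝ} (hp : 0 < p) (hN : 0 < N) {f : ℝ → E₃ → E₃}
    (hf : morreyNorm p q f ≤ ENNReal.ofReal N) {F : ℝ × E₃ → ℝ≥0∞} (hF : Measurable F)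
    (hFf : ∀ᵐ s, ∀ᵐ y, F (s, y) ≤ ‖f s y‖ₑ) : MorreyBound p q N F := by
  rintro ⟨t₀, x₀⟩ r hr
  rw [setLIntegral_parBall (hF.pow_const p)]
  have h1 : ∫⁻ t in Set.Ioo (t₀ - r ^ 2) (t₀ + r ^ 2), ∫⁻ x in Metric.ball x₀ r, F (t, x) ^ p ≤
      ∫⁻ t in Set.Ioo (t₀ - r ^ 2) (t₀ + r ^ 2), ∫⁻ x in Metric.ball x₀ r,
        ENNReal.ofReal (‖f t x‖ ^ p) := by
    refine lintegral_mono_ae (ae_restrict_of_ae ?_)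
    filter_upwards [hFf] with s hs
    refine lintegral_mono_ae (ae_restrict_of_ae ?_)
    filter_upwards [hs] with y hy
    rw [ofReal_norm_rpow _ hp.le]
    exact ENNReal.rpow_le_rpow hy hp.le
  refine h1.trans ?_
  have h2 := (le_iSup_of_le t₀ (le_iSup_of_le x₀ (le_iSup_of_le ⟨r, hr⟩ le_rfl))).trans hf
  rw [one_div, ENNReal.rpow_inv_le_iff hp, ENNReal.ofReal_rpow_of_pos hN] at h2
  have h3 : (1 : ℝ≥0∞) = ENNReal.ofReal (r ^ (5 * (1 - p / q))) *
      ENNReal.ofReal (r ^ (-(5 : ℝ) * (1 - p / q))) := by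
    rw [← ENNReal.ofReal_mul (by positivity), ← Real.rpow_add hr]
    simp
  rw [mul_comm (N ^ p), ENNReal.ofReal_mul (by positivity), ← one_mul (lintegral _ _), h3,
    mul_assoc]
  exact mul_le_mul_right h2 _

lemma morreyNorm_le_of_le_parPot {P Q A : ℝ} {b : ℝ} {G : ℝ → E₃ → E₃} {F : ℝ × E₃ → ℝ≥0∞}
    {K : ℝ≥0∞} (hP : 0 < P) (hF : Measurable F) (hG : ∀ t x, ‖G t x‖ₑ ≤ parPot b F (t, x))
    (h : ∀ z R, 0 < R → ∫⁻ w in parBall z R, parPot b F w ^ P ≤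
      K * ENNReal.ofReal (A * R ^ (5 * (1 - P / Q)))) :
    morreyNorm P Q G ≤ (K * ENNReal.ofReal A) ^ (1 / P) := by
  refine iSup_le fun t₀ => iSup_le fun x₀ => iSup_le fun r => ?_
  obtain ⟨r, hr⟩ := r
  refine ENNReal.rpow_le_rpow ?_ (by positivity)
  have h1 : ∫⁻ t in Set.Ioo (t₀ - r ^ 2) (t₀ + r ^ 2), ∫⁻ x in Metric.ball x₀ r,
      ENNReal.ofReal (‖G t x‖ ^ P) ≤ K * ENNReal.ofReal (A * r ^ (5 * (1 - P / Q))) := by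
    refine le_trans ?_ (h (t₀, x₀) r hr)
    rw [setLIntegral_parBall ((measurable_parPot b hF).pow_const P)]
    refine lintegral_mono fun t => lintegral_mono fun x => ?_
    rw [ofReal_norm_rpow _ hP.le]
    exact ENNReal.rpow_le_rpow (hG t x) hP.le
  refine (mul_le_mul_right h1 _).trans (le_of_eq ?_)
  rw [mul_left_comm, ← ENNReal.ofReal_mul (by positivity), mul_left_comm, ← Real.rpow_add hr]
  simp

/-- Adams–Hedberg inequality: if 0 < a < 5/q, 1 < p ≤ q < ∞ and ν = 1 - aq/5, then
‖I_a(f)‖_{M^{p/ν,q/ν}} ≤ C ‖f‖_{M^{p,q}}. -/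
theorem adams_hedberg (p q a : ℝ) (hp : 1 < p) (hpq : p ≤ q) (ha : 0 < a)
    (haq : a < 5 / q) :
    ∃ C : ℝ, 0 < C ∧
      ∀ f : ℝ → EuclideanSpace ℝ (Fin 3) → EuclideanSpace ℝ (Fin 3),
        morreyNorm (p / (1 - a * q / 5)) (q / (1 - a * q / 5)) (rieszPot a f) ≤
          ENNReal.ofReal C * morreyNorm p q f := by
  obtain ⟨K, hK, hbound⟩ := MorreyBound.parPot_rpow hp hpq ha haq
  have hp0 : 0 < p := by linarith
  have hq0 : 0 < q := by linarith
  have ha5 : a < 5 := haq.trans_le (div_le_self (by norm_num) (by linarith))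
  have hν0 : 0 < 1 - a * q / 5 := by
    rw [lt_div_iff₀ hq0] at haq
    linarith
  set ν := 1 - a * q / 5 with hν
  have hP : 0 < p / ν := by positivity
  have hKr : K ^ (1 / (p / ν)) ≠ ∞ := ENNReal.rpow_ne_top_of_nonneg (by positivity) hK
  refine ⟨(K ^ (1 / (p / ν))).toReal + 1, by positivity, fun f => ?_⟩
  rcases rieszPot_eq_zero_or_exists_le_parPot ha5 hP f with h0 | ⟨F, hF, hle, hFf⟩
  · have : morreyNorm (p / ν) (q / ν) (rieszPot a f) = 0 := by
      simp [morreyNorm, h0, hp0, hν0]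
    exact this ▸ zero_le
  · have hC0 : ENNReal.ofReal ((K ^ (1 / (p / ν))).toReal + 1) ≠ 0 := by
      rw [ne_eq, ENNReal.ofReal_eq_zero, not_le]
      positivity
    have hKC : K ^ (1 / (p / ν)) ≤ ENNReal.ofReal ((K ^ (1 / (p / ν))).toReal + 1) := by
      rw [ENNReal.le_ofReal_iff_toReal_le hKr (by positivity)]
      linarith
    rw [← ENNReal.div_le_iff' hC0 ENNReal.ofReal_ne_top]
    refine le_of_forall_gt_imp_ge_of_dense fun M hM => ?_
    rcases eq_or_ne M ∞ with rfl | hMt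
    · exact le_top
    have hN : 0 < M.toReal := ENNReal.toReal_pos (pos_of_gt hM).ne' hMt
    rw [ENNReal.div_le_iff' hC0 ENNReal.ofReal_ne_top]
    have hB : MorreyBound p q M.toReal F :=
      .of_morreyNorm_le hp0 hN (by rw [ENNReal.ofReal_toReal hMt]; exact hM.le) hF hFf
    have hPQ : p / ν / (q / ν) = p / q := div_div_div_cancel_right₀ hν0.ne' _ _
    refine (morreyNorm_le_of_le_parPot (Q := q / ν) (A := M.toReal ^ (p / ν)) hP hF hle
      (by simpa only [hPQ] using hbound F M.toReal hF hN hB)).trans ?_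
    rw [ENNReal.mul_rpow_of_nonneg _ _ (by positivity), ← ENNReal.ofReal_rpow_of_pos hN,
      ← ENNReal.rpow_mul, mul_one_div_cancel hP.ne', ENNReal.rpow_one, ENNReal.ofReal_toReal hMt]
    exact mul_le_mul_left hKC _
end

section
/- Localized estimate for the Riesz potential I₂: let Q be a bounded parabolic ball, 2 < p ≤ q, 5 < q, and f ∈ M^{p/2, q/2}_{t,x}(ℝ × ℝ³). Then 𝟙_Q I₂(𝟙_Q f) ∈ M^{σ, q}_{t,x}(ℝ × ℝ³), where σ = min{p/ν, q} and ν = 1 - (q-5)/(5q). -/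
open MeasureTheory ENNReal

section Auxiliary

open Filter Topology Set

section Param

variable {α : Type*} [MeasurableSpace α] {μ : Measure α}

/-- Differentiation under the integral sign, for a kernel which is bounded together with its
derivative, against an integrable weight. -/
lemma hasDerivAt_integral_mul_of_bounded {U : Set ℂ} {z : ℂ} (hU : U ∈ 𝓝 z) {F F' : ℂ → α → ℂ}
    {G : α → ℂ} {C : ℝ} (hG : Integrable G μ) (hF : ∀ w, Measurable (F w))
    (hF' : ∀ w, Measurable (F' w)) (hb : ∀ᵐ a ∂μ, ∀ w ∈ U, ‖F w a‖ ≤ C)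
    (hb' : ∀ᵐ a ∂μ, ∀ w ∈ U, ‖F' w a‖ ≤ C)
    (hd : ∀ᵐ a ∂μ, ∀ w ∈ U, HasDerivAt (F · a) (F' w a) w) :
    HasDerivAt (fun w => ∫ a, F w a * G a ∂μ) (∫ a, F' z a * G a ∂μ) z := by
  refine (hasDerivAt_integral_of_dominated_loc_of_deriv_le (F := fun w a => F w a * G a)
    (F' := fun w a => F' w a * G a) (bound := fun a => C * ‖G a‖) hU ?_ ?_ ?_ ?_ ?_ ?_).2
  · exact Eventually.of_forall fun w => (hF w).aestronglyMeasurable.mul hG.1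
  · exact hG.bdd_mul (hF z).aestronglyMeasurable
      (hb.mono fun a ha => ha z (mem_of_mem_nhds hU))
  · exact (hF' z).aestronglyMeasurable.mul hG.1
  · filter_upwards [hb'] with a ha w hw
    rw [norm_mul]
    gcongr
    exact ha w hw
  · exact hG.norm.const_mul C
  · exact hd.mono fun a ha w hw => (ha w hw).mul_const _

lemma integral_cexp_mul_eq_zero_of_frequently {X : α → ℝ} {G : α → ℂ} {R : ℝ}
    (hX : Measurable X) (hR : ∀ᵐ a ∂μ, |X a| ≤ R) (hG : Integrable G μ) {τ₀ : ℝ}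
    (h : ∃ᶠ τ : ℝ in 𝓝[≠] τ₀, ∫ a, Complex.exp (τ * X a) * G a ∂μ = 0) (z : ℂ) :
    ∫ a, Complex.exp (z * X a) * G a ∂μ = 0 := by
  have hder : ∀ w : ℂ, HasDerivAt (fun w : ℂ => ∫ a, Complex.exp (w * X a) * G a ∂μ)
      (∫ a, (X a * Complex.exp (w * X a)) * G a ∂μ) w := by
    intro w
    have hexp : ∀ v ∈ Metric.ball w 1, ∀ a, |X a| ≤ R →
        ‖Complex.exp (v * X a)‖ ≤ Real.exp ((‖w‖ + 1) * R) := by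
      intro v hv a ha
      rw [Complex.norm_exp]
      refine Real.exp_le_exp.2 ((Complex.re_le_norm _).trans ?_)
      rw [norm_mul, Complex.norm_real]
      have : ‖v‖ ≤ ‖w‖ + 1 := by
        have := norm_le_norm_add_norm_sub' v w
        rw [mem_ball_iff_norm] at hv
        linarith
      exact mul_le_mul this ha (norm_nonneg _) (by positivity)
    refine hasDerivAt_integral_mul_of_bounded (U := Metric.ball w 1)
      (C := (1 + |R|) * Real.exp ((‖w‖ + 1) * R))
      (F := fun v a => Complex.exp (v * X a)) (F' := fun v a => X a * Complex.exp (v * X a))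
      (Metric.ball_mem_nhds w one_pos) hG (fun v => by fun_prop) (fun v => by fun_prop) ?_ ?_ ?_
    · filter_upwards [hR] with a ha v hv
      refine (hexp v hv a ha).trans ?_
      have := Real.exp_pos ((‖w‖ + 1) * R)
      nlinarith [abs_nonneg R]
    · filter_upwards [hR] with a ha v hv
      rw [norm_mul, Complex.norm_real]
      refine mul_le_mul ?_ (hexp v hv a ha) (norm_nonneg _) (by positivity)
      rw [Real.norm_eq_abs]
      linarith [le_abs_self R]
    · refine Eventually.of_forall fun a v _ => ?_
      have : HasDerivAt (fun v : ℂ => v * (X a : ℂ)) (X a) v := by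
        simpa using (hasDerivAt_id v).mul_const (X a : ℂ)
      simpa [mul_comm] using this.cexp
  have han : AnalyticOnNhd ℂ (fun w : ℂ => ∫ a, Complex.exp (w * X a) * G a ∂μ) univ :=
    DifferentiableOn.analyticOnNhd (fun w _ => (hder w).differentiableAt.differentiableWithinAt)
      isOpen_univ
  refine han.eqOn_zero_of_preconnected_of_frequently_eq_zero isPreconnected_univ
    (mem_univ (τ₀ : ℂ)) ?_ (mem_univ z)
  have ht : Tendsto (fun τ : ℝ => (τ : ℂ)) (𝓝[≠] τ₀) (𝓝[≠] (τ₀ : ℂ)) := by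
    refine tendsto_nhdsWithin_of_tendsto_nhds_of_eventually_within _
      (Complex.continuous_ofReal.continuousAt.tendsto.mono_left nhdsWithin_le_nhds) ?_
    filter_upwards [self_mem_nhdsWithin] with τ hτ
    simpa using hτ
  exact ht.frequently h

/-- If the generalized Stieltjes transform of order three of a compactly supported density
vanishes at points accumulating in `(0, ∞)`, all its moments vanish. -/
lemma integral_pow_mul_eq_zero_of_frequently {X : α → ℝ} {G : α → ℂ} {R : ℝ}
    (hX : Measurable X) (h0 : ∀ a, 0 ≤ X a) (hR : ∀ᵐ a ∂μ, X a ≤ R) (hG : Integrable G μ) {c₀ : ℝ}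
    (hc₀ : 0 < c₀)
    (h : ∃ᶠ c : ℝ in 𝓝[≠] c₀, ∫ a, (((c + X a) ^ 3)⁻¹ : ℝ) * G a ∂μ = 0) (k : ℕ) :
    ∫ a, ((X a ^ k : ℝ) : ℂ) * G a ∂μ = 0 := by
  set S : ℝ := |R| + 1 with hS
  have hSpos : 0 < S := by positivity
  have hXS : ∀ᵐ a ∂μ, X a ≤ S := hR.mono fun a ha => ha.trans (by linarith [le_abs_self R])
  set U : Set ℂ := {z | -(1 / (2 * S)) < z.re} with hUdef
  have hUo : IsOpen U := isOpen_lt continuous_const Complex.continuous_re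
  have hUc : IsPreconnected U := (convex_halfSpace_re_gt _).isPreconnected
  have hlow : ∀ z ∈ U, ∀ a, X a ≤ S → (1 / 2 : ℝ) ≤ ‖1 + z * X a‖ := by
    intro z hz a ha
    refine le_trans ?_ (Complex.re_le_norm _)
    have h1 : (1 + z * (X a : ℂ)).re = 1 + z.re * X a := by simp
    rw [h1]
    have hz' : -(1 / (2 * S)) < z.re := hz
    have h2 : -(1 / (2 * S)) * X a ≤ z.re * X a := mul_le_mul_of_nonneg_right hz'.le (h0 a)
    have h3 : 1 / (2 * S) * X a ≤ 1 / (2 * S) * S := by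
      gcongr
    have h4 : 1 / (2 * S) * S = 1 / 2 := by field_simp
    linarith
  have hne : ∀ z ∈ U, ∀ a, X a ≤ S → 1 + z * (X a : ℂ) ≠ 0 := by
    intro z hz a ha h
    have := hlow z hz a ha
    rw [h, norm_zero] at this
    linarith
  set F : ℕ → ℂ → α → ℂ := fun k z a => (X a : ℂ) ^ k * ((1 + z * X a) ^ (3 + k))⁻¹ with hF
  have hFb : ∀ k, ∀ z ∈ U, ∀ a, X a ≤ S → ‖F k z a‖ ≤ S ^ k * 2 ^ (3 + k) := by
    intro k z hz a ha
    simp only [hF, norm_mul, norm_pow, norm_inv, Complex.norm_real, Real.norm_eq_abs,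
      abs_of_nonneg (h0 a)]
    have h1 : ((‖1 + z * (X a : ℂ)‖) ^ (3 + k))⁻¹ ≤ 2 ^ (3 + k) := by
      rw [← inv_pow]
      have : (‖1 + z * (X a : ℂ)‖)⁻¹ ≤ 2 := by
        rw [inv_le_comm₀ (by linarith [hlow z hz a ha]) two_pos]
        simpa using hlow z hz a ha
      gcongr
    exact mul_le_mul (pow_le_pow_left₀ (h0 a) ha k) h1 (by positivity) (by positivity)
  have hFm : ∀ k z, Measurable (F k z) := fun k z => by simp only [hF]; fun_prop
  have hder : ∀ k, ∀ z ∈ U, HasDerivAt (fun w => ∫ a, F k w a * G a ∂μ)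
      (∫ a, (-(3 + k : ℂ) * F (k + 1) z a) * G a ∂μ) z := by
    intro k z hz
    refine hasDerivAt_integral_mul_of_bounded (U := U)
      (C := S ^ k * 2 ^ (3 + k) + ‖-(3 + k : ℂ)‖ * (S ^ (k + 1) * 2 ^ (3 + (k + 1))))
      (F := F k) (F' := fun z a => -(3 + k : ℂ) * F (k + 1) z a)
      (hUo.mem_nhds hz) hG (hFm k) (fun w => (hFm (k + 1) w).const_mul _) ?_ ?_ ?_
    · filter_upwards [hXS] with a ha w hw
      exact (hFb k w hw a ha).trans (le_add_of_nonneg_right (by positivity))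
    · filter_upwards [hXS] with a ha w hw
      rw [norm_mul]
      refine le_trans ?_ (le_add_of_nonneg_left (by positivity))
      gcongr
      exact hFb (k + 1) w hw a ha
    · filter_upwards [hXS] with a ha w hw
      have h1 : HasDerivAt (fun v : ℂ => 1 + v * (X a : ℂ)) (X a) w := by
        simpa using ((hasDerivAt_id w).mul_const (X a : ℂ)).const_add 1
      have h2 := ((h1.pow (3 + k)).inv (pow_ne_zero _ (hne w hw a ha))).const_mul ((X a : ℂ) ^ k)
      refine h2.congr_deriv ?_
      have := hne w hw a ha
      simp only [hF, Pi.pow_apply]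
      rw [show 3 + k - 1 = 2 + k by omega]
      generalize 1 + w * (X a : ℂ) = D at this ⊢
      push_cast
      field_simp
      ring
  have hzero : ∀ k, ∀ z ∈ U, ∫ a, F k z a * G a ∂μ = 0 := by
    intro k
    induction k with
    | zero =>
      have han : AnalyticOnNhd ℂ (fun w : ℂ => ∫ a, F 0 w a * G a ∂μ) U :=
        DifferentiableOn.analyticOnNhd
          (fun w hw => (hder 0 w hw).differentiableAt.differentiableWithinAt) hUo
      have hmem : ((c₀⁻¹ : ℝ) : ℂ) ∈ U := by
        have h1 : 0 < 1 / (2 * S) := by positivity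
        have h2 : 0 < c₀⁻¹ := by positivity
        simp only [hUdef, mem_ofPred_eq, Complex.ofReal_re]
        linarith
      refine fun z hz => han.eqOn_zero_of_preconnected_of_frequently_eq_zero hUc hmem ?_ hz
      have ht : Tendsto (fun c : ℝ => ((c⁻¹ : ℝ) : ℂ)) (𝓝[≠] c₀) (𝓝[≠] ((c₀⁻¹ : ℝ) : ℂ)) := by
        refine tendsto_nhdsWithin_of_tendsto_nhds_of_eventually_within _ ?_ ?_
        · exact (Complex.continuous_ofReal.continuousAt.tendsto.comp
            (continuousAt_inv₀ hc₀.ne')).mono_left nhdsWithin_le_nhds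
        · filter_upwards [self_mem_nhdsWithin] with τ hτ
          simpa using hτ
      have hpos : ∀ᶠ c in 𝓝[≠] c₀, 0 < c :=
        nhdsWithin_le_nhds (lt_mem_nhds hc₀)
      refine ht.frequently ((h.and_eventually hpos).mono ?_)
      rintro c ⟨hc, hcp⟩
      have : ∀ a, F 0 ((c⁻¹ : ℝ) : ℂ) a * G a
          = (c : ℂ) ^ 3 * ((((c + X a) ^ 3)⁻¹ : ℝ) * G a) := by
        intro a
        have h1 : (c : ℂ) ≠ 0 := by exact_mod_cast hcp.ne'
        have h2 : (c : ℂ) + X a ≠ 0 := by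
          have := h0 a
          exact_mod_cast (by positivity : c + X a ≠ 0)
        simp only [hF]
        push_cast
        have h3 : 1 + (c : ℂ)⁻¹ * X a = (c + X a) / c := by field_simp
        rw [h3]
        simp only [pow_zero, one_mul]
        field_simp
      simp only [this, integral_const_mul, hc, mul_zero]
    | succ k ih =>
      intro z hz
      have h1 : HasDerivAt (fun w => ∫ a, F k w a * G a ∂μ) 0 z := by
        refine (hasDerivAt_const z (0 : ℂ)).congr_of_eventuallyEq ?_
        filter_upwards [hUo.mem_nhds hz] with w hw using ih w hw
      have h2 := (hder k z hz).unique h1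
      simp only [mul_assoc, integral_const_mul] at h2
      have h3 : -(3 + k : ℂ) ≠ 0 := neg_ne_zero.2 (by exact_mod_cast (by omega : 3 + k ≠ 0))
      exact (mul_eq_zero.1 h2).resolve_left h3
  have hmem0 : (0 : ℂ) ∈ U := by
    have h1 : 0 < 1 / (2 * S) := by positivity
    simp only [hUdef, mem_ofPred_eq, Complex.zero_re]
    linarith
  simpa [hF] using hzero k 0 hmem0

end Param

section Uniqueness

variable {E : Type*} [NormedAddCommGroup E] [InnerProductSpace ℝ E] [MeasurableSpace E]
  [BorelSpace E]

/-- A set of positive measure meets some line through any given point in a set having an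
accumulation point. -/
lemma exists_frequently_line_mem [FiniteDimensional ℝ E] {X : Set E} (hX : MeasurableSet X)
    (h0 : volume X ≠ 0) (z : E) :
    ∃ θ : E, ∃ τ₀ : ℝ, ∃ᶠ τ : ℝ in 𝓝[≠] τ₀, z + τ • θ ∈ X := by
  set S : Set (ℝ × E) := {p | z + p.1 • p.2 ∈ X} with hS
  have hSm : MeasurableSet S := by
    have : Measurable fun p : ℝ × E => z + p.1 • p.2 := by
      exact (continuous_const.add (continuous_fst.smul continuous_snd)).measurable
    exact this hX
  have hpos : ((volume.restrict (Icc (1 : ℝ) 2)).prod (volume : Measure E)) S ≠ 0 := by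
    rw [Measure.prod_apply hSm]
    intro h
    rw [lintegral_eq_zero_iff (measurable_measure_prodMk_left hSm)] at h
    have h2 : ∀ᵐ τ : ℝ ∂volume.restrict (Icc (1 : ℝ) 2), False := by
      filter_upwards [h, ae_restrict_mem measurableSet_Icc] with τ hτ hτI
      have hτ0 : τ ≠ 0 := by linarith [hτI.1]
      have h3 : Prod.mk τ ⁻¹' S = (τ • ·) ⁻¹' ((z + ·) ⁻¹' X) := by
        ext θ; simp [hS]
      simp only [Pi.zero_apply] at hτ
      rw [h3, Measure.addHaar_preimage_smul _ hτ0, measure_preimage_add] at hτ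
      rcases mul_eq_zero.1 hτ with h4 | h4
      · rw [ENNReal.ofReal_eq_zero] at h4
        have : 0 < |(τ ^ Module.finrank ℝ E)⁻¹| := by positivity
        linarith
      · exact h0 h4
    have h5 := ae_iff.1 h2
    simp at h5
  rw [Measure.prod_apply_symm hSm] at hpos
  obtain ⟨θ, hθ⟩ : ∃ θ : E, (volume.restrict (Icc (1 : ℝ) 2)) ((fun τ => (τ, θ)) ⁻¹' S) ≠ 0 := by
    by_contra! h
    simp [h] at hpos
  rw [Measure.restrict_apply (measurable_prodMk_right hSm)] at hθ
  have hinf : ((fun τ => (τ, θ)) ⁻¹' S ∩ Icc (1 : ℝ) 2).Infinite := fun hf =>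
    hθ (hf.measure_zero _)
  obtain ⟨τ₀, -, hτ₀⟩ := hinf.exists_accPt_of_subset_isCompact isCompact_Icc inter_subset_right
  refine ⟨θ, τ₀, ?_⟩
  rw [accPt_iff_frequently_nhdsNE] at hτ₀
  exact hτ₀.mono fun τ hτ => hτ.1

lemma ae_eq_zero_of_forall_integral_char [CompleteSpace E] [SecondCountableTopology E]
    {μ : Measure E} {g : E → ℝ}
    (hg : Integrable g μ)
    (h : ∀ ξ : E, ∫ y, Complex.exp (inner ℝ y ξ * Complex.I) * g y ∂μ = 0) : g =ᵐ[μ] 0 := by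
  set p : E → ℝ≥0∞ := fun y => ENNReal.ofReal (g y) with hp
  set n : E → ℝ≥0∞ := fun y => ENNReal.ofReal (-g y) with hn
  have hpm : AEMeasurable p μ := hg.1.aemeasurable.ennreal_ofReal
  have hnm : AEMeasurable n μ := hg.1.aemeasurable.neg.ennreal_ofReal
  have hpi : ∫⁻ y, p y ∂μ ≠ ∞ := (hg.lintegral_lt_top).ne
  have hni : ∫⁻ y, n y ∂μ ≠ ∞ := (hg.neg.lintegral_lt_top).ne
  have : IsFiniteMeasure (μ.withDensity p) := isFiniteMeasure_withDensity hpi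
  have : IsFiniteMeasure (μ.withDensity n) := isFiniteMeasure_withDensity hni
  have hchar : ∀ w : E → ℝ, Integrable w μ → ∀ ξ : E,
      Integrable (fun y => w y • Complex.exp (inner ℝ y ξ * Complex.I)) μ := by
    intro w hw ξ
    simp only [Complex.real_smul, mul_comm (Complex.ofReal (w _))]
    refine hw.ofReal.bdd_mul (c := 1) (Measurable.aestronglyMeasurable (by fun_prop))
      (Eventually.of_forall fun y => ?_)
    rw [Complex.norm_exp]; simp
  have key : μ.withDensity p = μ.withDensity n := by
    refine Measure.ext_of_charFun (funext fun ξ => ?_)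
    rw [charFun_apply, charFun_apply,
      integral_withDensity_eq_integral_toReal_smul₀ hpm (by simp [hp]),
      integral_withDensity_eq_integral_toReal_smul₀ hnm (by simp [hn]), ← sub_eq_zero,
      ← integral_sub, ← h ξ]
    · refine integral_congr_ae (Eventually.of_forall fun y => ?_)
      simp only [hp, hn, ← sub_smul]
      have : (ENNReal.ofReal (g y)).toReal - (ENNReal.ofReal (-g y)).toReal = g y := by
        rcases le_total 0 (g y) with h0 | h0
        · simp [ENNReal.toReal_ofReal h0, ENNReal.ofReal_of_nonpos (neg_nonpos.2 h0)]
        · simp [ENNReal.toReal_ofReal (neg_nonneg.2 h0), ENNReal.ofReal_of_nonpos h0]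
      rw [this, Complex.real_smul, mul_comm]
    · exact (hchar _ (integrable_toReal_of_lintegral_ne_top hpm hpi)) ξ
    · exact (hchar _ (integrable_toReal_of_lintegral_ne_top hnm hni)) ξ
  have := (withDensity_eq_iff hpm hnm hpi).1 key
  filter_upwards [this] with y hy
  simp only [hp, hn] at hy
  rcases lt_trichotomy (g y) 0 with h0 | h0 | h0
  · rw [ENNReal.ofReal_of_nonpos h0.le, eq_comm, ENNReal.ofReal_eq_zero] at hy
    linarith
  · exact h0
  · rw [ENNReal.ofReal_of_nonpos (neg_nonpos.2 h0.le), ENNReal.ofReal_eq_zero] at hy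
    linarith

lemma ae_eq_zero_of_forall_moments [FiniteDimensional ℝ E] {μ : Measure E} {g : E → ℝ} {R : ℝ}
    (hg : Integrable g μ) (hR : ∀ᵐ y ∂μ, ‖y‖ ≤ R) {X : Set E} (hX : MeasurableSet X)
    (hX0 : volume X ≠ 0)
    (h : ∀ x ∈ X, ∀ k : ℕ, ∫ y, ((‖x - y‖ ^ k : ℝ) : ℂ) * (g y : ℂ) ∂μ = 0) : g =ᵐ[μ] 0 := by
  have hgc : Integrable (fun y => (g y : ℂ)) μ := hg.ofReal
  have hgauss : ∀ z : E, Integrable (fun y => Complex.exp (-(‖z - y‖ ^ 2 : ℝ)) * (g y : ℂ)) μ := by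
    intro z
    refine hgc.bdd_mul (c := 1) (Measurable.aestronglyMeasurable (by fun_prop))
      (Eventually.of_forall fun y => ?_)
    rw [Complex.norm_exp]
    simp only [Complex.neg_re, Complex.ofReal_re]
    exact Real.exp_le_one_iff.2 (by simp)
  have h1 : ∀ x ∈ X, ∫ y, Complex.exp (-(‖x - y‖ ^ 2 : ℝ)) * (g y : ℂ) ∂μ = 0 := by
    intro x hx
    set F : ℕ → E → ℂ := fun k y => (-1) ^ k / (k.factorial : ℂ) *
      (((‖x - y‖ ^ (2 * k) : ℝ) : ℂ) * (g y : ℂ)) with hF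
    set S : ℝ := (‖x‖ + |R|) ^ 2 with hSdef
    have hFb : ∀ k, ∀ᵐ y ∂μ, ‖F k y‖ ≤ S ^ k / k.factorial * ‖g y‖ := by
      intro k
      filter_upwards [hR] with y hy
      simp only [hF, norm_mul, norm_div, norm_pow, norm_neg, norm_one, one_pow,
        Complex.norm_natCast, Complex.norm_real]
      have h2 : ‖x - y‖ ≤ ‖x‖ + |R| := (norm_sub_le x y).trans (by linarith [le_abs_self R])
      have h3 : ‖‖x - y‖‖ ^ (2 * k) ≤ S ^ k := by
        rw [norm_norm, hSdef, ← pow_mul]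
        gcongr
      calc 1 / (k.factorial : ℝ) * (‖‖x - y‖‖ ^ (2 * k) * ‖g y‖)
          ≤ 1 / (k.factorial : ℝ) * (S ^ k * ‖g y‖) := by gcongr
        _ = S ^ k / k.factorial * ‖g y‖ := by ring
    have hFm : ∀ k, AEStronglyMeasurable (F k) μ := fun k => by
      refine AEStronglyMeasurable.const_mul (AEStronglyMeasurable.mul ?_ hgc.1) _
      exact Measurable.aestronglyMeasurable (by fun_prop)
    have hFi : ∀ k, Integrable (F k) μ := fun k =>
      (hg.norm.const_mul _).mono' (hFm k) (hFb k)
    have hsum : Summable fun k => ∫ y, ‖F k y‖ ∂μ := by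
      refine Summable.of_nonneg_of_le (fun k => integral_nonneg fun y => norm_nonneg _)
        (fun k => (integral_mono_ae (hFi k).norm (hg.norm.const_mul _) (hFb k)).trans_eq
          (integral_const_mul _ _)) ?_
      exact (Real.summable_pow_div_factorial S).mul_right _
    have h4 := hasSum_integral_of_summable_integral_norm hFi hsum
    have h5 : ∀ k, ∫ y, F k y ∂μ = 0 := fun k => by
      simp only [hF, integral_const_mul, h x hx (2 * k), mul_zero]
    have h6 : ∀ y, ∑' k, F k y = Complex.exp (-(‖x - y‖ ^ 2 : ℝ)) * (g y : ℂ) := by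
      intro y
      simp only [hF, ← mul_assoc]
      rw [tsum_mul_right, Complex.exp_eq_exp_ℂ, NormedSpace.exp_eq_tsum_div]
      congr 1
      refine tsum_congr fun k => ?_
      rw [neg_pow]
      push_cast
      ring
    simp only [h5, h6] at h4
    exact h4.unique hasSum_zero
  have h2 : ∀ z, ∫ y, Complex.exp (-(‖z - y‖ ^ 2 : ℝ)) * (g y : ℂ) ∂μ = 0 := by
    intro z
    obtain ⟨θ, τ₀, hτ₀⟩ := exists_frequently_line_mem hX hX0 z
    have := integral_cexp_mul_eq_zero_of_frequently (μ := μ) (τ₀ := τ₀)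
      (X := fun y => -2 * inner ℝ (z - y) θ)
      (G := fun y => Complex.exp (-(‖z - y‖ ^ 2 : ℝ)) * (g y : ℂ))
      (R := 2 * ((‖z‖ + R) * ‖θ‖)) (by fun_prop) ?_ (hgauss z) ?_ 0
    · simpa using this
    · filter_upwards [hR] with y hy
      rw [abs_mul]
      simp only [abs_neg, Nat.abs_ofNat]
      gcongr
      refine (abs_real_inner_le_norm _ _).trans ?_
      gcongr
      exact (norm_sub_le _ _).trans (by linarith)
    · refine hτ₀.mono fun τ hτ => ?_
      have h3 := h1 _ hτ
      have h4 : ∀ y, Complex.exp (-(‖z + τ • θ - y‖ ^ 2 : ℝ)) * (g y : ℂ)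
          = Complex.exp (-(τ ^ 2 * ‖θ‖ ^ 2 : ℝ)) *
            (Complex.exp (τ * ((-2 * inner ℝ (z - y) θ : ℝ) : ℂ)) *
              (Complex.exp (-(‖z - y‖ ^ 2 : ℝ)) * (g y : ℂ))) := by
        intro y
        have h5 : ‖z + τ • θ - y‖ ^ 2
            = ‖z - y‖ ^ 2 + 2 * τ * inner ℝ (z - y) θ + τ ^ 2 * ‖θ‖ ^ 2 := by
          rw [show z + τ • θ - y = (z - y) + τ • θ by abel, norm_add_sq_real, inner_smul_right,
            norm_smul, mul_pow, Real.norm_eq_abs, sq_abs]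
          ring
        rw [h5, ← mul_assoc, ← mul_assoc, ← Complex.exp_add, ← Complex.exp_add]
        congr 2
        push_cast
        ring
      simp only [h4, integral_const_mul] at h3
      exact (mul_eq_zero.1 h3).resolve_left (Complex.exp_ne_zero _)
  have h3 : ∀ z, ∫ y, Complex.exp ((2 * inner ℝ y z : ℝ)) *
      (Complex.exp (-(‖(0 : E) - y‖ ^ 2 : ℝ)) * (g y : ℂ)) ∂μ = 0 := by
    intro z
    have h4 : ∀ y, Complex.exp (-(‖z - y‖ ^ 2 : ℝ)) * (g y : ℂ)
        = Complex.exp (-(‖z‖ ^ 2 : ℝ)) * (Complex.exp ((2 * inner ℝ y z : ℝ)) *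
            (Complex.exp (-(‖(0 : E) - y‖ ^ 2 : ℝ)) * (g y : ℂ))) := by
      intro y
      rw [norm_sub_sq_real, ← mul_assoc, ← mul_assoc, ← Complex.exp_add, ← Complex.exp_add,
        real_inner_comm, zero_sub, norm_neg]
      congr 2
      push_cast
      ring
    have h5 := h2 z
    simp only [h4, integral_const_mul] at h5
    exact (mul_eq_zero.1 h5).resolve_left (Complex.exp_ne_zero _)
  have h4 : (fun y => Real.exp (-‖(0 : E) - y‖ ^ 2) * g y) =ᵐ[μ] 0 := by
    have hcast : ∀ y, ((Real.exp (-‖(0 : E) - y‖ ^ 2) * g y : ℝ) : ℂ)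
        = Complex.exp (-(‖(0 : E) - y‖ ^ 2 : ℝ)) * (g y : ℂ) := fun y => by push_cast; rfl
    refine ae_eq_zero_of_forall_integral_char ?_ fun ξ => ?_
    · have := (hgauss 0).re
      refine this.congr (Eventually.of_forall fun y => ?_)
      simp only [← hcast]
      rfl
    · have := integral_cexp_mul_eq_zero_of_frequently (μ := μ) (τ₀ := 0)
        (X := fun y => inner ℝ y ξ)
        (G := fun y => Complex.exp (-(‖(0 : E) - y‖ ^ 2 : ℝ)) * (g y : ℂ))
        (R := R * ‖ξ‖) (by fun_prop) ?_ (hgauss 0) ?_ Complex.I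
      · simp only [hcast]
        simpa only [mul_comm Complex.I] using this
      · filter_upwards [hR] with y hy
        refine (abs_real_inner_le_norm _ _).trans ?_
        gcongr
      · refine Eventually.frequently (Eventually.of_forall fun τ => ?_)
        rw [← h3 ((τ / 2) • ξ)]
        refine integral_congr_ae (Eventually.of_forall fun y => ?_)
        simp only [inner_smul_right]
        congr 2
        push_cast
        ring
  filter_upwards [h4] with y hy
  simpa [Real.exp_ne_zero] using hy

end Uniqueness

section Potential

lemma norm_inv_add_norm_cube_le {E : Type*} [SeminormedAddCommGroup E] {c : ℝ} (hc : 0 < c)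
    (z : E) : ‖((c + ‖z‖) ^ 3)⁻¹‖ ≤ (c ^ 3)⁻¹ := by
  rw [norm_inv, norm_pow, Real.norm_of_nonneg (by positivity)]
  gcongr
  exact le_add_of_nonneg_right (norm_nonneg z)

lemma integrable_inv_add_norm_cube_smul {E F : Type*} [NormedAddCommGroup E] [MeasurableSpace E]
    [BorelSpace E] [SecondCountableTopology E] [NormedAddCommGroup F] [NormedSpace ℝ F]
    {μ : Measure E} {g : E → F} (hg : Integrable g μ) {c : ℝ} (hc : 0 < c) (x : E) :
    Integrable (fun y => ((c + ‖x - y‖) ^ 3)⁻¹ • g y) μ :=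
  hg.bdd_smul (c ^ 3)⁻¹ (Measurable.aestronglyMeasurable (by fun_prop))
    (Eventually.of_forall fun _ => norm_inv_add_norm_cube_le hc _)

variable {E F : Type*} [NormedAddCommGroup E] [InnerProductSpace ℝ E] [MeasurableSpace E]
  [BorelSpace E] [FiniteDimensional ℝ E] [NormedAddCommGroup F] [InnerProductSpace ℝ F]
  [FiniteDimensional ℝ F]

lemma ae_eq_zero_of_integral_potential_eq_zero {μ : Measure E} {g : E → F} {R : ℝ}
    (hg : Integrable g μ) (hR : ∀ᵐ y ∂μ, ‖y‖ ≤ R) {t : ℕ → ℝ} {t₀ s : ℝ}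
    (ht : Tendsto t atTop (𝓝[≠] t₀)) (hs : s ≠ t₀) {A : ℕ → Set E}
    (hA : ∀ n, MeasurableSet (A n)) (hA0 : volume (limsup A atTop) ≠ 0)
    (h : ∀ n, ∀ x ∈ A n, ∫ y, ((√|t n - s| + ‖x - y‖) ^ 3)⁻¹ • g y ∂μ = 0) : g =ᵐ[μ] 0 := by
  refine ae_eq_zero_of_forall_inner (𝕜 := ℝ) fun v => ?_
  refine ae_eq_zero_of_forall_moments (R := R) (hg.const_inner v) hR
    (.measurableSet_limsup hA) hA0 fun x hx k => ?_
  have hx' : ∃ᶠ n in atTop, x ∈ A n := by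
    rwa [mem_limsup_iff_frequently_mem] at hx
  have hc₀ : 0 < √|t₀ - s| := Real.sqrt_pos.2 (abs_pos.2 (sub_ne_zero.2 hs.symm))
  have htn : Tendsto t atTop (𝓝 t₀) := ht.mono_right nhdsWithin_le_nhds
  have hc : Tendsto (fun n => √|t n - s|) atTop (𝓝[≠] (√|t₀ - s|)) := by
    refine tendsto_nhdsWithin_of_tendsto_nhds_of_eventually_within _
      ((htn.sub_const s).abs.sqrt) ?_
    have h1 : ∀ᶠ n in atTop, t n ≠ t₀ := ht.eventually self_mem_nhdsWithin
    have h2 : ∀ᶠ n in atTop, t n ≠ 2 * s - t₀ :=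
      htn.eventually_ne (by intro h; apply hs; linarith)
    filter_upwards [h1, h2] with n hn1 hn2 h3
    have h4 : |t n - s| = |t₀ - s| := by
      rw [mem_singleton_iff] at h3
      exact (Real.sqrt_inj (abs_nonneg _) (abs_nonneg _)).1 h3
    rcases abs_eq_abs.1 h4 with h5 | h5
    · exact hn1 (by linarith)
    · exact hn2 (by linarith)
  refine integral_pow_mul_eq_zero_of_frequently (X := fun y => ‖x - y‖) (c₀ := √|t₀ - s|)
    (R := ‖x‖ + R) (by fun_prop) (fun _ => norm_nonneg _) ?_ (hg.const_inner v).ofReal hc₀ ?_ k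
  · filter_upwards [hR] with y hy
    exact (norm_sub_le _ _).trans (by linarith)
  · have hpos : ∀ᶠ n in atTop, 0 < √|t n - s| :=
      (hc.mono_right nhdsWithin_le_nhds).eventually (lt_mem_nhds hc₀)
    refine hc.frequently ((hx'.and_eventually hpos).mono ?_)
    rintro n ⟨hn, hcn⟩
    have h1 := congrArg (fun w => ((inner ℝ v w : ℝ) : ℂ)) (h n x hn)
    simp only [inner_zero_right, Complex.ofReal_zero] at h1
    rw [← integral_inner (integrable_inv_add_norm_cube_smul hg hcn x),
      ← integral_complex_ofReal] at h1
    rw [← h1]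
    refine integral_congr_ae (Eventually.of_forall fun y => ?_)
    simp [inner_smul_right]

/-- A function into a Polish space is almost everywhere measurable as soon as its compositions with
a separating countable family of Carathéodory functions are. -/
lemma aemeasurable_of_caratheodory_family {T ι X F : Type*} [MeasurableSpace T]
    [StandardBorelSpace T] {τ : Measure T} [Countable ι]
    [TopologicalSpace X] [PolishSpace X] [MeasurableSpace X] [BorelSpace X]
    [TopologicalSpace F] [TopologicalSpace.PseudoMetrizableSpace F]
    [SecondCountableTopology F] [T2Space F] [MeasurableSpace F] [BorelSpace F]
    {ψ : ι → T → X → F} {P : T → Prop} (hP : ∀ᵐ s ∂τ, P s)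
    (hψX : ∀ i s, P s → Continuous (ψ i s)) (hψT : ∀ i G, Measurable fun s => ψ i s G)
    (hinj : ∀ s, P s → ∀ G G', (∀ i, ψ i s G = ψ i s G') → G = G') {g : T → X}
    (hg : ∀ i, AEStronglyMeasurable (fun s => ψ i s (g s)) τ)
    {φ : X → ℝ} (hφ : Continuous φ) : AEMeasurable (fun s => φ (g s)) τ := by
  have hae : ∀ᵐ s ∂τ, (∀ i, ψ i s (g s) = (hg i).mk _ s) ∧ P s :=
    (ae_all_iff.2 fun i => (hg i).ae_eq_mk).and hP
  obtain ⟨N, hNsub, hNm, hN0⟩ := exists_measurable_superset_of_null (ae_iff.1 hae)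
  have hSm : MeasurableSet Nᶜ := hNm.compl
  have hSP : ∀ s ∈ Nᶜ, (∀ i, ψ i s (g s) = (hg i).mk _ s) ∧ P s := by
    intro s hs
    by_contra hcon
    exact hs (hNsub hcon)
  have : StandardBorelSpace (Nᶜ : Set T) := hSm.standardBorel
  let Φ : (Nᶜ : Set T) × X → (Nᶜ : Set T) × (ι → F) := fun q => (q.1, fun i => ψ i q.1 q.2)
  have hΦm : Measurable Φ := by
    refine measurable_fst.prodMk (measurable_pi_lambda _ fun i => ?_)
    have h1 := measurable_uncurry_of_continuous_of_measurable
      (u := fun (G : X) (s : (Nᶜ : Set T)) => ψ i s G)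
      (fun s => hψX i s (hSP s s.2).2) (fun G => (hψT i G).comp measurable_subtype_coe)
    exact h1.comp measurable_swap
  have hΦi : Function.Injective Φ := by
    rintro ⟨s, G⟩ ⟨s', G'⟩ heq
    obtain rfl : s = s' := congrArg Prod.fst heq
    have h1 : (fun i => ψ i s G) = fun i => ψ i s G' := congrArg Prod.snd heq
    rw [hinj s (hSP s s.2).2 G G' fun i => congrFun h1 i]
  have hemb : MeasurableEmbedding Φ := hΦm.measurableEmbedding hΦi
  have hmeas : Measurable fun s : (Nᶜ : Set T) => (s, g s) := by
    rw [← hemb.measurable_comp_iff]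
    refine measurable_id.prodMk (measurable_pi_lambda _ fun i => ?_)
    have h1 : (fun s : (Nᶜ : Set T) => ψ i s (g s)) = fun s : (Nᶜ : Set T) => (hg i).mk _ (s : T) :=
      funext fun s => (hSP s s.2).1 i
    change Measurable fun s : (Nᶜ : Set T) => ψ i s (g s)
    rw [h1]
    exact (hg i).stronglyMeasurable_mk.measurable.comp measurable_subtype_coe
  have hfin : Measurable fun s : (Nᶜ : Set T) => φ (g s) :=
    hφ.measurable.comp (measurable_snd.comp hmeas)
  have h5 : τ.restrict Nᶜ = τ :=
    Measure.restrict_eq_self_of_ae_mem (by simpa [ae_iff] using hN0)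
  rw [← h5]
  exact aemeasurable_restrict_of_measurable_subtype hSm hfin

/-- An `L¹`-valued function of time is measurable as soon as enough of its
potentials are: these potentials form an injective Borel map, hence a measurable embedding. -/
lemma aemeasurable_comp_of_potential {μ : Measure E} [SFinite μ] {R : ℝ}
    (hR : ∀ᵐ y ∂μ, ‖y‖ ≤ R) {t : ℕ → ℝ} {t₀ : ℝ}
    (ht : Tendsto t atTop (𝓝[≠] t₀)) {A : ℕ → Set E}
    (hA : ∀ n, MeasurableSet (A n)) (hAne : ∀ n, (A n).Nonempty)
    (hA0 : volume (limsup A atTop) ≠ 0) (g : ℝ → Lp F 1 μ)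
    (hg : ∀ n, ∀ x ∈ A n, AEStronglyMeasurable
      (fun s => ∫ y, ((√|t n - s| + ‖x - y‖) ^ 3)⁻¹ • g s y ∂μ) volume)
    {φ : Lp F 1 μ → ℝ} (hφ : Continuous φ) : AEMeasurable (fun s => φ (g s)) volume := by
  let : MeasurableSpace (Lp F 1 μ) := borel _
  have : BorelSpace (Lp F 1 μ) := ⟨rfl⟩
  have : Fact ((1 : ℝ≥0∞) ≠ ∞) := ⟨one_ne_top⟩
  have : SecondCountableTopology (Lp F 1 μ) := inferInstance
  have : PolishSpace (Lp F 1 μ) := inferInstance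
  let : MeasurableSpace F := borel _
  have : BorelSpace F := ⟨rfl⟩
  have : ∀ n, Nonempty (A n) := fun n => (hAne n).to_subtype
  let x : ℕ × ℕ → E := fun i => (TopologicalSpace.denseSeq (A i.1) i.2 : E)
  have hxmem : ∀ i, x i ∈ A i.1 := fun i => (TopologicalSpace.denseSeq (A i.1) i.2).2
  let ψ : ℕ → E → ℝ → Lp F 1 μ → F := fun n z s G =>
    ∫ y, ((√|t n - s| + ‖z - y‖) ^ 3)⁻¹ • G y ∂μ
  have hint : ∀ G : Lp F 1 μ, Integrable G μ := fun G => L1.integrable_coeFn G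
  have hpos : ∀ s, (∀ n, s ≠ t n) → ∀ n, 0 < √|t n - s| := fun s hs n =>
    Real.sqrt_pos.2 (abs_pos.2 (sub_ne_zero.2 (hs n).symm))
  have hψsub : ∀ n z, ∀ s, (∀ n, s ≠ t n) → ∀ G G', ψ n z s G - ψ n z s G' = ψ n z s (G - G') := by
    intro n z s hs G G'
    change (∫ y, _ ∂μ) - (∫ y, _ ∂μ) = ∫ y, _ ∂μ
    rw [← integral_sub (integrable_inv_add_norm_cube_smul (hint G) (hpos s hs n) z)
      (integrable_inv_add_norm_cube_smul (hint G') (hpos s hs n) z)]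
    refine integral_congr_ae ?_
    filter_upwards [Lp.coeFn_sub G G'] with y hy
    rw [hy, Pi.sub_apply, smul_sub]
  have hψG : ∀ n z, ∀ s, (∀ n, s ≠ t n) → Continuous (ψ n z s) := by
    intro n z s hs
    refine (LipschitzWith.of_dist_le_mul (K := Real.toNNReal (√|t n - s| ^ 3)⁻¹)
      fun G G' => ?_).continuous
    rw [dist_eq_norm, dist_eq_norm, hψsub n z s hs, L1.norm_eq_integral_norm,
      Real.coe_toNNReal _ (by positivity), ← integral_const_mul]
    refine norm_integral_le_of_norm_le ((hint _).norm.const_mul _)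
      (Eventually.of_forall fun y => ?_)
    rw [norm_smul]
    gcongr
    exact norm_inv_add_norm_cube_le (hpos s hs n) _
  have hψz : ∀ n, ∀ s, (∀ n, s ≠ t n) → ∀ G, Continuous fun z => ψ n z s G := by
    intro n s hs G
    refine continuous_of_dominated (bound := fun y => (√|t n - s| ^ 3)⁻¹ * ‖G y‖) ?_ ?_ ?_ ?_
    · exact fun z => (integrable_inv_add_norm_cube_smul (hint G) (hpos s hs n) z).1
    · refine fun z => Eventually.of_forall fun y => ?_
      rw [norm_smul]
      gcongr
      exact norm_inv_add_norm_cube_le (hpos s hs n) _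
    · exact (hint G).norm.const_mul _
    · refine Eventually.of_forall fun y => ?_
      have h1 : ∀ z : E, (√|t n - s| + ‖z - y‖) ^ 3 ≠ 0 := fun z => by
        have := hpos s hs n
        positivity
      exact (Continuous.inv₀ (by fun_prop) h1).smul continuous_const
  have hψs : ∀ n z G, Measurable fun s => ψ n z s G := by
    intro n z G
    have h1 : StronglyMeasurable fun p : ℝ × E =>
        ((√|t n - p.1| + ‖z - p.2‖) ^ 3)⁻¹ • G p.2 := by
      refine StronglyMeasurable.smul ?_ ((Lp.stronglyMeasurable G).comp_measurable measurable_snd)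
      exact Measurable.stronglyMeasurable (by fun_prop)
    exact h1.integral_prod_right'.measurable
  refine aemeasurable_of_caratheodory_family (ψ := fun i : ℕ × ℕ => ψ i.1 (x i))
    (P := fun s => s ≠ t₀ ∧ ∀ n, s ≠ t n)
    ((Measure.ae_ne volume t₀).and (ae_all_iff.2 fun n => Measure.ae_ne volume (t n)))
    (fun i s hs => hψG i.1 (x i) s hs.2) (fun i G => hψs i.1 (x i) G) ?_
    (fun i => hg i.1 (x i) (hxmem i)) hφ
  intro s ⟨hs0, hs⟩ G G' heq
  have h1 : ∀ n, ∀ z ∈ A n, ψ n z s (G - G') = 0 := by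
    intro n
    have h2 : (fun z : A n => ψ n z s (G - G')) = fun _ => 0 := by
      refine Continuous.ext_on (TopologicalSpace.denseRange_denseSeq (A n))
        ((hψz n s hs (G - G')).comp continuous_subtype_val) continuous_const ?_
      rintro _ ⟨m, rfl⟩
      change ψ n (x (n, m)) s (G - G') = 0
      rw [← hψsub n _ s hs, sub_eq_zero]
      exact heq (n, m)
    exact fun z hz => congrFun h2 ⟨z, hz⟩
  have h3 : (G - G' : Lp F 1 μ) =ᵐ[μ] (0 : E → F) :=
    ae_eq_zero_of_integral_potential_eq_zero (hint _) hR ht hs0 hA hA0 h1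
  exact sub_eq_zero.1 ((Lp.eq_zero_iff_ae_eq_zero).2 h3)

end Potential

section Selection

lemma measure_limsup_ge_of_forall_le {X : Type*} [MeasurableSpace X] {μ : Measure X}
    [IsFiniteMeasure μ] {A : ℕ → Set X} (hA : ∀ n, MeasurableSet (A n)) {c : ℝ≥0∞}
    (hc : ∀ n, c ≤ μ (A n)) : c ≤ μ (limsup A atTop) := by
  rw [limsup_eq_iInf_iSup_of_nat]
  simp only [iSup_eq_iUnion, iInf_eq_iInter]
  refine ge_of_tendsto' (tendsto_measure_iInter_atTop (s := fun n => ⋃ i, ⋃ (_ : n ≤ i), A i)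
    (fun n => (MeasurableSet.iUnion fun i => .iUnion fun _ => hA i).nullMeasurableSet)
    ?_ ⟨0, measure_ne_top _ _⟩) fun n => ?_
  · intro m n hmn
    exact iUnion_mono fun i => iUnion_mono' fun h => ⟨hmn.trans h, subset_rfl⟩
  · exact (hc n).trans (measure_mono (subset_iUnion₂_of_subset n le_rfl subset_rfl))

/-- Uncountably many non-null sets recur along some nontrivially convergent sequence of indices. -/
lemma exists_seq_limsup_ne_zero_of_not_countable {X : Type*} [MeasurableSpace X] {μ : Measure X}
    [IsFiniteMeasure μ] {K T : Set ℝ} (hK : IsCompact K) (hTK : T ⊆ K) (hT : ¬ T.Countable)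
    {A : ℝ → Set X} (hA : ∀ t ∈ T, MeasurableSet (A t)) (hA0 : ∀ t ∈ T, μ (A t) ≠ 0) :
    ∃ (t : ℕ → ℝ) (t₀ : ℝ), (∀ n, t n ∈ T) ∧ Tendsto t atTop (𝓝[≠] t₀) ∧
      μ (limsup (fun n => A (t n)) atTop) ≠ 0 := by
  have h1 : T ⊆ ⋃ k : ℕ, {t ∈ T | ((k : ℝ≥0∞))⁻¹ < μ (A t)} := fun t ht => by
    obtain ⟨k, hk⟩ := ENNReal.exists_inv_nat_lt (hA0 t ht)
    exact mem_iUnion.2 ⟨k, ht, hk⟩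
  obtain ⟨k, hk⟩ : ∃ k : ℕ, ¬ {t ∈ T | ((k : ℝ≥0∞))⁻¹ < μ (A t)}.Countable := by
    by_contra! hcon
    exact hT ((countable_iUnion hcon).mono h1)
  have hinf : {t ∈ T | ((k : ℝ≥0∞))⁻¹ < μ (A t)}.Infinite := fun h => hk h.countable
  obtain ⟨t₀, -, ht₀⟩ := hinf.exists_accPt_of_subset_isCompact hK ((sep_subset _ _).trans hTK)
  obtain ⟨t, ht, htT⟩ := exists_seq_forall_of_frequently (accPt_iff_frequently_nhdsNE.1 ht₀)
  refine ⟨t, t₀, fun n => (htT n).1, ht, fun h0 => ?_⟩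
  have h2 := measure_limsup_ge_of_forall_le (fun n => hA _ (htT n).1) (fun n => (htT n).2.le)
  rw [h0, nonpos_iff_eq_zero, ENNReal.inv_eq_zero] at h2
  exact ENNReal.natCast_ne_top k h2

end Selection

section Slices

variable {X F : Type*} [MeasurableSpace X] {μ : Measure X} [NormedAddCommGroup F]

/-- The class in `L¹` of a function, or zero if the function is not integrable. -/
noncomputable def toL1OrZero (μ : Measure X) (G : X → F) : Lp F 1 μ :=
  open Classical in if h : Integrable G μ then h.toL1 G else 0

lemma toL1OrZero_ae_eq_or (G : X → F) :
    (toL1OrZero μ G =ᵐ[μ] G) ∨ (toL1OrZero μ G =ᵐ[μ] 0) := by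
  by_cases h : Integrable G μ
  · left
    rw [toL1OrZero, dif_pos h]
    exact h.coeFn_toL1
  · right
    rw [toL1OrZero, dif_neg h]
    exact Lp.coeFn_zero _ _ _

lemma integral_potential_toL1OrZero {E : Type*} [NormedAddCommGroup E] [MeasurableSpace E]
    [BorelSpace E] [NormedSpace ℝ F] {μ : Measure E} {G : E → F} {c : ℝ} (hc : 0 < c) {x : E}
    {R : ℝ} (hR : ∀ᵐ y ∂μ, ‖x - y‖ ≤ R) :
    ∫ y, ((c + ‖x - y‖) ^ 3)⁻¹ • toL1OrZero μ G y ∂μ = ∫ y, ((c + ‖x - y‖) ^ 3)⁻¹ • G y ∂μ := by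
  by_cases h : Integrable G μ
  · rw [toL1OrZero, dif_pos h]
    refine integral_congr_ae ?_
    filter_upwards [h.coeFn_toL1] with y hy
    rw [hy]
  · have h1 : ¬ Integrable (fun y => ((c + ‖x - y‖) ^ 3)⁻¹ • G y) μ := by
      refine fun h2 => h ?_
      have h3 := h2.bdd_smul (φ := fun y => (c + ‖x - y‖) ^ 3) ((c + R) ^ 3)
        (Measurable.aestronglyMeasurable (by fun_prop)) ?_
      · refine h3.congr (Eventually.of_forall fun y => ?_)
        have : (c + ‖x - y‖) ^ 3 ≠ 0 := by positivity
        exact smul_inv_smul₀ this (G y)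
      · filter_upwards [hR] with y hy
        rw [norm_pow, Real.norm_of_nonneg (by positivity)]
        gcongr
    rw [integral_undef h1, toL1OrZero, dif_neg h]
    refine integral_eq_zero_of_ae ?_
    filter_upwards [Lp.coeFn_zero F 1 μ] with y hy
    rw [hy]
    simp

lemma continuous_integral_norm_restrict (s : Set X) :
    Continuous fun G : Lp F 1 μ => ∫ y in s, ‖G y‖ ∂μ := by
  refine (LipschitzWith.of_dist_le_mul (K := 1) fun G G' => ?_).continuous
  have hi : ∀ H : Lp F 1 μ, Integrable (fun y => ‖H y‖) (μ.restrict s) := fun H =>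
    (L1.integrable_coeFn H).norm.restrict
  rw [NNReal.coe_one, one_mul, dist_eq_norm, dist_eq_norm, L1.norm_eq_integral_norm,
    ← integral_sub (hi G) (hi G')]
  calc ‖∫ y in s, (‖G y‖ - ‖G' y‖) ∂μ‖ ≤ ∫ y in s, ‖(G - G' : Lp F 1 μ) y‖ ∂μ := by
        refine norm_integral_le_of_norm_le (hi _) ?_
        filter_upwards [ae_restrict_of_ae (Lp.coeFn_sub G G')] with y hy
        rw [hy]
        exact abs_norm_sub_norm_le _ _
    _ ≤ ∫ y, ‖(G - G' : Lp F 1 μ) y‖ ∂μ :=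
        setIntegral_le_integral (L1.integrable_coeFn _).norm (Eventually.of_forall fun _ =>
          norm_nonneg _)

lemma lintegral_enorm_restrict_eq (s : Set X) (G : Lp F 1 μ) :
    ∫⁻ y in s, ‖G y‖ₑ ∂μ = ENNReal.ofReal (∫ y in s, ‖G y‖ ∂μ) :=
  (ofReal_integral_norm_eq_lintegral_enorm (L1.integrable_coeFn G).restrict).symm

end Slices

local notation "ℝ³" => EuclideanSpace ℝ (Fin 3)

section Bound

lemma lintegral_le_rpow_mul_measure_univ {X : Type*} [MeasurableSpace X] {μ : Measure X}
    {h : X → ℝ≥0∞} (hh : AEMeasurable h μ) {p : ℝ} (hp : 1 < p) :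
    ∫⁻ a, h a ∂μ ≤ (∫⁻ a, h a ^ p ∂μ) ^ (1 / p) * μ univ ^ (1 - 1 / p) := by
  have hpq := Real.HolderConjugate.conjExponent hp
  have h1 := ENNReal.lintegral_mul_le_Lp_mul_Lq μ hpq hh (aemeasurable_const (b := (1 : ℝ≥0∞)))
  have h2 : 1 / p.conjExponent = 1 - 1 / p := by
    have := hpq.inv_add_inv_eq_one
    rw [one_div, one_div]
    linarith
  simpa only [Pi.mul_apply, mul_one, ENNReal.one_rpow, lintegral_const, one_mul, h2] using h1

/-- Dyadic decomposition of the kernel of a potential around its singularity. -/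
lemma enorm_integral_potential_le_tsum {E F : Type*} [NormedAddCommGroup E] [MeasurableSpace E]
    [BorelSpace E] [NormedAddCommGroup F] [NormedSpace ℝ F] {μ : Measure E} {G : E → F}
    (hG : AEStronglyMeasurable G μ) {t s D : ℝ} {x : E} (hst : s ≠ t)
    (hD : ∀ᵐ y ∂μ, √|t - s| + ‖x - y‖ ≤ D) {ρ : ℕ → ℝ} (hρ : ∀ k, ρ k = 2 * D * (1 / 2) ^ k) :
    ‖∫ y, ((√|t - s| + ‖x - y‖) ^ 3)⁻¹ • G y ∂μ‖ₑ ≤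
      ∑' k, ENNReal.ofReal (64 / ρ k ^ 3) * (Ioo (t - ρ k ^ 2) (t + ρ k ^ 2)).indicator
        (fun _ => ∫⁻ y in Metric.ball x (ρ k), ‖G y‖ₑ ∂μ) s := by
  have hc : 0 < √|t - s| := Real.sqrt_pos.2 (abs_pos.2 (sub_ne_zero.2 hst.symm))
  let w : ℕ → ℝ≥0∞ := fun k => ENNReal.ofReal (64 / ρ k ^ 3) *
    (Ioo (t - ρ k ^ 2) (t + ρ k ^ 2)).indicator (fun _ => 1) s
  calc ‖∫ y, ((√|t - s| + ‖x - y‖) ^ 3)⁻¹ • G y ∂μ‖ₑ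
      ≤ ∫⁻ y, ‖((√|t - s| + ‖x - y‖) ^ 3)⁻¹ • G y‖ₑ ∂μ := enorm_integral_le_lintegral_enorm _
    _ ≤ ∫⁻ y, ∑' k, w k * (Metric.ball x (ρ k)).indicator (fun y => ‖G y‖ₑ) y ∂μ := by
        refine lintegral_mono_ae ?_
        filter_upwards [hD] with y hy
        have hd : 0 ≤ ‖x - y‖ := norm_nonneg _
        have hD0 : 0 < D := by linarith
        obtain ⟨k, hk1, hk2⟩ := exists_nat_pow_near_of_lt_one
          (x := (√|t - s| + ‖x - y‖) / D) (y := (1 / 2 : ℝ)) (by positivity)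
          ((div_le_one hD0).2 hy) (by norm_num) (by norm_num)
        rw [lt_div_iff₀ hD0, pow_succ] at hk1
        rw [div_le_iff₀ hD0] at hk2
        have hpow : 0 < (1 / 2 : ℝ) ^ k * D := by positivity
        have hρk : ρ k = 2 * ((1 / 2) ^ k * D) := by rw [hρ]; ring
        have h1 : y ∈ Metric.ball x (ρ k) := by
          rw [Metric.mem_ball', dist_eq_norm, hρk]
          linarith
        have h2 : s ∈ Ioo (t - ρ k ^ 2) (t + ρ k ^ 2) := by
          have h3 : √|t - s| < ρ k := by rw [hρk]; linarith
          have h4 := (Real.sqrt_lt' (hc.trans h3)).1 h3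
          rw [abs_lt] at h4
          constructor <;> linarith
        refine le_trans ?_ (ENNReal.le_tsum k)
        simp only [w, indicator_of_mem h1, indicator_of_mem h2, mul_one]
        rw [enorm_smul]
        gcongr
        rw [Real.enorm_of_nonneg (by positivity)]
        refine ENNReal.ofReal_le_ofReal ?_
        have h5 : (64 : ℝ) / ρ k ^ 3 = ((ρ k / 4) ^ 3)⁻¹ := by
          rw [div_pow, inv_div]
          norm_num
        rw [h5]
        have h6 : 0 < ρ k / 4 := by rw [hρk]; positivity
        have h7 : ρ k / 4 ≤ √|t - s| + ‖x - y‖ := by rw [hρk]; linarith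
        gcongr
    _ = ∑' k, w k * ∫⁻ y in Metric.ball x (ρ k), ‖G y‖ₑ ∂μ := by
        rw [lintegral_tsum fun k =>
          (hG.enorm.indicator Metric.isOpen_ball.measurableSet).const_mul _]
        congr 1 with k
        rw [lintegral_const_mul'' _ (hG.enorm.indicator Metric.isOpen_ball.measurableSet),
          lintegral_indicator Metric.isOpen_ball.measurableSet]
    _ = _ := by
        congr 1 with k
        by_cases h : s ∈ Ioo (t - ρ k ^ 2) (t + ρ k ^ 2) <;> simp [w, h]

lemma rpow_lintegral_le_morreyNorm {F : Type*} [NormedAddCommGroup F] {p q ρ : ℝ} (hp : 0 < p)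
    (hρ : 0 < ρ) (f : ℝ → ℝ³ → F) (t : ℝ) (x : ℝ³) :
    (∫⁻ s in Ioo (t - ρ ^ 2) (t + ρ ^ 2), ∫⁻ y in Metric.ball x ρ,
      ENNReal.ofReal (‖f s y‖ ^ p)) ^ (1 / p) ≤
      ENNReal.ofReal (ρ ^ (5 / p - 5 / q)) * morreyNorm p q f := by
  set J := ∫⁻ s in Ioo (t - ρ ^ 2) (t + ρ ^ 2), ∫⁻ y in Metric.ball x ρ,
      ENNReal.ofReal (‖f s y‖ ^ p) with hJ
  have h1 : (ENNReal.ofReal (ρ ^ (-(5 : ℝ) * (1 - p / q))) * J) ^ (1 / p) ≤ morreyNorm p q f :=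
    le_iSup_of_le t (le_iSup_of_le x (le_iSup_of_le ⟨ρ, hρ⟩ le_rfl))
  have h2 : ENNReal.ofReal (ρ ^ (5 / p - 5 / q)) *
      ENNReal.ofReal (ρ ^ (-(5 : ℝ) * (1 - p / q))) ^ (1 / p) = 1 := by
    rw [ENNReal.ofReal_rpow_of_nonneg (by positivity) (by positivity),
      ← ENNReal.ofReal_mul (by positivity), ← Real.rpow_mul hρ.le, ← Real.rpow_add hρ]
    have : 5 / p - 5 / q + -5 * (1 - p / q) * (1 / p) = 0 := by
      field_simp
      ring
    rw [this, Real.rpow_zero, ENNReal.ofReal_one]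
  calc J ^ (1 / p) = ENNReal.ofReal (ρ ^ (5 / p - 5 / q)) *
        (ENNReal.ofReal (ρ ^ (-(5 : ℝ) * (1 - p / q))) * J) ^ (1 / p) := by
        rw [ENNReal.mul_rpow_of_nonneg _ _ (by positivity), ← mul_assoc, h2, one_mul]
    _ ≤ _ := by gcongr

/-- Hölder's inequality for Morrey functions on parabolic balls. -/
lemma lintegral_parabolicBall_le {F : Type*} [NormedAddCommGroup F] {p q ρ : ℝ}
    (hp : 1 < p) (hρ : 0 < ρ) {μ : Measure ℝ³} (hμ : μ ≤ volume) {f G : ℝ → ℝ³ → F} {t : ℝ} {x : ℝ³}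
    (hG : ∀ s, AEStronglyMeasurable (G s) μ) (hGf : ∀ s, ∀ᵐ y ∂μ, ‖G s y‖ ≤ ‖f s y‖)
    (hm : AEMeasurable (fun s => ∫⁻ y in Metric.ball x ρ, ‖G s y‖ₑ ∂μ) volume) :
    ∫⁻ s in Ioo (t - ρ ^ 2) (t + ρ ^ 2), ∫⁻ y in Metric.ball x ρ, ‖G s y‖ₑ ∂μ ≤
      ENNReal.ofReal ((2 * volume.real (Metric.ball (0 : ℝ³) 1)) ^ (1 - 1 / p) * ρ ^ (5 - 5 / q)) *
        morreyNorm p q f := by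
  have hp0 : 0 < p := by linarith
  have hp1 : 0 ≤ 1 - 1 / p := by
    rw [sub_nonneg, div_le_one hp0]
    exact hp.le
  set I := Ioo (t - ρ ^ 2) (t + ρ ^ 2) with hI
  set c := volume.real (Metric.ball (0 : ℝ³) 1) with hc
  have hc0 : 0 ≤ c := measureReal_nonneg
  have hB : volume (Metric.ball x ρ) = ENNReal.ofReal (ρ ^ 3 * c) := by
    rw [Measure.addHaar_ball _ _ hρ.le, ENNReal.ofReal_mul (by positivity), hc,
      ofReal_measureReal measure_ball_lt_top.ne, finrank_euclideanSpace_fin]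
  have hIv : volume I = ENNReal.ofReal (2 * ρ ^ 2) := by
    rw [hI, Real.volume_Ioo]
    ring_nf
  let J : ℝ → ℝ≥0∞ := fun s => ∫⁻ y in Metric.ball x ρ, ENNReal.ofReal (‖f s y‖ ^ p)
  have h1 : ∀ s, (∫⁻ y in Metric.ball x ρ, ‖G s y‖ₑ ∂μ) ^ p ≤
      J s * volume (Metric.ball x ρ) ^ (p - 1) := by
    intro s
    calc (∫⁻ y in Metric.ball x ρ, ‖G s y‖ₑ ∂μ) ^ p
        ≤ ((∫⁻ y in Metric.ball x ρ, ‖G s y‖ₑ ^ p ∂μ) ^ (1 / p) *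
          (μ.restrict (Metric.ball x ρ)) univ ^ (1 - 1 / p)) ^ p := by
          gcongr
          exact lintegral_le_rpow_mul_measure_univ (hG s).restrict.enorm hp
      _ = (∫⁻ y in Metric.ball x ρ, ‖G s y‖ₑ ^ p ∂μ) * μ (Metric.ball x ρ) ^ (p - 1) := by
          rw [ENNReal.mul_rpow_of_nonneg _ _ hp0.le, ← ENNReal.rpow_mul, ← ENNReal.rpow_mul,
            one_div_mul_cancel hp0.ne', ENNReal.rpow_one, Measure.restrict_apply_univ, sub_mul,
            one_div_mul_cancel hp0.ne', one_mul]
      _ ≤ J s * volume (Metric.ball x ρ) ^ (p - 1) := by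
          have hle : ∫⁻ y in Metric.ball x ρ, ‖G s y‖ₑ ^ p ∂μ ≤ J s := by
            refine (lintegral_mono_ae ?_).trans
              (lintegral_mono' (Measure.restrict_mono_measure hμ _) le_rfl)
            filter_upwards [ae_restrict_of_ae (hGf s)] with y hy
            rw [← ofReal_norm, ENNReal.ofReal_rpow_of_nonneg (norm_nonneg _) hp0.le]
            gcongr
          have := hμ (Metric.ball x ρ)
          have : 0 ≤ p - 1 := by linarith
          gcongr
  have hBtop : volume (Metric.ball x ρ) ^ (p - 1) ≠ ∞ :=
    ENNReal.rpow_ne_top_of_nonneg (by linarith) measure_ball_lt_top.ne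
  calc ∫⁻ s in I, ∫⁻ y in Metric.ball x ρ, ‖G s y‖ₑ ∂μ
      ≤ (∫⁻ s in I, (∫⁻ y in Metric.ball x ρ, ‖G s y‖ₑ ∂μ) ^ p) ^ (1 / p) *
          (volume.restrict I) univ ^ (1 - 1 / p) :=
        lintegral_le_rpow_mul_measure_univ hm.restrict hp
    _ ≤ (∫⁻ s in I, J s * volume (Metric.ball x ρ) ^ (p - 1)) ^ (1 / p) *
          volume I ^ (1 - 1 / p) := by
        rw [Measure.restrict_apply_univ]
        gcongr with s
        exact h1 s
    _ = (∫⁻ s in I, J s) ^ (1 / p) *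
          (volume (Metric.ball x ρ) ^ (1 - 1 / p) * volume I ^ (1 - 1 / p)) := by
        rw [lintegral_mul_const' _ _ hBtop, ENNReal.mul_rpow_of_nonneg _ _ (by positivity),
          ← ENNReal.rpow_mul, mul_assoc, sub_mul, mul_one_div_cancel hp0.ne', one_mul]
    _ ≤ (ENNReal.ofReal (ρ ^ (5 / p - 5 / q)) * morreyNorm p q f) *
          (volume (Metric.ball x ρ) ^ (1 - 1 / p) * volume I ^ (1 - 1 / p)) := by
        gcongr
        exact rpow_lintegral_le_morreyNorm hp0 hρ f t x
    _ = _ := by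
        rw [mul_right_comm, hB, hIv, ← ENNReal.mul_rpow_of_nonneg _ _ hp1,
          ← ENNReal.ofReal_mul (by positivity), ENNReal.ofReal_rpow_of_nonneg (by positivity) hp1,
          ← ENNReal.ofReal_mul (by positivity)]
        congr 2
        have h3 : ρ ^ 3 * c * (2 * ρ ^ 2) = (2 * c) * ρ ^ (5 : ℝ) := by
          norm_cast
          ring
        rw [h3, Real.mul_rpow (by positivity) (by positivity), ← Real.rpow_mul hρ.le,
          mul_left_comm, ← Real.rpow_add hρ]
        congr 2
        ring

end Bound

section Localized

lemma integral_rieszPot_two_eq {x₀ x : ℝ³} {r s t : ℝ} {F : ℝ → ℝ³ → ℝ³}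
    (hF : ∀ s, ∀ y ∉ Metric.ball x₀ r, F s y = 0) (hst : s ≠ t) (hx : x ∈ Metric.ball x₀ r) :
    ∫ y, ((√|t - s| + ‖x - y‖) ^ (-(5 - 2) : ℝ)) • F s y =
      ∫ y, ((√|t - s| + ‖x - y‖) ^ 3)⁻¹ •
        toL1OrZero (volume.restrict (Metric.ball x₀ r)) (F s) y
        ∂(volume.restrict (Metric.ball x₀ r)) := by
  have hc : 0 < √|t - s| := Real.sqrt_pos.2 (abs_pos.2 (sub_ne_zero.2 hst.symm))
  rw [integral_potential_toL1OrZero hc (R := 2 * r),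
    setIntegral_eq_integral_of_forall_compl_eq_zero]
  · refine integral_congr_ae (Eventually.of_forall fun y => ?_)
    have h1 : (-(5 - 2) : ℝ) = -((3 : ℕ) : ℝ) := by norm_num
    simp only
    rw [h1, Real.rpow_neg (by positivity), Real.rpow_natCast]
  · intro y hy
    rw [hF s y hy, smul_zero]
  · filter_upwards [ae_restrict_mem Metric.isOpen_ball.measurableSet] with y hy
    rw [Metric.mem_ball] at hx hy
    rw [← dist_eq_norm]
    linarith [dist_triangle_right x y x₀]

/-- A function whose potential does not vanish on a large set has measurable time slices. -/
lemma aemeasurable_lintegral_toL1OrZero {a b r : ℝ} {x₀ : ℝ³} {F : ℝ → ℝ³ → ℝ³}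
    (hF : ∀ s, ∀ y ∉ Metric.ball x₀ r, F s y = 0) {T : Set ℝ} (hT : ¬ T.Countable)
    (hTab : T ⊆ Icc a b) {A : ℝ → Set ℝ³} (hA : ∀ t ∈ T, MeasurableSet (A t))
    (hA0 : ∀ t ∈ T, volume (A t) ≠ 0) (hAB : ∀ t ∈ T, A t ⊆ Metric.ball x₀ r)
    (hne : ∀ t ∈ T, ∀ x ∈ A t, rieszPot 2 F t x ≠ 0) (x : ℝ³) (ρ : ℝ) :
    AEMeasurable (fun s => ∫⁻ y in Metric.ball x ρ,
      ‖toL1OrZero (volume.restrict (Metric.ball x₀ r)) (F s) y‖ₑ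
        ∂(volume.restrict (Metric.ball x₀ r))) volume := by
  have : IsFiniteMeasure (volume.restrict (Metric.ball x₀ r)) :=
    ⟨by rw [Measure.restrict_apply_univ]; exact measure_ball_lt_top⟩
  obtain ⟨t, t₀, htT, ht, hlim⟩ := exists_seq_limsup_ne_zero_of_not_countable
    (μ := volume.restrict (Metric.ball x₀ r)) isCompact_Icc hTab hT hA fun t ht => by
      rw [Measure.restrict_apply (hA t ht), inter_eq_left.2 (hAB t ht)]
      exact hA0 t ht
  simp_rw [lintegral_enorm_restrict_eq]
  refine AEMeasurable.ennreal_ofReal (aemeasurable_comp_of_potential (R := ‖x₀‖ + r) ?_ ht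
    (fun n => hA _ (htT n)) (fun n => ?_) (fun h0 => hlim ?_)
    (fun s => toL1OrZero (volume.restrict (Metric.ball x₀ r)) (F s)) (fun n z hz => ?_)
    (continuous_integral_norm_restrict _))
  · filter_upwards [ae_restrict_mem Metric.isOpen_ball.measurableSet] with y hy
    rw [Metric.mem_ball, dist_eq_norm] at hy
    linarith [norm_le_norm_add_norm_sub' y x₀]
  · exact nonempty_of_measure_ne_zero (hA0 _ (htT n))
  · exact nonpos_iff_eq_zero.1 ((Measure.restrict_apply_le _ _).trans h0.le)
  · have h1 : AEStronglyMeasurable (fun s => ∫ y, ((√|t n - s| + ‖z - y‖) ^ (-(5 - 2) : ℝ)) • F s y)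
        volume := by
      by_contra hcon
      exact hne _ (htT n) z hz (integral_undef fun h => hcon h.1)
    refine h1.congr ?_
    filter_upwards [Measure.ae_ne volume (t n)] with s hs
    exact integral_rieszPot_two_eq hF hs (hAB _ (htT n) hz)

lemma summable_dyadic_rpow {D q : ℝ} (hD : 0 < D) (hq : 5 / 2 < q) (c : ℝ) {ρ : ℕ → ℝ}
    (hρ : ∀ k, ρ k = 2 * D * (1 / 2) ^ k) :
    Summable fun k => 64 / ρ k ^ 3 * (c * ρ k ^ (5 - 5 / q)) := by
  have hρ0 : ∀ k, 0 < ρ k := fun k => by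
    rw [hρ]
    positivity
  obtain ⟨θ, hθ⟩ : ∃ θ : ℝ, θ = 2 - 5 / q := ⟨_, rfl⟩
  have hθ0 : 0 < θ := by
    rw [hθ, sub_pos, div_lt_iff₀ (by linarith)]
    linarith
  have h1 : ∀ k, 64 / ρ k ^ 3 * (c * ρ k ^ (5 - 5 / q)) =
      64 * c * (2 * D) ^ θ * ((1 / 2 : ℝ) ^ θ) ^ k := by
    intro k
    have h2 : ρ k ^ (5 - 5 / q) = ρ k ^ 3 * ρ k ^ θ := by
      rw [← Real.rpow_natCast (ρ k) 3, ← Real.rpow_add (hρ0 k)]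
      congr 1
      rw [hθ]
      push_cast
      ring
    have h3 : ρ k ^ θ = (2 * D) ^ θ * ((1 / 2 : ℝ) ^ θ) ^ k := by
      rw [hρ, Real.mul_rpow (by positivity) (by positivity), ← Real.rpow_natCast,
        ← Real.rpow_natCast, ← Real.rpow_mul (by norm_num), ← Real.rpow_mul (by norm_num),
        mul_comm θ]
    have h4 := (hρ0 k).ne'
    rw [mul_assoc _ _ (((1 / 2 : ℝ) ^ θ) ^ k), ← h3, h2]
    field_simp
  simp_rw [h1]
  refine (summable_geometric_of_lt_one (by positivity) ?_).mul_left _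
  exact Real.rpow_lt_one (by norm_num) (by norm_num) hθ0

lemma exists_enorm_rieszPot_two_le {a b r p q : ℝ} (x₀ : ℝ³) (hab : a < b) (hr : 0 < r)
    (hp : 1 < p) (hq : 5 / 2 < q) :
    ∃ K : ℝ, 0 ≤ K ∧ ∀ f F : ℝ → ℝ³ → ℝ³, (∀ s y, ‖F s y‖ ≤ ‖f s y‖) →
      (∀ s y, (s, y) ∉ Ioo a b ×ˢ Metric.ball x₀ r → F s y = 0) →
      (∀ x ρ, AEMeasurable (fun s => ∫⁻ y in Metric.ball x ρ,
        ‖toL1OrZero (volume.restrict (Metric.ball x₀ r)) (F s) y‖ₑ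
          ∂(volume.restrict (Metric.ball x₀ r))) volume) →
      ∀ t ∈ Ioo a b, ∀ x ∈ Metric.ball x₀ r,
        ‖rieszPot 2 F t x‖ₑ ≤ ENNReal.ofReal K * morreyNorm p q f := by
  set D : ℝ := √(b - a) + 2 * r with hD
  have hD0 : 0 < D := by positivity
  obtain ⟨ρ, hρ⟩ : ∃ ρ : ℕ → ℝ, ∀ k, ρ k = 2 * D * (1 / 2) ^ k := ⟨_, fun _ => rfl⟩
  have hρ0 : ∀ k, 0 < ρ k := fun k => by
    rw [hρ]
    positivity
  set c : ℝ := (2 * volume.real (Metric.ball (0 : ℝ³) 1)) ^ (1 - 1 / p) with hc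
  have hc0 : 0 ≤ c := Real.rpow_nonneg (mul_nonneg zero_le_two measureReal_nonneg) _
  set K : ℕ → ℝ := fun k => 64 / ρ k ^ 3 * (c * ρ k ^ (5 - 5 / q)) with hK
  have hK0 : ∀ k, 0 ≤ K k := fun k => by
    have := hρ0 k
    positivity
  have hKs : Summable K := summable_dyadic_rpow hD0 hq c hρ
  refine ⟨∑' k, K k, tsum_nonneg hK0, fun f F hFf hF hm t ht x hx => ?_⟩
  set μ := volume.restrict (Metric.ball x₀ r) with hμ
  have hFB : ∀ s, ∀ y ∉ Metric.ball x₀ r, F s y = 0 := fun s y hy => hF s y fun h => hy h.2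
  have hGm : ∀ s, AEStronglyMeasurable (toL1OrZero μ (F s)) μ := fun s =>
    Lp.aestronglyMeasurable _
  have hGf : ∀ s, ∀ᵐ y ∂μ, ‖toL1OrZero μ (F s) y‖ ≤ ‖f s y‖ := by
    intro s
    rcases toL1OrZero_ae_eq_or (μ := μ) (F s) with h | h
    · filter_upwards [h] with y hy
      rw [hy]
      exact hFf s y
    · filter_upwards [h] with y hy
      rw [hy]
      simp
  calc ‖rieszPot 2 F t x‖ₑ
      ≤ ∫⁻ s, ‖∫ y, ((√|t - s| + ‖x - y‖) ^ (-(5 - 2) : ℝ)) • F s y‖ₑ :=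
        by
          rw [rieszPot]
          exact enorm_integral_le_lintegral_enorm _
    _ ≤ ∫⁻ s, ∑' k, ENNReal.ofReal (64 / ρ k ^ 3) *
          (Ioo (t - ρ k ^ 2) (t + ρ k ^ 2)).indicator
            (fun s => ∫⁻ y in Metric.ball x (ρ k), ‖toL1OrZero μ (F s) y‖ₑ ∂μ) s := by
        refine lintegral_mono_ae ?_
        filter_upwards [Measure.ae_ne volume t] with s hs
        by_cases hsab : s ∈ Ioo a b
        · rw [integral_rieszPot_two_eq hFB hs hx]
          refine (enorm_integral_potential_le_tsum (hGm s) hs (D := D) ?_ hρ).trans_eq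
            (tsum_congr fun k => by simp only [indicator_apply])
          filter_upwards [ae_restrict_mem Metric.isOpen_ball.measurableSet] with y hy
          have h1 : √|t - s| ≤ √(b - a) := by
            refine Real.sqrt_le_sqrt (abs_le.2 ⟨?_, ?_⟩) <;> linarith [ht.1, ht.2, hsab.1, hsab.2]
          rw [Metric.mem_ball] at hx hy
          rw [← dist_eq_norm]
          linarith [dist_triangle_right x y x₀]
        · have h1 : ∀ y, F s y = 0 := fun y => hF s y fun h => hsab h.1
          simp [h1]
    _ = ∑' k, ENNReal.ofReal (64 / ρ k ^ 3) * ∫⁻ s in Ioo (t - ρ k ^ 2) (t + ρ k ^ 2),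
          ∫⁻ y in Metric.ball x (ρ k), ‖toL1OrZero μ (F s) y‖ₑ ∂μ := by
        rw [lintegral_tsum fun k => ((hm x (ρ k)).indicator measurableSet_Ioo).const_mul _]
        congr 1 with k
        rw [lintegral_const_mul'' _ ((hm x (ρ k)).indicator measurableSet_Ioo),
          lintegral_indicator measurableSet_Ioo]
    _ ≤ ∑' k, ENNReal.ofReal (K k) * morreyNorm p q f := by
        refine ENNReal.tsum_le_tsum fun k => ?_
        have h1 := hρ0 k
        rw [hK, ENNReal.ofReal_mul (by positivity), mul_assoc]
        gcongr
        exact lintegral_parabolicBall_le hp h1 Measure.restrict_le_self hGm hGf (hm x (ρ k))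
    _ = ENNReal.ofReal (∑' k, K k) * morreyNorm p q f := by
        rw [ENNReal.tsum_mul_right, ENNReal.ofReal_tsum_of_nonneg hK0 hKs]

/-- Bounded functions supported in a parabolic cylinder belong to Morrey spaces. -/
lemma exists_morreyNorm_le_of_enorm_le {F : Type*} [NormedAddCommGroup F] {a b r σ q : ℝ}
    (x₀ : ℝ³) (hab : a < b) (hσ : 0 < σ) (hσq : σ ≤ q) :
    ∃ C : ℝ, 0 ≤ C ∧ ∀ (v : ℝ → ℝ³ → F) (M : ℝ≥0∞),
      (∀ t x, (t, x) ∉ Ioo a b ×ˢ Metric.ball x₀ r → v t x = 0) → (∀ t x, ‖v t x‖ₑ ≤ M) →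
      morreyNorm σ q v ≤ ENNReal.ofReal C * M := by
  set c := volume.real (Metric.ball (0 : ℝ³) 1) with hc
  have hc0 : 0 ≤ c := measureReal_nonneg
  set β := volume.real (Metric.ball x₀ r) with hβ
  have hβ0 : 0 ≤ β := measureReal_nonneg
  have hba : 0 < b - a := sub_pos.2 hab
  have hq : 0 < q := hσ.trans_le hσq
  have hσq' : σ / q ≤ 1 := (div_le_one hq).2 hσq
  refine ⟨(2 * c + (b - a) * β) ^ (1 / σ), by positivity, fun v M hv hM => ?_⟩
  refine iSup_le fun t₀ => iSup_le fun x₁ => iSup_le fun ⟨ρ, hρ⟩ => ?_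
  simp only
  have hvM : ∀ t x, ENNReal.ofReal (‖v t x‖ ^ σ) ≤ M ^ σ := fun t x => by
    rw [← ENNReal.ofReal_rpow_of_nonneg (norm_nonneg _) hσ.le, ofReal_norm]
    exact ENNReal.rpow_le_rpow (hM t x) hσ.le
  set J := ∫⁻ t in Ioo (t₀ - ρ ^ 2) (t₀ + ρ ^ 2), ∫⁻ x in Metric.ball x₁ ρ,
    ENNReal.ofReal (‖v t x‖ ^ σ) with hJ
  have hJ1 : J ≤ M ^ σ * ENNReal.ofReal (2 * c * ρ ^ 5) := by
    calc J ≤ ∫⁻ t in Ioo (t₀ - ρ ^ 2) (t₀ + ρ ^ 2), ∫⁻ x in Metric.ball x₁ ρ, M ^ σ :=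
          lintegral_mono fun t => lintegral_mono fun x => hvM t x
      _ = M ^ σ * ENNReal.ofReal (2 * c * ρ ^ 5) := by
          have h1 : ENNReal.ofReal (2 * c * ρ ^ 5) =
              ENNReal.ofReal (ρ ^ 3) * ENNReal.ofReal c * ENNReal.ofReal (2 * ρ ^ 2) := by
            rw [← ENNReal.ofReal_mul (by positivity), ← ENNReal.ofReal_mul (by positivity)]
            ring_nf
          rw [setLIntegral_const, setLIntegral_const, Measure.addHaar_ball _ _ hρ.le,
            Real.volume_Ioo, finrank_euclideanSpace_fin, h1, hc,
            ofReal_measureReal measure_ball_lt_top.ne]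
          ring_nf
  have hJ2 : J ≤ M ^ σ * ENNReal.ofReal ((b - a) * β) := by
    calc J ≤ ∫⁻ t, ∫⁻ x, ENNReal.ofReal (‖v t x‖ ^ σ) :=
          (lintegral_mono fun t => setLIntegral_le_lintegral _ _).trans
            (setLIntegral_le_lintegral _ _)
      _ ≤ ∫⁻ t, (Ioo a b).indicator (fun _ => ∫⁻ x, (Metric.ball x₀ r).indicator
            (fun _ => M ^ σ) x) t := by
          refine lintegral_mono fun t => ?_
          by_cases ht : t ∈ Ioo a b
          · rw [indicator_of_mem ht]
            refine lintegral_mono fun x => ?_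
            by_cases hx : x ∈ Metric.ball x₀ r
            · rw [indicator_of_mem hx]
              exact hvM t x
            · simp [hv t x fun h => hx h.2, hσ.ne']
          · have h1 : ∀ x, v t x = 0 := fun x => hv t x fun h => ht h.1
            simp [h1, hσ.ne']
      _ = M ^ σ * ENNReal.ofReal ((b - a) * β) := by
          rw [lintegral_indicator measurableSet_Ioo, setLIntegral_const,
            lintegral_indicator Metric.isOpen_ball.measurableSet, setLIntegral_const,
            Real.volume_Ioo, ENNReal.ofReal_mul hba.le, hβ,
            ofReal_measureReal measure_ball_lt_top.ne]
          ring
  have hkey : ENNReal.ofReal (ρ ^ (-(5 : ℝ) * (1 - σ / q))) * J ≤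
      M ^ σ * ENNReal.ofReal (2 * c + (b - a) * β) := by
    rcases le_total ρ 1 with h | h
    · refine (mul_le_mul_right hJ1 _).trans ?_
      rw [mul_left_comm, ← ENNReal.ofReal_mul (by positivity)]
      gcongr
      have h1 : ρ ^ (-(5 : ℝ) * (1 - σ / q)) * ρ ^ 5 ≤ 1 := by
        rw [← Real.rpow_natCast ρ 5, ← Real.rpow_add hρ]
        refine Real.rpow_le_one hρ.le h ?_
        have : 0 ≤ σ / q := by positivity
        push_cast
        linarith
      calc ρ ^ (-(5 : ℝ) * (1 - σ / q)) * (2 * c * ρ ^ 5)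
          = 2 * c * (ρ ^ (-(5 : ℝ) * (1 - σ / q)) * ρ ^ 5) := by ring
        _ ≤ 2 * c * 1 := by gcongr
        _ ≤ 2 * c + (b - a) * β := by
            have : 0 ≤ (b - a) * β := by positivity
            linarith
    · refine (mul_le_mul_right hJ2 _).trans ?_
      rw [mul_left_comm, ← ENNReal.ofReal_mul (by positivity)]
      gcongr
      have h1 : ρ ^ (-(5 : ℝ) * (1 - σ / q)) ≤ 1 :=
        Real.rpow_le_one_of_one_le_of_nonpos h (by linarith)
      calc ρ ^ (-(5 : ℝ) * (1 - σ / q)) * ((b - a) * β) ≤ 1 * ((b - a) * β) := by gcongr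
        _ ≤ 2 * c + (b - a) * β := by linarith
  calc (ENNReal.ofReal (ρ ^ (-(5 : ℝ) * (1 - σ / q))) * J) ^ (1 / σ)
      ≤ (M ^ σ * ENNReal.ofReal (2 * c + (b - a) * β)) ^ (1 / σ) := by gcongr
    _ = ENNReal.ofReal ((2 * c + (b - a) * β) ^ (1 / σ)) * M := by
        rw [ENNReal.mul_rpow_of_nonneg _ _ (by positivity), ← ENNReal.rpow_mul,
          mul_one_div_cancel hσ.ne', ENNReal.rpow_one,
          ENNReal.ofReal_rpow_of_nonneg (by positivity) (by positivity), mul_comm]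

/-- A function with nonzero Morrey norm does not vanish on uncountably many sets of positive
measure, one in each time slice. -/
lemma exists_not_countable_of_morreyNorm_ne_zero {F : Type*} [NormedAddCommGroup F] {σ q : ℝ}
    (hσ : 0 < σ) {v : ℝ → ℝ³ → F} (hv : morreyNorm σ q v ≠ 0) :
    ∃ (T : Set ℝ) (A : ℝ → Set ℝ³), ¬ T.Countable ∧ (∀ t ∈ T, MeasurableSet (A t)) ∧
      (∀ t ∈ T, volume (A t) ≠ 0) ∧ ∀ t ∈ T, ∀ x ∈ A t, v t x ≠ 0 := by
  have h1 : ∃ (t₀ : ℝ) (x₁ : ℝ³) (ρ : ℝ), ∫⁻ t in Ioo (t₀ - ρ ^ 2) (t₀ + ρ ^ 2),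
      ∫⁻ x in Metric.ball x₁ ρ, ENNReal.ofReal (‖v t x‖ ^ σ) ≠ 0 := by
    by_contra! hcon
    refine hv ?_
    simp [morreyNorm, hcon, hσ]
  obtain ⟨t₀, x₁, ρ, h1⟩ := h1
  set H : ℝ → ℝ≥0∞ := fun t => ∫⁻ x in Metric.ball x₁ ρ, ENNReal.ofReal (‖v t x‖ ^ σ) with hH
  choose h hhm hhle hheq using fun t => exists_measurable_le_lintegral_eq
    (volume.restrict (Metric.ball x₁ ρ)) fun x => ENNReal.ofReal (‖v t x‖ ^ σ)
  refine ⟨{t | H t ≠ 0}, fun t => {x | h t x ≠ 0}, fun hcount => h1 ?_, fun t _ => ?_,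
    fun t ht h0 => ht ?_, fun t _ x hx h0 => hx ?_⟩
  · have h2 : H =ᵐ[volume.restrict (Ioo (t₀ - ρ ^ 2) (t₀ + ρ ^ 2))] 0 :=
      ae_restrict_of_ae (ae_iff.2 (hcount.measure_zero volume))
    rw [lintegral_congr_ae h2]
    simp
  · exact (hhm t (measurableSet_singleton 0)).compl
  · have h3 : h t =ᵐ[volume] 0 := ae_iff.2 h0
    simp only [hH]
    rw [hheq t, lintegral_congr_ae (ae_restrict_of_ae h3)]
    simp
  · have h4 : h t x ≤ ENNReal.ofReal (‖v t x‖ ^ σ) := hhle t x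
    rw [h0, norm_zero, Real.zero_rpow hσ.ne', ENNReal.ofReal_zero] at h4
    exact nonpos_iff_eq_zero.1 h4

end Localized

end Auxiliary

/-- Localized estimate for the Riesz potential I₂: with 2 < p ≤ q, 5 < q,
ν = 1 - (q-5)/(5q) and σ = min{p/ν, q}, if f ∈ M^{p/2,q/2} then
𝟙_Q I₂(𝟙_Q f) ∈ M^{σ,q}. -/
theorem riesz2_localized (a b r p q : ℝ) (x₀ : EuclideanSpace ℝ (Fin 3))
    (hab : a < b) (hr : 0 < r) (hp : 2 < p) (hpq : p ≤ q) (hq : 5 < q) :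
    ∃ C : ℝ, 0 < C ∧
      ∀ f : ℝ → EuclideanSpace ℝ (Fin 3) → EuclideanSpace ℝ (Fin 3),
        morreyNorm (min (p / (1 - (q - 5) / (5 * q))) q) q
            (fun t x => (Set.Ioo a b ×ˢ Metric.ball x₀ r).indicator
              (fun z => rieszPot 2
                (fun s y => (Set.Ioo a b ×ˢ Metric.ball x₀ r).indicator
                  (fun w => f w.1 w.2) (s, y)) z.1 z.2) (t, x)) ≤
          ENNReal.ofReal C * morreyNorm (p / 2) (q / 2) f := by
  have hq0 : 0 < q := by linarith
  set σ := min (p / (1 - (q - 5) / (5 * q))) q with hσ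
  have hσ0 : 0 < σ := by
    refine lt_min (div_pos (by linarith) ?_) hq0
    rw [sub_pos, div_lt_one (by positivity)]
    linarith
  obtain ⟨K, hK0, hK⟩ := exists_enorm_rieszPot_two_le (p := p / 2) (q := q / 2) x₀ hab hr
    (by linarith) (by linarith)
  obtain ⟨C, hC0, hC⟩ := exists_morreyNorm_le_of_enorm_le (F := EuclideanSpace ℝ (Fin 3))
    (r := r) x₀ hab hσ0 (min_le_right _ _)
  refine ⟨C * K + 1, by positivity, fun f => ?_⟩
  set Q := Set.Ioo a b ×ˢ Metric.ball x₀ r with hQ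
  set F : ℝ → EuclideanSpace ℝ (Fin 3) → EuclideanSpace ℝ (Fin 3) :=
    fun s y => Q.indicator (fun w => f w.1 w.2) (s, y) with hF
  set v : ℝ → EuclideanSpace ℝ (Fin 3) → EuclideanSpace ℝ (Fin 3) :=
    fun t x => Q.indicator (fun z => rieszPot 2 F z.1 z.2) (t, x) with hv
  have hFQ : ∀ s y, (s, y) ∉ Q → F s y = 0 := fun s y h => Set.indicator_of_notMem h _
  have hvQ : ∀ t x, (t, x) ∉ Q → v t x = 0 := fun t x h => Set.indicator_of_notMem h _
  have hFf : ∀ s y, ‖F s y‖ ≤ ‖f s y‖ := fun s y =>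
    norm_indicator_le_norm_self (fun w : ℝ × EuclideanSpace ℝ (Fin 3) => f w.1 w.2) (s, y)
  by_cases h0 : morreyNorm σ q v = 0
  · rw [h0]
    exact zero_le
  obtain ⟨T, A, hT, hA, hA0, hAv⟩ := exists_not_countable_of_morreyNorm_ne_zero hσ0 h0
  have hAQ : ∀ t ∈ T, ∀ x ∈ A t, (t, x) ∈ Q := fun t ht x hx =>
    of_not_not fun h => hAv t ht x hx (hvQ t x h)
  have hm := aemeasurable_lintegral_toL1OrZero (a := a) (b := b)
    (fun s y hy => hFQ s y fun h => hy h.2) hT (fun t ht => by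
      obtain ⟨x, hx⟩ := nonempty_of_measure_ne_zero (hA0 t ht)
      exact Set.Ioo_subset_Icc_self (hAQ t ht x hx).1) hA hA0
    (fun t ht x hx => (hAQ t ht x hx).2) fun t ht x hx h => hAv t ht x hx (by
      change Q.indicator (fun z => rieszPot 2 F z.1 z.2) (t, x) = 0
      rw [Set.indicator_of_mem (hAQ t ht x hx)]
      exact h)
  refine (hC v (ENNReal.ofReal K * morreyNorm (p / 2) (q / 2) f) hvQ fun t x => ?_).trans ?_
  · by_cases h : (t, x) ∈ Q
    · simp only [hv]
      rw [Set.indicator_of_mem h]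
      exact hK f F hFf hFQ hm t h.1 x h.2
    · rw [hvQ t x h, enorm_zero]
      exact zero_le
  · rw [← mul_assoc, ← ENNReal.ofReal_mul hC0]
    gcongr
    linarith
end
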